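/- Let U_B ⊂ U(4) be a partially invertible universal set with a = |U_M|/|U_B|, let t ≥ 1 be an integer, ε' < 1 − P(t), some constant 0 < C < 1, and for each n let k ≥ (10t + n²t − nt + n + log₂(1/ε')) / log₂(1/(1+(C−1)a)). Then there exists n₀ ≥ ⌊2.5·log₂(4t)⌋ such that for all n ≥ n₀ and every 0 < ε < 1, the n-qubit ensemble block^L(B₁) is an ε-approximate unitary t-design on U(2^n) whenever L ≥ (4nt + log₂(1/ε)) / log₂(1/η), where η = (P(t) + ε')/(1 − a^k)^{n−1} + (1 − (1 − a^k)^{n−1})/(1 − a^k)^{n−1} and B₁ is the uniform ensemble on the relaxed seed U^k. -/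

import Mathlib

open MeasureTheory Matrix
open scoped Classical ComplexOrder

noncomputable section

/-- We equip the unitary group with its Borel σ-algebra. -/
instance unitaryGroupMeasurableSpace {ξ : Type*} [Fintype ξ] [DecidableEq ξ] :
    MeasurableSpace (Matrix.unitaryGroup ξ ℂ) := borel _

instance unitaryGroupBorelSpace {ξ : Type*} [Fintype ξ] [DecidableEq ξ] :
    BorelSpace (Matrix.unitaryGroup ξ ℂ) := ⟨rfl⟩

/-- The spectral-gap bound
`P(t) = (1 + (1/2)·(425·⌊log₂(4t)⌋²·t⁵·t^{3.1/ln 2})⁻¹)^{-1/3}`. -/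
def Pgap (t : ℕ) : ℝ :=
  (1 + (1 / 2) * (425 * ((⌊Real.logb 2 (4 * t)⌋ : ℤ) : ℝ) ^ 2 * (t : ℝ) ^ 5 *
      (t : ℝ) ^ ((3.1 : ℝ) / Real.log 2))⁻¹) ^ (-(1 / 3 : ℝ))

/-- The `t`-fold tensor (Kronecker) power `U^{⊗t}` of a matrix `U`. -/
def tpowMat {ξ : Type*} [Fintype ξ] (t : ℕ) (U : Matrix ξ ξ ℂ) :
    Matrix (Fin t → ξ) (Fin t → ξ) ℂ :=
  fun x y => ∏ s, U (x s) (y s)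

/-- The Haar-averaged `t`-twirl `∫ U^{⊗t} ρ U^{†⊗t} dμ_H(U)`, defined entrywise. -/
def haarChannel {ξ : Type*} [Fintype ξ] [DecidableEq ξ] (t : ℕ)
    (μH : Measure (Matrix.unitaryGroup ξ ℂ))
    (ρ : Matrix (Fin t → ξ) (Fin t → ξ) ℂ) :
    Matrix (Fin t → ξ) (Fin t → ξ) ℂ :=
  fun x y => ∫ U, (tpowMat t ((U : Matrix ξ ξ ℂ)) * ρ * (tpowMat t ((U : Matrix ξ ξ ℂ)))ᴴ) x y ∂μH

/-- The ensemble `{p i, V i}` is an `ε`-approximate unitary `t`-design (strong definition):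
for every positive semidefinite `ρ`,
`(1−ε)·∫ U^{⊗t} ρ U^{†⊗t} dμ_H  ≤  Σ_i p_i V_i^{⊗t} ρ V_i^{†⊗t}  ≤  (1+ε)·∫ U^{⊗t} ρ U^{†⊗t} dμ_H`
in the positive semidefinite order. -/
def IsApproxDesign {ξ : Type*} [Fintype ξ] [DecidableEq ξ] {ι : Type*} [Fintype ι]
    (t : ℕ) (ε : ℝ) (μH : Measure (Matrix.unitaryGroup ξ ℂ))
    (p : ι → ℝ) (V : ι → Matrix ξ ξ ℂ) : Prop :=
  ∀ ρ : Matrix (Fin t → ξ) (Fin t → ξ) ℂ, ρ.PosSemidef →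
    (∑ i, (p i : ℂ) • (tpowMat t (V i) * ρ * (tpowMat t (V i))ᴴ)
        - ((1 - ε : ℝ) : ℂ) • haarChannel t μH ρ).PosSemidef ∧
    (((1 + ε : ℝ) : ℂ) • haarChannel t μH ρ
        - ∑ i, (p i : ℂ) • (tpowMat t (V i) * ρ * (tpowMat t (V i))ᴴ)).PosSemidef

/-- Index of a pair of qubit basis states as a basis state of `ℂ⁴`. -/
def pairIdx (x y : Fin 2) : Fin 4 := ⟨2 * x.val + y.val, by omega⟩

/-- The `n`-qubit matrix which applies the two-qubit gate `U` to the (distinct) qubits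
`q, q'` and acts as the identity on all other qubits. -/
def applyGate (n : ℕ) (q q' : Fin n) (U : Matrix (Fin 4) (Fin 4) ℂ) :
    Matrix (Fin n → Fin 2) (Fin n → Fin 2) ℂ :=
  fun x y =>
    if (∀ r, r ≠ q → r ≠ q' → x r = y r) then
      U (pairIdx (x q) (x q')) (pairIdx (y q) (y q')) else 0

/-- One block: a first layer of nearest-neighbour two-qubit gates `f i` on qubit pairs
`(0,1), (2,3), …`, followed by a second layer of gates `g i` on qubit pairs
`(1,2), (3,4), …` (`n` even; odd `n` analogous, the last qubit pair being dropped). -/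
def blockUnitary (n : ℕ)
    (f : Fin (n / 2) → Matrix (Fin 4) (Fin 4) ℂ)
    (g : Fin ((n - 1) / 2) → Matrix (Fin 4) (Fin 4) ℂ) :
    Matrix (Fin n → Fin 2) (Fin n → Fin 2) ℂ :=
  (List.ofFn fun i : Fin ((n - 1) / 2) =>
      applyGate n ⟨2 * i.val + 1, by omega⟩ ⟨2 * i.val + 2, by omega⟩ (g i)).prod *
  (List.ofFn fun i : Fin (n / 2) =>
      applyGate n ⟨2 * i.val, by omega⟩ ⟨2 * i.val + 1, by omega⟩ (f i)).prod

/-- The product `U_{f 0} ⋯ U_{f (k-1)}` of a word of unitaries, as a `4 × 4` matrix. -/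
def wordMat {k : ℕ} (f : Fin k → Matrix.unitaryGroup (Fin 4) ℂ) :
    Matrix (Fin 4) (Fin 4) ℂ :=
  (List.ofFn fun i => ((f i : Matrix (Fin 4) (Fin 4) ℂ))).prod

/-- A word of length `k` over the seed `UB` with at least one letter outside `UM`:
the index set of the uniform ensemble `B₁` on the relaxed seed `𝒰^k = 𝒰_{B^k} ∖ 𝒰_{M^k}`. -/
abbrev RelaxedWord (UB UM : Finset (Matrix.unitaryGroup (Fin 4) ℂ)) (k : ℕ) :=
  {f : Fin k → {x // x ∈ UB} // ∃ i, (f i : Matrix.unitaryGroup (Fin 4) ℂ) ∉ UM}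

instance relaxedWordFintype (UB UM : Finset (Matrix.unitaryGroup (Fin 4) ℂ)) (k : ℕ) :
    Fintype (RelaxedWord UB UM k) :=
  inferInstance

set_option linter.all false

section abstractHilbert
variable {E : Type*} [NormedAddCommGroup E] [InnerProductSpace ℂ E] [FiniteDimensional ℂ E]

lemma hs_re_symm (x y : E) : (inner ℂ x y).re = (inner ℂ y x).re := by
  rw [← inner_conj_symm x y, Complex.conj_re]

lemma hs_norm_add_sq (x y : E) : ‖x + y‖ ^ 2 = ‖x‖ ^ 2 + 2 * (inner ℂ x y).re + ‖y‖ ^ 2 :=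
  norm_add_sq (𝕜 := ℂ) x y

lemma hs_norm_sub_sq (x y : E) : ‖x - y‖ ^ 2 = ‖x‖ ^ 2 - 2 * (inner ℂ x y).re + ‖y‖ ^ 2 :=
  norm_sub_sq (𝕜 := ℂ) x y

lemma hs_re_self (x : E) : (inner ℂ x x).re = ‖x‖ ^ 2 :=
  inner_self_eq_norm_sq (𝕜 := ℂ) x

lemma hs_re_le (x y : E) : (inner ℂ x y).re ≤ ‖x‖ * ‖y‖ :=
  re_inner_le_norm (𝕜 := ℂ) x y

lemma hs_proj_re (K : Submodule ℂ E) (v : E) :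
    (inner ℂ v (K.starProjection v)).re = ‖K.starProjection v‖ ^ 2 := by
  have h := Submodule.inner_starProjection_left_eq_right K v (K.starProjection v)
  rw [Submodule.starProjection_eq_self_iff.2 (Submodule.starProjection_apply_mem K v)] at h
  rw [← h, hs_re_self]

lemma hs_proj_compl_sq (K : Submodule ℂ E) (v : E) :
    ‖v - K.starProjection v‖ ^ 2 = ‖v‖ ^ 2 - ‖K.starProjection v‖ ^ 2 := by
  rw [hs_norm_sub_sq, hs_proj_re]; ring

lemma hs_proj_min (K : Submodule ℂ E) (v w : E) (hw : w ∈ K) :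
    ‖v - K.starProjection v‖ ≤ ‖v - w‖ := by
  have h1 : v - K.starProjection v = (v - w) - K.starProjection (v - w) := by
    rw [map_sub, Submodule.starProjection_eq_self_iff.2 hw]; abel
  rw [h1]
  have := hs_proj_compl_sq K (v - w)
  refine le_of_sq_le_sq ?_ (norm_nonneg _)
  rw [this]; nlinarith [sq_nonneg ‖K.starProjection (v - w)‖]

/-- Pair lemma. -/
lemma hs_pair_aux (K L : Submodule ℂ E) (ε : ℝ) (hε0 : 0 ≤ ε) (hε : ε ≤ 1)
    (h : ∀ x ∈ K, ∀ y ∈ L, x ∈ (K ⊓ L)ᗮ → y ∈ (K ⊓ L)ᗮ → ‖inner ℂ x y‖ ≤ ε * ‖x‖ * ‖y‖)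
    (v : E) (hv : v ∈ (K ⊓ L)ᗮ) :
    -ε * (‖v - K.starProjection v‖ ^ 2 + ‖v - L.starProjection v‖ ^ 2) ≤
      2 * (inner ℂ (v - K.starProjection v) (v - L.starProjection v)).re := by
  have hperp : ∀ M : Submodule ℂ E, K ⊓ L ≤ M → M.starProjection v ∈ (K ⊓ L)ᗮ := by
    intro M hM
    rw [Submodule.mem_orthogonal] at hv ⊢
    intro u hu
    rw [← Submodule.inner_starProjection_left_eq_right,
      Submodule.starProjection_eq_self_iff.2 (hM hu)]
    exact hv u hu
  have hc := h _ (Submodule.starProjection_apply_mem K v) _ (Submodule.starProjection_apply_mem L v)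
    (hperp K inf_le_left) (hperp L inf_le_right)
  rw [hs_proj_compl_sq, hs_proj_compl_sq]
  have e1 := hs_proj_re K v
  have e2 := hs_proj_re L v
  set x := K.starProjection v
  set y := L.starProjection v
  have hre : (inner ℂ (v - x) (v - y)).re
      = ‖v‖ ^ 2 - ‖x‖ ^ 2 - ‖y‖ ^ 2 + (inner ℂ x y).re := by
    simp only [inner_sub_left, inner_sub_right, Complex.sub_re]
    rw [hs_re_self, e2, hs_re_symm x v, e1]; ring
  rw [hre]
  have hcabs : |(inner ℂ x y).re| ≤ ε * ‖x‖ * ‖y‖ := le_trans (Complex.abs_re_le_norm _) hc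
  have hxy := hs_norm_add_sq x y
  have hcs : ‖x‖ ^ 2 + ‖y‖ ^ 2 ≤ ‖v‖ * ‖x + y‖ := by
    have := hs_re_le v (x + y)
    rw [inner_add_right, Complex.add_re, e1, e2] at this
    exact this
  set c := (inner ℂ x y).re
  have hcl := (abs_le.1 hcabs)
  have hxn := norm_nonneg x
  have hyn := norm_nonneg y
  have hvn := norm_nonneg v
  have hab : 2 * (‖x‖ * ‖y‖) ≤ ‖x‖ ^ 2 + ‖y‖ ^ 2 := by nlinarith [sq_nonneg (‖x‖ - ‖y‖)]
  obtain ⟨N, hN⟩ : ∃ N, N = ‖x‖ ^ 2 + ‖y‖ ^ 2 := ⟨_, rfl⟩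
  obtain ⟨V, hV⟩ : ∃ V, V = ‖v‖ ^ 2 := ⟨_, rfl⟩
  have hN0 : 0 ≤ N := by rw [hN]; positivity
  have hV0 : 0 ≤ V := by rw [hV]; positivity
  have h1 : N ^ 2 ≤ V * (N + 2 * c) := by
    have : N ^ 2 ≤ (‖v‖ * ‖x + y‖) ^ 2 := by
      apply pow_le_pow_left₀ hN0; rw [hN]; exact hcs
    rw [mul_pow, hxy] at this
    rw [hV, hN] at *; linarith
  have h2c : 2 * c ≤ ε * N := by rw [hN]; nlinarith
  have h2 : N ^ 2 ≤ V * ((1 + ε) * N) := by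
    refine h1.trans (mul_le_mul_of_nonneg_left (by linarith) hV0)
  have h3 : N ≤ (1 + ε) * V := by
    rcases hN0.eq_or_lt with h0 | h0
    · rw [← h0]; positivity
    · have : N * N ≤ N * ((1 + ε) * V) := by nlinarith
      exact le_of_mul_le_mul_left this h0
  have goal' : 0 ≤ 2 * (1 + ε) * V - (2 + ε) * N + 2 * c := by
    rcases hV0.eq_or_lt with h0 | h0
    · have hN' : N = 0 := le_antisymm (by rw [← h0] at h3; simpa using h3) hN0
      have : ‖x‖ ^ 2 = 0 := by nlinarith [sq_nonneg ‖x‖, sq_nonneg ‖y‖]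
      have hx0 : ‖x‖ = 0 := by simpa using this
      rw [hx0] at hcl; rw [hN', ← h0]; simp at hcl; linarith
    · have : 0 ≤ V * (2 * (1 + ε) * V - (2 + ε) * N + 2 * c) := by
        have : 0 ≤ (2 * V - N) * ((1 + ε) * V - N) := by
          apply mul_nonneg <;> nlinarith
        nlinarith
      exact nonneg_of_mul_nonneg_right this h0
  rw [hN, hV] at goal'
  linarith

lemma hs_pair (K L : Submodule ℂ E) (ε : ℝ) (hε0 : 0 ≤ ε) (hε : ε ≤ 1)
    (h : ∀ x ∈ K, ∀ y ∈ L, x ∈ (K ⊓ L)ᗮ → y ∈ (K ⊓ L)ᗮ → ‖inner ℂ x y‖ ≤ ε * ‖x‖ * ‖y‖)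
    (v : E) :
    -ε * (‖v - K.starProjection v‖ ^ 2 + ‖v - L.starProjection v‖ ^ 2) ≤
      2 * (inner ℂ (v - K.starProjection v) (v - L.starProjection v)).re := by
  have hm : v - (K ⊓ L).starProjection v ∈ (K ⊓ L)ᗮ :=
    Submodule.sub_starProjection_mem_orthogonal v
  have := hs_pair_aux K L ε hε0 hε h _ hm
  have hmem := Submodule.starProjection_apply_mem (K ⊓ L) v
  rw [map_sub, map_sub, Submodule.starProjection_eq_self_iff.2 hmem.1,
    Submodule.starProjection_eq_self_iff.2 hmem.2] at this
  simpa using this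

lemma hs_comm_nonneg (K L : Submodule ℂ E)
    (h : ∀ v, K.starProjection (L.starProjection v) = L.starProjection (K.starProjection v))
    (v : E) : 0 ≤ (inner ℂ (v - K.starProjection v) (v - L.starProjection v)).re := by
  set w := v - K.starProjection v with hw
  have h1 : v - L.starProjection v = (w - L.starProjection w) + K.starProjection (v - L.starProjection v) := by
    rw [hw]; simp only [map_sub, h]; abel
  have h2 : inner ℂ w (K.starProjection (v - L.starProjection v)) = 0 :=
    Submodule.starProjection_inner_eq_zero v _ (Submodule.starProjection_apply_mem _ _)
  rw [h1, inner_add_right, h2, add_zero, inner_sub_right, Complex.sub_re, hs_re_self, hs_proj_re]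
  have := Submodule.norm_starProjection_apply_le L w
  nlinarith [norm_nonneg (L.starProjection w), norm_nonneg w]

/-- Chain gap. -/
lemma hs_chain_gap (m : ℕ) (K : Fin m → Submodule ℂ E) (ε : ℝ) (hε0 : 0 ≤ ε) (hε : ε < 1 / 2)
    (hcomm : ∀ i j : Fin m, i.val + 1 < j.val →
      ∀ v, (K i).starProjection ((K j).starProjection v) = (K j).starProjection ((K i).starProjection v))
    (hadj : ∀ i j : Fin m, i.val + 1 = j.val → ∀ x ∈ K i, ∀ y ∈ K j,
      x ∈ (K i ⊓ K j)ᗮ → y ∈ (K i ⊓ K j)ᗮ → ‖inner ℂ x y‖ ≤ ε * ‖x‖ * ‖y‖)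
    (v : E) (hv : v ∈ (⨅ j, K j)ᗮ) :
    (1 - 2 * ε) * ‖v‖ ^ 2 ≤ ∑ j, ‖v - (K j).starProjection v‖ ^ 2 := by
  set H : E →L[ℂ] E := ∑ j, (ContinuousLinearMap.id ℂ E - (K j).starProjection) with hH
  have Happ : ∀ u, H u = ∑ j, (u - (K j).starProjection u) := by
    intro u; simp [hH]
  have hform : ∀ u w, inner ℂ u (H w) = ∑ j, inner ℂ (u - (K j).starProjection u) (w - (K j).starProjection w) := by
    intro u w
    rw [Happ, inner_sum]
    refine Finset.sum_congr rfl fun j _ => ?_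
    rw [inner_sub_left, ← sub_eq_zero]
    have : inner ℂ ((K j).starProjection u) (w - (K j).starProjection w) = 0 :=
      (Submodule.mem_orthogonal _ _).1 (Submodule.sub_starProjection_mem_orthogonal w) _
        (Submodule.starProjection_apply_mem _ _)
    rw [this]; simp
  have hformre : ∀ u, (inner ℂ u (H u)).re = ∑ j, ‖u - (K j).starProjection u‖ ^ 2 := by
    intro u
    rw [hform, Complex.re_sum]
    exact Finset.sum_congr rfl fun j _ => hs_re_self _
  -- lower bound on the square
  have hsq : ∀ u, (1 - 2 * ε) * (∑ j, ‖u - (K j).starProjection u‖ ^ 2) ≤ ‖H u‖ ^ 2 := by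
    intro u
    set a : Fin m → ℝ := fun j => ‖u - (K j).starProjection u‖ ^ 2 with ha
    have ha0 : ∀ j, 0 ≤ a j := fun j => by positivity
    have key : ∀ i j : Fin m, (if i = j then a i else 0)
        - (if i.val + 1 = j.val then ε / 2 * (a i + a j) else 0)
        - (if j.val + 1 = i.val then ε / 2 * (a i + a j) else 0)
        ≤ (inner ℂ (u - (K i).starProjection u) (u - (K j).starProjection u)).re := by
      intro i j
      rcases lt_trichotomy i.val j.val with hlt | heq | hgt
      · have h1 : i ≠ j := fun h => by rw [h] at hlt; exact lt_irrefl _ hlt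
        have h2 : ¬ (j.val + 1 = i.val) := by omega
        rw [if_neg h1, if_neg h2]
        by_cases h3 : i.val + 1 = j.val
        · rw [if_pos h3]
          have := hs_pair (K i) (K j) ε hε0 (by linarith) (hadj i j h3) u
          simp only [ha]; linarith
        · rw [if_neg h3]
          have := hs_comm_nonneg (K i) (K j) (hcomm i j (by omega)) u
          linarith
      · have h1 : i = j := Fin.ext heq
        subst h1
        rw [if_pos rfl, if_neg (by omega), hs_re_self]
        simp [ha]
      · have h1 : i ≠ j := fun h => by rw [h] at hgt; exact lt_irrefl _ hgt
        have h2 : ¬ (i.val + 1 = j.val) := by omega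
        rw [if_neg h1, if_neg h2, hs_re_symm]
        by_cases h3 : j.val + 1 = i.val
        · rw [if_pos h3]
          have := hs_pair (K j) (K i) ε hε0 (by linarith) (hadj j i h3) u
          simp only [ha]; linarith
        · rw [if_neg h3]
          have := hs_comm_nonneg (K j) (K i) (hcomm j i (by omega)) u
          linarith
    have hexp : ‖H u‖ ^ 2 = ∑ i, ∑ j,
        (inner ℂ (u - (K i).starProjection u) (u - (K j).starProjection u)).re := by
      rw [← hs_re_self, Happ, sum_inner, Complex.re_sum]
      refine Finset.sum_congr rfl fun i _ => ?_
      rw [inner_sum, Complex.re_sum]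
    rw [hexp]
    refine le_trans ?_ (Finset.sum_le_sum fun i _ => Finset.sum_le_sum fun j _ => key i j)
    have cnt1 : ∀ (i : Fin m) (c : ℝ), 0 ≤ c → ∑ j : Fin m, (if i.val + 1 = j.val then c else 0) ≤ c := by
      intro i c hc
      by_cases h : i.val + 1 < m
      · rw [Finset.sum_eq_single (⟨i.val + 1, h⟩ : Fin m)]
        · simp
        · intro b _ hb
          rw [if_neg]; intro h'; exact hb (Fin.ext h'.symm)
        · simp
      · rw [Finset.sum_eq_zero]
        · exact hc
        · intro j _; rw [if_neg]; have := j.2; omega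
    have cnt2 : ∀ (i : Fin m) (c : ℝ), 0 ≤ c → ∑ j : Fin m, (if j.val + 1 = i.val then c else 0) ≤ c := by
      intro i c hc
      by_cases h : 1 ≤ i.val
      · rw [Finset.sum_eq_single (⟨i.val - 1, by omega⟩ : Fin m)]
        · simp [h]
        · intro b _ hb
          rw [if_neg]; intro h'; exact hb (Fin.ext (by simp; omega))
        · simp
      · rw [Finset.sum_eq_zero]
        · exact hc
        · intro j _; rw [if_neg]; omega
    have s1 : ∑ i : Fin m, ∑ j : Fin m, (if i.val + 1 = j.val then ε / 2 * (a i + a j) else 0) ≤ ε * ∑ i, a i := by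
      have e : ∀ i j : Fin m, (if i.val + 1 = j.val then ε / 2 * (a i + a j) else 0)
          = (if i.val + 1 = j.val then ε / 2 * a i else 0) + (if i.val + 1 = j.val then ε / 2 * a j else 0) := by
        intro i j; split_ifs <;> ring
      simp_rw [e, Finset.sum_add_distrib]
      have t1 : ∑ i : Fin m, ∑ j : Fin m, (if i.val + 1 = j.val then ε / 2 * a i else 0) ≤ ∑ i, ε / 2 * a i :=
        Finset.sum_le_sum fun i _ => cnt1 i _ (by have := ha0 i; positivity)
      have t2 : ∑ i : Fin m, ∑ j : Fin m, (if i.val + 1 = j.val then ε / 2 * a j else 0) ≤ ∑ i, ε / 2 * a i := by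
        rw [Finset.sum_comm]
        exact Finset.sum_le_sum fun i _ => cnt2 i _ (by have := ha0 i; positivity)
      rw [← Finset.mul_sum] at t1 t2; linarith
    have s2 : ∑ i : Fin m, ∑ j : Fin m, (if j.val + 1 = i.val then ε / 2 * (a i + a j) else 0) ≤ ε * ∑ i, a i := by
      rw [Finset.sum_comm]
      simpa [add_comm] using s1
    simp only [Finset.sum_sub_distrib, Finset.sum_ite_eq, Finset.mem_univ, if_true]
    linarith
  -- kernel
  have hker : H.ker ≤ ⨅ j, K j := by
    intro u hu
    have hu' : H u = 0 := hu
    have h0 := hformre u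
    rw [hu', inner_zero_right, Complex.zero_re] at h0
    rw [Submodule.mem_iInf]
    intro j
    have := (Finset.sum_eq_zero_iff_of_nonneg (fun j _ => by positivity)).1 h0.symm j (Finset.mem_univ _)
    have h1 : u - (K j).starProjection u = 0 := by simpa using this
    rw [← Submodule.starProjection_eq_self_iff, ← sub_eq_zero, ← neg_eq_zero]; simpa using h1
  have hsym : (H : E →ₗ[ℂ] E).IsSymmetric := by
    intro x y
    change inner ℂ (H x) y = inner ℂ x (H y)
    rw [hform x y, ← inner_conj_symm, hform y x, map_sum]
    exact Finset.sum_congr rfl fun j _ => inner_conj_symm _ _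
  have hvr : v ∈ (LinearMap.range (H : E →ₗ[ℂ] E)) := by
    have h1 := hsym.orthogonal_range
    rw [← Submodule.orthogonal_orthogonal (LinearMap.range (H : E →ₗ[ℂ] E)), h1]
    exact Submodule.orthogonal_le hker hv
  obtain ⟨u, hu⟩ := hvr
  have hu' : H u = v := hu
  rw [← hformre v]
  have hq : ‖v‖ ^ 2 = ∑ j, (inner ℂ (v - (K j).starProjection v) (u - (K j).starProjection u)).re := by
    rw [← hs_re_self, ← Complex.re_sum, ← hform, hu']
  have hcs : (‖v‖ ^ 2) ^ 2 ≤ (inner ℂ v (H v)).re * (inner ℂ u (H u)).re := by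
    rw [hformre, hformre, hq]
    refine le_trans ?_ (Finset.sum_mul_sq_le_sq_mul_sq Finset.univ
      (fun j => ‖v - (K j).starProjection v‖) (fun j => ‖u - (K j).starProjection u‖))
    refine pow_le_pow_left₀ ?_ (Finset.sum_le_sum fun j _ => hs_re_le _ _) 2
    rw [← hq]; positivity
  have h3 := hsq u
  rw [hu', ← hformre] at h3
  have hA : 0 ≤ (inner ℂ v (H v)).re := by rw [hformre]; positivity
  have hB : 0 ≤ (inner ℂ u (H u)).re := by rw [hformre]; positivity
  have hc : 0 < 1 - 2 * ε := by linarith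
  rcases (sq_nonneg ‖v‖).eq_or_lt with h0 | h0
  · rw [← h0]; simpa using hA
  · have : (1 - 2 * ε) * (‖v‖ ^ 2) * ‖v‖ ^ 2 ≤ (inner ℂ v (H v)).re * ‖v‖ ^ 2 := by nlinarith
    exact le_of_mul_le_mul_right this h0

end abstractHilbert

section abstractHilbert2
variable {E : Type*} [NormedAddCommGroup E] [InnerProductSpace ℂ E] [FiniteDimensional ℂ E]

/-- joint fixed vectors of a family of operators -/
def fixSub {ι : Type*} (π : ι → E →L[ℂ] E) : Submodule ℂ E where
  carrier := {v | ∀ i, π i v = v}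
  add_mem' := by intro a b ha hb i; rw [map_add, ha i, hb i]
  zero_mem' := by intro i; simp
  smul_mem' := by intro c v hv i; rw [map_smul, hv i]

lemma mem_fixSub {ι : Type*} (π : ι → E →L[ℂ] E) (v : E) : v ∈ fixSub π ↔ ∀ i, π i v = v := Iff.rfl

set_option maxHeartbeats 400000 in
lemma hs_orbit {ι : Type*} [Nonempty ι] (π : ι → E →L[ℂ] E) (hiso : ∀ i v, ‖π i v‖ = ‖v‖)
    (hmul : ∀ i j, ∃ k, ∀ v, π k v = π i (π j v))
    (v : E) (r : ℝ) (hr : ∀ i, ‖π i v - v‖ ≤ r) :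
    ‖v - (fixSub π).starProjection v‖ ≤ r := by
  have hinner : ∀ i x y, inner ℂ (π i x) (π i y) = inner ℂ x y := by
    intro i x y
    exact (LinearMap.norm_map_iff_inner_map_map (π i)).1 (hiso i) x y
  set S : Set E := closure (convexHull ℝ (Set.range fun i => π i v)) with hS
  have hne : S.Nonempty := by
    obtain ⟨i⟩ := ‹Nonempty ι›
    exact ⟨π i v, subset_closure (subset_convexHull ℝ _ ⟨i, rfl⟩)⟩
  have hcl : IsClosed S := isClosed_closure
  have hcv : Convex ℝ S := (convex_convexHull ℝ _).closure
  -- properties of S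
  have hSind : ∀ (T : Set E), IsClosed T → Convex ℝ T → (∀ i, π i v ∈ T) → S ⊆ T := by
    intro T h1 h2 h3
    exact closure_minimal (convexHull_min (by rintro _ ⟨i, rfl⟩; exact h3 i) h2) h1
  have hSmap : ∀ i, ∀ x ∈ S, π i x ∈ S := by
    intro i
    apply hSind ((π i) ⁻¹' S) (hcl.preimage (π i).continuous)
      (hcv.linear_preimage ((π i).toLinearMap.restrictScalars ℝ))
    intro j
    obtain ⟨k, hk⟩ := hmul i j
    change π i (π j v) ∈ S
    rw [← hk]
    exact subset_closure (subset_convexHull ℝ _ ⟨k, rfl⟩)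
  have hScore : ∀ w ∈ fixSub π, ∀ x ∈ S, inner ℂ w (v - x) = 0 := by
    intro w hw
    apply hSind {x | inner ℂ w (v - x) = 0}
    · exact isClosed_eq (by fun_prop) continuous_const
    · intro x hx y hy a b ha hb hab
      have hx' : inner ℂ w (v - x) = 0 := hx
      have hy' : inner ℂ w (v - y) = 0 := hy
      have : v - (a • x + b • y) = (a : ℂ) • (v - x) + (b : ℂ) • (v - y) := by
        have hv : v = (a : ℂ) • v + (b : ℂ) • v := by
          rw [← add_smul, ← Complex.ofReal_add, hab]; simp
        nth_rewrite 1 [hv]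
        rw [smul_sub, smul_sub, Complex.coe_smul, Complex.coe_smul, Complex.coe_smul, Complex.coe_smul]; abel
      change inner ℂ w (v - (a • x + b • y)) = 0
      rw [this, inner_add_right, inner_smul_right, inner_smul_right, hx', hy']; simp
    · intro i
      change inner ℂ w (v - π i v) = 0
      rw [inner_sub_right]
      nth_rewrite 2 [← hw i]
      rw [hinner]; simp
  haveI : ProperSpace E := FiniteDimensional.proper ℂ E
  obtain ⟨m, hm, hmin⟩ := hcl.exists_infDist_eq_dist hne (0 : E)
  have hmle : ∀ x ∈ S, ‖m‖ ≤ ‖x‖ := by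
    intro x hx
    have h1 := Metric.infDist_le_dist_of_mem (x := (0 : E)) hx
    rw [hmin] at h1
    simpa using h1
  have hmfix : m ∈ fixSub π := by
    intro i
    have h1 := hSmap i m hm
    have hmid : (1 / 2 : ℝ) • π i m + (1 / 2 : ℝ) • m ∈ S :=
      hcv h1 hm (by norm_num) (by norm_num) (by norm_num)
    have h2 := hmle _ hmid
    have h3 := parallelogram_law_with_norm ℂ (π i m) m
    rw [← smul_add, norm_smul] at h2
    have h4 : ‖π i m‖ = ‖m‖ := hiso i m
    rw [h4] at h3
    have h5 : ‖π i m - m‖ * ‖π i m - m‖ ≤ 0 := by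
      norm_num at h2
      nlinarith [norm_nonneg m]
    have h6 : ‖π i m - m‖ = 0 := by nlinarith [norm_nonneg (π i m - m)]
    exact sub_eq_zero.1 (norm_eq_zero.1 h6)
  have hproj : (fixSub π).starProjection v = m := by
    refine Submodule.eq_starProjection_of_mem_orthogonal hmfix ?_ 
    rw [Submodule.mem_orthogonal]
    intro w hw; exact hScore w hw m hm
  rw [hproj]
  have : m ∈ Metric.closedBall v r := by
    apply hSind _ Metric.isClosed_closedBall (convex_closedBall v r) _ hm
    intro i; rw [Metric.mem_closedBall, dist_eq_norm]; exact hr i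
  rw [Metric.mem_closedBall, dist_eq_norm] at this
  rwa [norm_sub_rev]

/-- If an operator preserves both `K` and its complement it commutes with the projection. -/
lemma hs_proj_comm_of (K : Submodule ℂ E) (A : E →L[ℂ] E) (h1 : ∀ v ∈ K, A v ∈ K)
    (h2 : ∀ v ∈ Kᗮ, A v ∈ Kᗮ) (v : E) : K.starProjection (A v) = A (K.starProjection v) := by
  apply Submodule.eq_starProjection_of_mem_orthogonal
  · exact h1 _ (Submodule.starProjection_apply_mem _ _)
  · rw [← map_sub]; exact h2 _ (Submodule.sub_starProjection_mem_orthogonal v)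

lemma hs_proj_comm_sym (K L : Submodule ℂ E) (h1 : ∀ v ∈ K, L.starProjection v ∈ K) (v : E) :
    K.starProjection (L.starProjection v) = L.starProjection (K.starProjection v) := by
  refine hs_proj_comm_of K L.starProjection h1 ?_ v
  intro w hw
  rw [Submodule.mem_orthogonal] at hw ⊢
  intro u hu
  rw [← Submodule.inner_starProjection_left_eq_right]
  exact hw _ (h1 u hu)

/-- Detectability lemma, abstract version. -/
lemma hs_detect (K : ℕ → Submodule ℂ E) (m : ℕ)
    (hcomm : ∀ i j : ℕ, i + 1 < j → ∀ v, (K i).starProjection ((K j).starProjection v)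
        = (K j).starProjection ((K i).starProjection v))
    (χ : E) (heven : ∀ a, χ ∈ K (2 * a))
    (y : ℕ → E) (hy : ∀ j, y j = (K (2 * j + 1)).starProjection (y (j + 1)))
    (hym : ∀ j, m ≤ j → y j = χ) :
    (∀ j, y 0 ∈ K (2 * j + 1)) ∧
    ∀ M, ∑ a ∈ Finset.range M, ‖y 0 - (K (2 * a)).starProjection (y 0)‖ ^ 2
      ≤ 4 * (‖χ‖ ^ 2 - ‖y 0‖ ^ 2) := by
  have hcomm' : ∀ i j : ℕ, (i + 1 < j ∨ j + 1 < i ∨ i = j) → ∀ v, (K i).starProjection ((K j).starProjection v)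
        = (K j).starProjection ((K i).starProjection v) := by
    intro i j h v
    rcases h with h | h | h
    · exact hcomm i j h v
    · exact (hcomm j i h v).symm
    · rw [h]
  -- claim B
  have hB : ∀ b j, (∀ i, i < j → (2 * i + 1 + 1 < b ∨ b + 1 < 2 * i + 1 ∨ b = 2 * i + 1)) →
      ‖y 0 - (K b).starProjection (y 0)‖ ≤ ‖y j - (K b).starProjection (y j)‖ := by
    intro b j
    induction j with
    | zero => intro _; exact le_rfl
    | succ j ih =>
      intro h
      refine (ih fun i hi => h i (by omega)).trans ?_
      have hj := h j (by omega)
      rw [hy j, hcomm' b (2 * j + 1) (by omega), ← map_sub]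
      exact Submodule.norm_starProjection_apply_le _ _
  -- claim A
  have hA : ∀ a d, ∀ j, j + d = m + a + 1 → a < j → y j ∈ K (2 * a) := by
    intro a d
    induction d with
    | zero => intro j hj _; rw [hym j (by omega)]; exact heven a
    | succ d ih =>
      intro j hj haj
      have h1 := ih (j + 1) (by omega) (by omega)
      rw [← Submodule.starProjection_eq_self_iff] at h1 ⊢
      rw [hy j, hcomm' _ _ (by omega), h1]
  have hA' : ∀ a j, a < j → y j ∈ K (2 * a) := by
    intro a j h
    rcases le_or_gt j (m + a + 1) with h' | h'
    · exact hA a (m + a + 1 - j) j (by omega) h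
    · rw [hym j (by omega)]; exact heven a
  have hdec : ∀ j, ‖y (j + 1) - y j‖ ^ 2 = ‖y (j + 1)‖ ^ 2 - ‖y j‖ ^ 2 := by
    intro j; rw [hy j, hs_proj_compl_sq]
  have hmono : ∀ j, ‖y j‖ ^ 2 ≤ ‖y (j + 1)‖ ^ 2 := by
    intro j; have := hdec j; nlinarith [sq_nonneg ‖y (j + 1) - y j‖]
  have hmon : Monotone fun j => ‖y j‖ ^ 2 := monotone_nat_of_le_succ hmono
  have hle : ∀ j, ‖y j‖ ^ 2 ≤ ‖χ‖ ^ 2 := by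
    intro j
    have := hmon (le_max_left j m)
    simp only at this
    rwa [hym (max j m) (le_max_right _ _)] at this
  refine ⟨?_, ?_⟩
  · intro j
    have h1 := hB (2 * j + 1) j (fun i hi => by omega)
    have h2 : y j - (K (2 * j + 1)).starProjection (y j) = 0 := by
      rw [sub_eq_zero, eq_comm, Submodule.starProjection_eq_self_iff, hy j]
      exact Submodule.starProjection_apply_mem _ _
    rw [h2, norm_zero] at h1
    rw [← Submodule.starProjection_eq_self_iff, ← sub_eq_zero, ← neg_eq_zero]
    have := norm_le_zero_iff.1 h1
    simpa using this
  · intro M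
    have hterm : ∀ a, ‖y 0 - (K (2 * a)).starProjection (y 0)‖ ^ 2
        ≤ 2 * (‖y (a + 1)‖ ^ 2 - ‖y (a - 1)‖ ^ 2) := by
      intro a
      have h1 := hB (2 * a) (a - 1) (fun i hi => by omega)
      have h2 := hs_proj_min (K (2 * a)) (y (a - 1)) _ (hA' a (a + 1) (by omega))
      have h3 := h1.trans h2
      rcases a with _ | a
      · have h4 := hdec 0
        simp only [zero_add, Nat.zero_sub] at *
        have : ‖y 0 - y 1‖ = ‖y 1 - y 0‖ := norm_sub_rev _ _
        have h5 := pow_le_pow_left₀ (norm_nonneg _) h3 2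
        rw [this, h4] at h5
        have := hmono 0
        simp only [zero_add] at this
        linarith
      · simp only [Nat.add_sub_cancel] at *
        have h4 := hdec a
        have h5 := hdec (a + 1)
        have h6 : ‖y a - y (a + 1 + 1)‖ ≤ ‖y (a + 1) - y a‖ + ‖y (a + 1 + 1) - y (a + 1)‖ := by
          rw [norm_sub_rev]
          have : y (a + 1 + 1) - y a = (y (a + 1) - y a) + (y (a + 1 + 1) - y (a + 1)) := by abel
          rw [this]; exact norm_add_le _ _
        have h7 := pow_le_pow_left₀ (norm_nonneg _) (h3.trans h6) 2
        nlinarith [sq_nonneg (‖y (a + 1) - y a‖ - ‖y (a + 1 + 1) - y (a + 1)‖)]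
    refine (Finset.sum_le_sum fun a _ => hterm a).trans ?_
    have htel : ∀ M, ∑ a ∈ Finset.range M, 2 * (‖y (a + 1)‖ ^ 2 - ‖y (a - 1)‖ ^ 2)
        = 2 * (‖y M‖ ^ 2 - ‖y 0‖ ^ 2) + 2 * (‖y (M - 1)‖ ^ 2 - ‖y 0‖ ^ 2) := by
      intro M
      induction M with
      | zero => simp
      | succ M ih =>
        rw [Finset.sum_range_succ, ih]; simp only [Nat.add_sub_cancel]; ring
    rw [htel]
    have := hle M
    have := hle (M - 1)
    linarith

end abstractHilbert2

section ptensor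
variable {ι κ : Type*} [Fintype ι] [DecidableEq ι] [Fintype κ] [DecidableEq κ]

/-- product tensor -/
def pten (f : ι → Matrix κ κ ℂ) : Matrix (ι → κ) (ι → κ) ℂ := fun x y => ∏ r, f r (x r) (y r)

lemma pten_mul (f g : ι → Matrix κ κ ℂ) : pten f * pten g = pten (fun r => f r * g r) := by
  ext x y
  simp only [pten, Matrix.mul_apply, Finset.prod_univ_sum, Fintype.piFinset_univ, Finset.prod_mul_distrib]

lemma pten_one : pten (fun _ : ι => (1 : Matrix κ κ ℂ)) = 1 := by
  ext x y
  simp only [pten, Matrix.one_apply]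
  by_cases h : x = y
  · subst h; simp
  · rw [if_neg h]
    obtain ⟨r, hr⟩ := Function.ne_iff.1 h
    exact Finset.prod_eq_zero (Finset.mem_univ r) (if_neg hr)

lemma pten_conjTranspose (f : ι → Matrix κ κ ℂ) : (pten f)ᴴ = pten (fun r => (f r)ᴴ) := by
  ext x y
  simp [pten, Matrix.conjTranspose_apply]

lemma pten_smul (c : ι → ℂ) (f : ι → Matrix κ κ ℂ) :
    pten (fun r => c r • f r) = (∏ r, c r) • pten f := by
  ext x y
  simp [pten, Finset.prod_mul_distrib]

/-- one-slot operator -/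
def slot (s : ι) (X : Matrix κ κ ℂ) : Matrix (ι → κ) (ι → κ) ℂ :=
  pten (Function.update (fun _ => (1 : Matrix κ κ ℂ)) s X)

lemma slot_apply (s : ι) (X : Matrix κ κ ℂ) (x y : ι → κ) :
    slot s X x y = X (x s) (y s) * ∏ r ∈ Finset.univ.erase s, (1 : Matrix κ κ ℂ) (x r) (y r) := by
  rw [slot, pten, ← Finset.mul_prod_erase Finset.univ _ (Finset.mem_univ s)]
  congr 1
  · simp
  · refine Finset.prod_congr rfl fun r hr => ?_
    rw [Function.update_of_ne (Finset.ne_of_mem_erase hr)]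

lemma slot_add (s : ι) (X Y : Matrix κ κ ℂ) : slot s (X + Y) = slot s X + slot s Y := by
  ext x y; simp [slot_apply, add_mul]

lemma slot_smul (s : ι) (c : ℂ) (X : Matrix κ κ ℂ) : slot s (c • X) = c • slot s X := by
  ext x y; simp [slot_apply, mul_assoc]

lemma slot_mul (s : ι) (X Y : Matrix κ κ ℂ) : slot s X * slot s Y = slot s (X * Y) := by
  rw [slot, slot, pten_mul, slot]
  congr 1; funext r
  by_cases h : r = s
  · subst h; simp
  · simp [Function.update_of_ne h]

lemma slot_one (s : ι) : slot s (1 : Matrix κ κ ℂ) = 1 := by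
  rw [slot, ← pten_one]; congr 1; funext r
  by_cases h : r = s
  · subst h; simp
  · simp [Function.update_of_ne h]

lemma slot_conjTranspose (s : ι) (X : Matrix κ κ ℂ) : (slot s X)ᴴ = slot s Xᴴ := by
  rw [slot, pten_conjTranspose, slot]; congr 1; funext r
  by_cases h : r = s
  · subst h; simp
  · simp [Function.update_of_ne h]

lemma pten_slot_conj (s : ι) (U U' X : Matrix κ κ ℂ) (h : U * U' = 1) :
    pten (fun _ : ι => U) * slot s X * pten (fun _ : ι => U') = slot s (U * X * U') := by
  rw [slot, slot, pten_mul, pten_mul]; congr 1; funext r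
  by_cases hr : r = s
  · subst hr; simp
  · simp [Function.update_of_ne hr, h]

lemma slot_diag (s : ι) (d : κ → ℂ) :
    slot s (Matrix.diagonal d) = Matrix.diagonal fun x : ι → κ => d (x s) := by
  ext x y
  rw [slot_apply]
  by_cases h : x = y
  · subst h; simp
  · rw [Matrix.diagonal_apply_ne _ h]
    obtain ⟨r, hr⟩ := Function.ne_iff.1 h
    by_cases hrs : r = s
    · subst hrs; rw [Matrix.diagonal_apply_ne _ hr, zero_mul]
    · have : ∏ r ∈ Finset.univ.erase s, (1 : Matrix κ κ ℂ) (x r) (y r) = 0 :=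
        Finset.prod_eq_zero (i := r) (by simp [hrs]) (Matrix.one_apply_ne hr)
      rw [this, mul_zero]

lemma pten_diag (d : κ → ℂ) :
    pten (fun _ : ι => Matrix.diagonal d) = Matrix.diagonal fun x : ι → κ => ∏ s, d (x s) := by
  ext x y
  rw [pten]
  by_cases h : x = y
  · subst h; simp
  · rw [Matrix.diagonal_apply_ne _ h]
    obtain ⟨r, hr⟩ := Function.ne_iff.1 h
    exact Finset.prod_eq_zero (Finset.mem_univ r) (Matrix.diagonal_apply_ne d hr)

end ptensor

section hsspace
variable {I : Type*} [Fintype I] [DecidableEq I]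

/-- Hilbert–Schmidt space of matrices. -/
abbrev HSp (I : Type*) [Fintype I] := EuclideanSpace ℂ (I × I)

def toV (M : Matrix I I ℂ) : HSp I := WithLp.toLp 2 fun p => M p.1 p.2
def toM (v : HSp I) : Matrix I I ℂ := fun x y => v (x, y)

@[simp] lemma toM_toV (M : Matrix I I ℂ) : toM (toV M) = M := rfl
@[simp] lemma toV_toM (v : HSp I) : toV (toM v) = v := rfl
@[simp] lemma toV_apply (M : Matrix I I ℂ) (p : I × I) : toV M p = M p.1 p.2 := rfl
@[simp] lemma toM_apply (v : HSp I) (x y : I) : toM v x y = v (x, y) := rfl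
lemma toM_add (u v : HSp I) : toM (u + v) = toM u + toM v := rfl
lemma toM_sub (u v : HSp I) : toM (u - v) = toM u - toM v := rfl
lemma toM_smul (c : ℂ) (v : HSp I) : toM (c • v) = c • toM v := rfl
lemma toV_add (u v : Matrix I I ℂ) : toV (u + v) = toV u + toV v := rfl
lemma toV_sub (u v : Matrix I I ℂ) : toV (u - v) = toV u - toV v := rfl
lemma toV_smul (c : ℂ) (v : Matrix I I ℂ) : toV (c • v) = c • toV v := rfl
lemma toV_inj {u v : Matrix I I ℂ} (h : toV u = toV v) : u = v := by
  rw [← toM_toV u, h, toM_toV]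

lemma toV_sum {J : Type*} (s : Finset J) (f : J → Matrix I I ℂ) : toV (∑ j ∈ s, f j) = ∑ j ∈ s, toV (f j) := by
  induction s using Finset.induction_on with
  | empty => rfl
  | insert a s ha ih => rw [Finset.sum_insert ha, Finset.sum_insert ha, toV_add, ih]

lemma hsp_inner (u v : HSp I) : inner ℂ u v = ((toM u)ᴴ * toM v).trace := by
  rw [EuclideanSpace.inner_eq_star_dotProduct, Matrix.trace]
  simp only [dotProduct, Matrix.diag_apply, Matrix.mul_apply, Fintype.sum_prod_type, toM, Pi.star_apply,
    Matrix.conjTranspose_apply]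
  rw [Finset.sum_comm]
  refine Finset.sum_congr rfl fun i _ => Finset.sum_congr rfl fun j _ => mul_comm _ _

lemma hsp_norm_sq (v : HSp I) : ‖v‖ ^ 2 = ∑ x, ∑ y, ‖v (x, y)‖ ^ 2 := by
  rw [EuclideanSpace.norm_sq_eq, Fintype.sum_prod_type]

/-- left-right multiplication -/
def lrM (A B : Matrix I I ℂ) : HSp I →L[ℂ] HSp I :=
  LinearMap.toContinuousLinearMap
    { toFun := fun v => toV (A * toM v * B)
      map_add' := by intro u v; rw [toM_add, mul_add, add_mul, toV_add]
      map_smul' := by intro c v; rw [toM_smul, Matrix.mul_smul, Matrix.smul_mul, toV_smul]; rfl }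

lemma lrM_apply (A B : Matrix I I ℂ) (v : HSp I) : lrM A B v = toV (A * toM v * B) := rfl

lemma lrM_mul (A B A' B' : Matrix I I ℂ) (v : HSp I) :
    lrM A B (lrM A' B' v) = lrM (A * A') (B' * B) v := by
  simp only [lrM_apply, toM_toV, mul_assoc]

lemma lrM_one (v : HSp I) : lrM 1 1 v = v := by simp [lrM_apply]

lemma lrM_inner (A B : Matrix I I ℂ) (u v : HSp I) :
    inner ℂ (lrM A B u) v = inner ℂ u (lrM Aᴴ Bᴴ v) := by
  rw [hsp_inner, hsp_inner, lrM_apply, lrM_apply, toM_toV, toM_toV]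
  simp only [Matrix.conjTranspose_mul, mul_assoc]
  rw [Matrix.trace_mul_comm]
  simp only [mul_assoc]

lemma lrM_norm (A B : Matrix I I ℂ) (hA : Aᴴ * A = 1) (hB : B * Bᴴ = 1) (v : HSp I) :
    ‖lrM A B v‖ = ‖v‖ := by
  have h : ‖lrM A B v‖ ^ 2 = ‖v‖ ^ 2 := by
    rw [← hs_re_self, ← hs_re_self, lrM_inner, lrM_mul, hA, hB, lrM_one]
  exact (sq_eq_sq₀ (norm_nonneg _) (norm_nonneg _)).1 h

end hsspace

section adj
variable {ξ : Type*} [Fintype ξ] [DecidableEq ξ] {t : ℕ}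

lemma tpow_eq (U : Matrix ξ ξ ℂ) : tpowMat t U = pten (fun _ : Fin t => U) := rfl

lemma tpow_mul (U V : Matrix ξ ξ ℂ) : tpowMat t (U * V) = tpowMat t U * tpowMat t V := by
  rw [tpow_eq, tpow_eq, tpow_eq, pten_mul]

lemma tpow_one : tpowMat t (1 : Matrix ξ ξ ℂ) = 1 := by rw [tpow_eq, pten_one]

lemma tpow_star (U : Matrix ξ ξ ℂ) : (tpowMat t U)ᴴ = tpowMat t Uᴴ := by
  rw [tpow_eq, tpow_eq, pten_conjTranspose]

/-- the twirl action -/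
def ad (t : ℕ) (A : Matrix ξ ξ ℂ) : HSp (Fin t → ξ) →L[ℂ] HSp (Fin t → ξ) :=
  lrM (tpowMat t A) (tpowMat t A)ᴴ

lemma ad_mul (A B : Matrix ξ ξ ℂ) (v : HSp (Fin t → ξ)) : ad t (A * B) v = ad t A (ad t B v) := by
  rw [ad, ad, ad, lrM_mul, tpow_mul, Matrix.conjTranspose_mul]

lemma ad_one (v : HSp (Fin t → ξ)) : ad t (1 : Matrix ξ ξ ℂ) v = v := by
  rw [ad, tpow_one, Matrix.conjTranspose_one, lrM_one]

lemma ad_inner (A : Matrix ξ ξ ℂ) (u v : HSp (Fin t → ξ)) :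
    inner ℂ (ad t A u) v = inner ℂ u (ad t Aᴴ v) := by
  rw [ad, lrM_inner, ad, tpow_star, tpow_star]

lemma ad_norm (A : Matrix ξ ξ ℂ) (hA : Aᴴ * A = 1) (v : HSp (Fin t → ξ)) : ‖ad t A v‖ = ‖v‖ := by
  have : (tpowMat t A)ᴴ * tpowMat t A = 1 := by rw [tpow_star, ← tpow_mul, hA, tpow_one]
  refine lrM_norm _ _ this ?_ v
  rw [Matrix.conjTranspose_conjTranspose, this]

/-- sum of one-slot operators -/
def tsumM (t : ℕ) (X : Matrix ξ ξ ℂ) : Matrix (Fin t → ξ) (Fin t → ξ) ℂ := ∑ s, slot s X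

lemma tsumM_add (X Y : Matrix ξ ξ ℂ) : tsumM t (X + Y) = tsumM t X + tsumM t Y := by
  simp [tsumM, slot_add, Finset.sum_add_distrib]

lemma tsumM_smul (c : ℂ) (X : Matrix ξ ξ ℂ) : tsumM t (c • X) = c • tsumM t X := by
  simp [tsumM, slot_smul, Finset.smul_sum]

/-- the derived action -/
def dD (t : ℕ) (X : Matrix ξ ξ ℂ) : HSp (Fin t → ξ) →L[ℂ] HSp (Fin t → ξ) :=
  lrM (tsumM t X) 1 - lrM 1 (tsumM t X)

lemma dD_apply (X : Matrix ξ ξ ℂ) (v : HSp (Fin t → ξ)) :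
    dD t X v = toV (tsumM t X * toM v - toM v * tsumM t X) := by
  simp [dD, lrM_apply, toV_sub]

lemma dD_add (X Y : Matrix ξ ξ ℂ) (v : HSp (Fin t → ξ)) : dD t (X + Y) v = dD t X v + dD t Y v := by
  rw [dD_apply, dD_apply, dD_apply, tsumM_add, ← toV_add]; congr 1; noncomm_ring

lemma dD_smul (c : ℂ) (X : Matrix ξ ξ ℂ) (v : HSp (Fin t → ξ)) : dD t (c • X) v = c • dD t X v := by
  rw [dD_apply, dD_apply, tsumM_smul, ← toV_smul]; congr 1
  rw [Matrix.smul_mul, Matrix.mul_smul, smul_sub]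

lemma dD_zero (v : HSp (Fin t → ξ)) : dD t (0 : Matrix ξ ξ ℂ) v = 0 := by
  have := dD_smul (0 : ℂ) (0 : Matrix ξ ξ ℂ) v
  simpa using this

lemma dD_sum {J : Type*} (s : Finset J) (f : J → Matrix ξ ξ ℂ) (v : HSp (Fin t → ξ)) :
    dD t (∑ j ∈ s, f j) v = ∑ j ∈ s, dD t (f j) v := by
  induction s using Finset.induction_on with
  | empty => simp [dD_zero]
  | insert a s ha ih => rw [Finset.sum_insert ha, Finset.sum_insert ha, dD_add, ih]

lemma tsum_conj (U U' X : Matrix ξ ξ ℂ) (h : U * U' = 1) :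
    tpowMat t U * tsumM t X * tpowMat t U' = tsumM t (U * X * U') := by
  simp only [tsumM, Finset.mul_sum, Finset.sum_mul]
  exact Finset.sum_congr rfl fun s _ => by rw [tpow_eq, tpow_eq, pten_slot_conj s U U' X h]

lemma dD_conj (U X : Matrix ξ ξ ℂ) (h : U * Uᴴ = 1) (v : HSp (Fin t → ξ)) :
    dD t (U * X * Uᴴ) (ad t U v) = ad t U (dD t X v) := by
  have h' : Uᴴ * U = 1 := mul_eq_one_comm.1 h
  have h1 : tpowMat t Uᴴ * tpowMat t U = 1 := by rw [← tpow_mul, h', tpow_one]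
  simp only [dD_apply, ad, lrM_apply, toM_toV, ← tsum_conj U Uᴴ X h, tpow_star]
  congr 1
  have a1 : ∀ M, tpowMat t Uᴴ * (tpowMat t U * M) = M := by intro M; rw [← mul_assoc, h1, one_mul]
  simp only [mul_assoc, mul_sub, sub_mul, a1]

lemma dD_norm_le (S : Matrix ξ ξ ℂ) (h : Sᴴ * S = 1) (v : HSp (Fin t → ξ)) :
    ‖dD t S v‖ ≤ 2 * t * ‖v‖ := by
  have hs' : S * Sᴴ = 1 := mul_eq_one_comm.1 h
  have h1 : dD t S v = ∑ s : Fin t, (lrM (slot s S) 1 v - lrM 1 (slot s S) v) := by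
    rw [dD_apply, tsumM]
    simp only [lrM_apply, mul_one, one_mul, ← toV_sub]
    rw [← toV_sum, Finset.sum_sub_distrib, Finset.sum_mul, Finset.mul_sum]
  rw [h1]
  refine (norm_sum_le _ _).trans ?_
  have h2 : ∀ s ∈ (Finset.univ : Finset (Fin t)), ‖lrM (slot s S) 1 v - lrM 1 (slot s S) v‖ ≤ 2 * ‖v‖ := by
    intro s _
    have a : ‖lrM (slot s S) 1 v‖ = ‖v‖ :=
      lrM_norm _ _ (by rw [slot_conjTranspose, slot_mul, h, slot_one]) (by simp) v
    have b : ‖lrM 1 (slot s S) v‖ = ‖v‖ :=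
      lrM_norm _ _ (by simp) (by rw [slot_conjTranspose, slot_mul, hs', slot_one]) v
    refine (norm_sub_le _ _).trans ?_
    rw [a, b]; linarith
  refine (Finset.sum_le_sum h2).trans ?_
  simp; linarith

lemma ad_diag (d : ξ → ℂ) (v : HSp (Fin t → ξ)) (x y : Fin t → ξ) :
    ad t (Matrix.diagonal d) v (x, y) = (∏ s, d (x s)) * star (∏ s, d (y s)) * v (x, y) := by
  rw [ad, lrM_apply, tpow_eq, pten_diag, Matrix.diagonal_conjTranspose]
  simp only [toV_apply, Matrix.mul_diagonal, Matrix.diagonal_mul, toM_apply, Pi.star_apply]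
  ring

lemma dD_diag (d : ξ → ℂ) (v : HSp (Fin t → ξ)) (x y : Fin t → ξ) :
    dD t (Matrix.diagonal d) v (x, y) = (∑ s, d (x s) - ∑ s, d (y s)) * v (x, y) := by
  have : tsumM t (Matrix.diagonal d) = Matrix.diagonal fun x : Fin t → ξ => ∑ s, d (x s) := by
    rw [tsumM]; simp only [slot_diag]
    ext x y
    rw [Matrix.sum_apply]
    by_cases h : x = y
    · subst h; simp
    · simp [Matrix.diagonal_apply_ne _ h]
  rw [dD_apply, this]
  simp only [toV_apply, Matrix.sub_apply, Matrix.mul_diagonal, Matrix.diagonal_mul, toM_apply]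
  ring

lemma exp_diag_apply (θ : ξ → ℝ) (v : HSp (Fin t → ξ)) (x y : Fin t → ξ) :
    ad t (Matrix.diagonal fun i => Complex.exp (Complex.I * θ i)) v (x, y)
      = Complex.exp (Complex.I * ((∑ s, θ (x s) - ∑ s, θ (y s) : ℝ) : ℂ)) * v (x, y) := by
  rw [ad_diag, ← Complex.exp_sum, ← Complex.exp_sum, Complex.star_def, ← Complex.exp_conj, ← Complex.exp_add]
  congr 2
  simp only [map_sum, map_mul, Complex.conj_I, Complex.conj_ofReal]
  push_cast
  rw [mul_sub, Finset.mul_sum, Finset.mul_sum]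
  simp [Finset.sum_neg_distrib, sub_eq_add_neg]

lemma exp_diag_le (θ : ξ → ℝ) (v : HSp (Fin t → ξ)) :
    ‖ad t (Matrix.diagonal fun i => Complex.exp (Complex.I * θ i)) v - v‖
      ≤ ‖dD t (Matrix.diagonal fun i => (θ i : ℂ)) v‖ := by
  refine le_of_sq_le_sq ?_ (norm_nonneg _)
  rw [hsp_norm_sq, hsp_norm_sq]
  refine Finset.sum_le_sum fun x _ => Finset.sum_le_sum fun y _ => ?_
  refine pow_le_pow_left₀ (norm_nonneg _) ?_ 2
  rw [PiLp.sub_apply, exp_diag_apply, dD_diag, ← sub_one_mul, norm_mul, norm_mul]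
  refine mul_le_mul_of_nonneg_right ?_ (norm_nonneg _)
  refine (Real.norm_exp_I_mul_ofReal_sub_one_le).trans ?_
  rw [← Complex.ofReal_sum, ← Complex.ofReal_sum, ← Complex.ofReal_sub, Complex.norm_real]

lemma exp_conj_le (V : Matrix ξ ξ ℂ) (hV : V * Vᴴ = 1) (θ : ξ → ℝ) (v : HSp (Fin t → ξ)) :
    ‖ad t (V * (Matrix.diagonal fun i => Complex.exp (Complex.I * θ i)) * Vᴴ) v - v‖
      ≤ ‖dD t (V * (Matrix.diagonal fun i => (θ i : ℂ)) * Vᴴ) v‖ := by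
  have hV' : Vᴴ * V = 1 := mul_eq_one_comm.1 hV
  obtain ⟨w, hw⟩ : ∃ w, v = ad t V w := ⟨ad t Vᴴ v, by rw [← ad_mul, hV, ad_one]⟩
  rw [hw, dD_conj _ _ hV, ad_mul, ad_mul, ← ad_mul Vᴴ V, hV', ad_one, ← map_sub,
    ad_norm _ hV', ad_norm _ hV']
  exact exp_diag_le θ w

/-- invariance under all exponentials of a Hermitian direction kills the derivative -/
lemma dD_zero_of_exp (V : Matrix ξ ξ ℂ) (hV : V * Vᴴ = 1) (θ : ξ → ℝ) (v : HSp (Fin t → ξ))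
    (h : ∀ c : ℝ, ad t (V * (Matrix.diagonal fun i => Complex.exp (Complex.I * ((c * θ i : ℝ) : ℂ))) * Vᴴ) v = v) :
    dD t (V * (Matrix.diagonal fun i => (θ i : ℂ)) * Vᴴ) v = 0 := by
  have hV' : Vᴴ * V = 1 := mul_eq_one_comm.1 hV
  obtain ⟨w, hw⟩ : ∃ w, v = ad t V w := ⟨ad t Vᴴ v, by rw [← ad_mul, hV, ad_one]⟩
  have hw' : w = ad t Vᴴ v := by rw [hw, ← ad_mul, hV', ad_one]
  have h2 : ∀ c : ℝ, ad t (Matrix.diagonal fun i => Complex.exp (Complex.I * ((c * θ i : ℝ) : ℂ))) w = w := by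
    intro c
    have := congrArg (ad t Vᴴ) (h c)
    rw [← hw', ad_mul, ad_mul, ← hw', ← ad_mul Vᴴ V, hV', ad_one] at this
    exact this
  have h3 : dD t (Matrix.diagonal fun i => (θ i : ℂ)) w = 0 := by
    ext ⟨x, y⟩
    rw [dD_diag]
    change _ = (0 : ℂ)
    by_cases hc : (∑ s, θ (x s) - ∑ s, θ (y s)) = 0
    · rw [← Complex.ofReal_sum, ← Complex.ofReal_sum, ← Complex.ofReal_sub, hc]; simp
    · have h4 := congrArg (fun u : HSp (Fin t → ξ) => u (x, y)) (h2 (Real.pi / (∑ s, θ (x s) - ∑ s, θ (y s))))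
      simp only [exp_diag_apply] at h4
      rw [← Finset.mul_sum, ← Finset.mul_sum, ← mul_sub, div_mul_cancel₀ _ hc, mul_comm Complex.I,
        Complex.exp_pi_mul_I] at h4
      have : w (x, y) = 0 := by linear_combination (-1/2) * h4
      rw [this, mul_zero]
  rw [hw, dD_conj _ _ hV, h3, map_zero]

end adj

section diag
variable {ξ : Type*} [Fintype ξ] [DecidableEq ξ]

lemma herm_diag (X : Matrix ξ ξ ℂ) (hX : X.IsHermitian) :
    ∃ V : Matrix ξ ξ ℂ, V * Vᴴ = 1 ∧ X = V * Matrix.diagonal (fun i => (hX.eigenvalues i : ℂ)) * Vᴴ := by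
  refine ⟨hX.eigenvectorUnitary, ?_, ?_⟩
  · exact (Matrix.mem_unitaryGroup_iff.1 hX.eigenvectorUnitary.2)
  · have := hX.spectral_theorem
    rw [Unitary.conjStarAlgAut_apply] at this
    exact this

open scoped Matrix.Norms.L2Operator in
lemma unitary_log (A : Matrix ξ ξ ℂ) (hA : A ∈ Matrix.unitaryGroup ξ ℂ) :
    ∃ (X : Matrix ξ ξ ℂ) (hX : X.IsHermitian), (∀ i, |hX.eigenvalues i| ≤ Real.pi) ∧
      A = NormedSpace.exp (Complex.I • X) := by
  have hfin : ∀ f : ℂ → ℂ, ContinuousOn f (spectrum ℂ A) := fun f =>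
    A.finite_spectrum.continuousOn f
  haveI : IsStarNormal A := ⟨by
    have h1 := Matrix.mem_unitaryGroup_iff.1 hA
    have h2 := Matrix.mem_unitaryGroup_iff'.1 hA
    rw [Commute, SemiconjBy, h1, h2]⟩
  set X : Matrix ξ ξ ℂ := cfc (fun z : ℂ => (Complex.arg z : ℂ)) A with hXdef
  have hsa : IsSelfAdjoint X := by
    rw [isSelfAdjoint_iff, hXdef, ← cfc_star]; simp
  have hX : X.IsHermitian := hsa
  have hnorm : ‖X‖ ≤ Real.pi :=
    norm_cfc_le Real.pi_pos.le fun y hy => by simpa using Complex.abs_arg_le_pi y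
  refine ⟨X, hX, ?_, ?_⟩
  · intro i
    have h1 : hX.eigenvalues i ∈ spectrum ℝ X := by
      rw [hX.spectrum_real_eq_range_eigenvalues]; exact ⟨i, rfl⟩
    haveI : Nonempty ξ := ⟨i⟩
    have := spectrum.norm_le_norm_of_mem h1
    rw [Real.norm_eq_abs] at this
    exact this.trans hnorm
  · rw [hXdef, ← CFC.exp_eq_normedSpace_exp (𝕜 := ℂ), ← cfc_comp_smul Complex.I NormedSpace.exp _ 
      (by exact Continuous.continuousOn (by rw [← Complex.exp_eq_exp_ℂ]; fun_prop)) ,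
      ← cfc_comp' _ _ A (by exact Continuous.continuousOn (by rw [← Complex.exp_eq_exp_ℂ]; fun_prop)) (hfin _)]
    conv_lhs => rw [← cfc_id' ℂ A]
    refine cfc_congr fun y hy => ?_
    have hy₁ : ‖y‖ = 1 := spectrum.norm_eq_one_of_unitary hA hy
    have : Complex.I * y.arg = Complex.log y :=
      Complex.ext (by simp [Complex.log_re, hy₁]) (by simp [Complex.log_im])
    have hy0 : y ≠ 0 := by intro h; rw [h] at hy₁; simp at hy₁
    simp only [smul_eq_mul]
    rw [this, ← Complex.exp_eq_exp_ℂ, Complex.exp_log hy0]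

open scoped Matrix.Norms.L2Operator in
lemma exp_herm (V : Matrix ξ ξ ℂ) (hV : V * Vᴴ = 1) (θ : ξ → ℝ) :
    NormedSpace.exp (Complex.I • (V * Matrix.diagonal (fun i => (θ i : ℂ)) * Vᴴ))
      = V * (Matrix.diagonal fun i => Complex.exp (Complex.I * θ i)) * Vᴴ := by
  have hu : IsUnit V := IsUnit.of_mul_eq_one _ hV
  have hinv : V⁻¹ = Vᴴ := Matrix.inv_eq_right_inv hV
  have h1 : Complex.I • (V * Matrix.diagonal (fun i => (θ i : ℂ)) * Vᴴ)
      = V * Matrix.diagonal (fun i => Complex.I * (θ i : ℂ)) * V⁻¹ := by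
    rw [hinv, ← Matrix.smul_mul, ← Matrix.mul_smul]; congr 2
    rw [← Matrix.diagonal_smul]; rfl
  rw [h1, Matrix.exp_conj _ _ hu, Matrix.exp_diagonal, hinv]
  congr 3; funext i
  rw [Pi.exp_def, ← Complex.exp_eq_exp_ℂ]

lemma unitary_diag (A : Matrix ξ ξ ℂ) (hA : A ∈ Matrix.unitaryGroup ξ ℂ) :
    ∃ (V : Matrix ξ ξ ℂ) (θ : ξ → ℝ), V * Vᴴ = 1 ∧ (∀ i, |θ i| ≤ Real.pi) ∧
      A = V * (Matrix.diagonal fun i => Complex.exp (Complex.I * θ i)) * Vᴴ := by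
  obtain ⟨X, hX, h1, h2⟩ := unitary_log A hA
  obtain ⟨V, hV, hXV⟩ := herm_diag X hX
  refine ⟨V, hX.eigenvalues, hV, h1, ?_⟩
  rw [h2, ← exp_herm V hV, ← hXV]

lemma diag_exp_unitary (V : Matrix ξ ξ ℂ) (hV : V * Vᴴ = 1) (θ : ξ → ℝ) :
    V * (Matrix.diagonal fun i => Complex.exp (Complex.I * θ i)) * Vᴴ ∈ Matrix.unitaryGroup ξ ℂ := by
  have hV' : Vᴴ * V = 1 := mul_eq_one_comm.1 hV
  rw [Matrix.mem_unitaryGroup_iff, Matrix.star_eq_conjTranspose]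
  simp only [Matrix.conjTranspose_mul, Matrix.conjTranspose_conjTranspose, Matrix.diagonal_conjTranspose]
  have : V * (Matrix.diagonal fun i => Complex.exp (Complex.I * θ i)) * Vᴴ *
      (V * (Matrix.diagonal (star fun i => Complex.exp (Complex.I * θ i)) * Vᴴ))
      = V * ((Matrix.diagonal fun i => Complex.exp (Complex.I * θ i)) * (Vᴴ * V) *
        (Matrix.diagonal (star fun i => Complex.exp (Complex.I * θ i)))) * Vᴴ := by
    simp only [mul_assoc]
  rw [this, hV', mul_one, Matrix.diagonal_mul_diagonal]
  have h1 : (fun i => Complex.exp (Complex.I * θ i) * (star fun i => Complex.exp (Complex.I * θ i)) i) = fun _ => (1 : ℂ) := by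
    funext i
    simp only [Pi.star_apply, Complex.star_def, ← Complex.exp_conj, ← Complex.exp_add, map_mul, Complex.conj_I, Complex.conj_ofReal]
    simp
  rw [h1, Matrix.diagonal_one, mul_one, hV]

/-- fully invariant vectors -/
def invF (t : ℕ) (ξ : Type*) [Fintype ξ] [DecidableEq ξ] : Submodule ℂ (HSp (Fin t → ξ)) :=
  fixSub (fun U : Matrix.unitaryGroup ξ ℂ => ad t (U : Matrix ξ ξ ℂ))

lemma mem_invF {t : ℕ} (v : HSp (Fin t → ξ)) :
    v ∈ invF t ξ ↔ ∀ U ∈ Matrix.unitaryGroup ξ ℂ, ad t U v = v :=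
  ⟨fun h U hU => h ⟨U, hU⟩, fun h U => h U U.2⟩

lemma dD_eq_zero_of_invF {t : ℕ} (v : HSp (Fin t → ξ)) (hv : v ∈ invF t ξ) (X : Matrix ξ ξ ℂ) :
    dD t X v = 0 := by
  have hherm : ∀ Y : Matrix ξ ξ ℂ, Y.IsHermitian → dD t Y v = 0 := by
    intro Y hY
    obtain ⟨V, hV, hYV⟩ := herm_diag Y hY
    rw [hYV]
    refine dD_zero_of_exp V hV hY.eigenvalues v fun c => ?_
    exact (mem_invF v).1 hv _ (diag_exp_unitary V hV fun i => c * hY.eigenvalues i)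
  have hdec : X = (1 / 2 : ℂ) • (X + Xᴴ) + (-Complex.I / 2) • (Complex.I • (X - Xᴴ)) := by
    rw [smul_smul]
    have : -Complex.I / 2 * Complex.I = 1 / 2 := by
      have := Complex.I_mul_I; linear_combination (-1/2) * this
    rw [this, ← smul_add]
    have : X + Xᴴ + (X - Xᴴ) = (2 : ℂ) • X := by rw [two_smul]; abel
    rw [this, smul_smul]; norm_num
  rw [hdec, dD_add, dD_smul, dD_smul, hherm, hherm]
  · simp
  · rw [Matrix.IsHermitian, Matrix.conjTranspose_smul, Matrix.conjTranspose_sub, Matrix.conjTranspose_conjTranspose]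
    simp only [Complex.star_def, Complex.conj_I, neg_smul, ← smul_neg, neg_sub]
  · rw [Matrix.IsHermitian, Matrix.conjTranspose_add, Matrix.conjTranspose_conjTranspose, add_comm]

end diag

section fft
variable {α : Type*} [Fintype α] [DecidableEq α] {t : ℕ}

/-- permutation operators -/
def permM (σ : Equiv.Perm (Fin t)) : Matrix (Fin t → α) (Fin t → α) ℂ :=
  fun x y => if x = y ∘ σ then 1 else 0

lemma permM_apply (σ : Equiv.Perm (Fin t)) (x y : Fin t → α) :
    permM σ x y = if x = y ∘ σ then 1 else 0 := rfl

lemma mul_permM (M : Matrix (Fin t → α) (Fin t → α) ℂ) (σ : Equiv.Perm (Fin t)) (x y : Fin t → α) :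
    (M * (permM σ : Matrix (Fin t → α) (Fin t → α) ℂ)) x y = M x (y ∘ σ) := by
  simp [Matrix.mul_apply, permM_apply]

lemma permM_mul (M : Matrix (Fin t → α) (Fin t → α) ℂ) (σ : Equiv.Perm (Fin t)) (x y : Fin t → α) :
    ((permM σ : Matrix (Fin t → α) (Fin t → α) ℂ) * M) x y = M (x ∘ σ.symm) y := by
  rw [Matrix.mul_apply, Finset.sum_eq_single (x ∘ σ.symm)]
  · rw [permM_apply, if_pos, one_mul]; funext s; simp
  · intro z _ hz
    rw [permM_apply, if_neg, zero_mul]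
    rintro rfl; apply hz; funext s; simp
  · simp

lemma pten_permM (U : Matrix α α ℂ) (σ : Equiv.Perm (Fin t)) :
    tpowMat t U * permM σ = permM σ * tpowMat t U := by
  ext x y
  rw [mul_permM, permM_mul]
  simp only [tpowMat]
  rw [← Equiv.prod_comp σ.symm]
  simp

lemma tsumM_permM (X : Matrix α α ℂ) (σ : Equiv.Perm (Fin t)) :
    tsumM t X * permM σ = permM σ * tsumM t X := by
  ext x y
  rw [mul_permM, permM_mul]
  simp only [tsumM, Matrix.sum_apply]
  rw [← Equiv.sum_comp σ.symm]
  refine Finset.sum_congr rfl fun s _ => ?_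
  simp only [slot, pten]
  rw [← Equiv.prod_comp σ.symm]
  refine Finset.prod_congr rfl fun r _ => ?_
  by_cases h : r = s
  · subst h; simp
  · rw [Function.update_of_ne h, Function.update_of_ne (by simpa using h)]
    show (1 : Matrix α α ℂ) _ _ = (1 : Matrix α α ℂ) _ _
    have e : (y ∘ σ) (σ.symm r) = y r := by simp
    exact congrArg ((1 : Matrix α α ℂ) (x (σ.symm r))) e

lemma tsumM_single (i j : α) (y : Fin t → α) (s0 : Fin t) (h0 : y s0 = i) (h1 : ∀ s, y s = i → s = s0)
    (z : Fin t → α) :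
    tsumM t (Matrix.single j i (1 : ℂ)) z y = if z = Function.update y s0 j then 1 else 0 := by
  rw [tsumM, Matrix.sum_apply, Finset.sum_eq_single s0]
  · rw [slot_apply, h0, Matrix.single_apply]
    by_cases hz : z = Function.update y s0 j
    · rw [if_pos hz, hz]
      simp only [Function.update_self, and_self, if_true, one_mul]
      refine Finset.prod_eq_one fun r hr => ?_
      rw [Function.update_of_ne (Finset.ne_of_mem_erase hr), Matrix.one_apply_eq]
    · rw [if_neg hz]
      obtain ⟨r, hr⟩ := Function.ne_iff.1 hz
      by_cases hrs : r = s0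
      · subst hrs
        rw [Function.update_self] at hr
        rw [if_neg (fun h => hr h.1.symm), zero_mul]
      · rw [Function.update_of_ne hrs] at hr
        have : ∏ r ∈ Finset.univ.erase s0, (1 : Matrix α α ℂ) (z r) (y r) = 0 :=
          Finset.prod_eq_zero (i := r) (by simp [hrs]) (Matrix.one_apply_ne hr)
        rw [this, mul_zero]
  · intro s _ hs
    rw [slot_apply, Matrix.single_apply, if_neg, zero_mul]
    rintro ⟨_, h⟩; exact hs (h1 s h.symm)
  · simp

lemma fft_step (N : Matrix (Fin t → α) (Fin t → α) ℂ)
    (hN : ∀ X : Matrix α α ℂ, tsumM t X * N = N * tsumM t X)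
    (y : Fin t → α) (hy : ∀ x, N x y = 0) (s0 : Fin t) (h1 : ∀ s, y s = y s0 → s = s0) (j : α) (x : Fin t → α) :
    N x (Function.update y s0 j) = 0 := by
  have h := congrFun (congrFun (hN (Matrix.single j (y s0) (1 : ℂ))) x) y
  rw [Matrix.mul_apply, Matrix.mul_apply] at h
  simp only [hy, mul_zero, Finset.sum_const_zero] at h
  simp only [tsumM_single (y s0) j y s0 rfl h1] at h
  simpa using h.symm

lemma fft_path (N : Matrix (Fin t → α) (Fin t → α) ℂ)
    (hN : ∀ X : Matrix α α ℂ, tsumM t X * N = N * tsumM t X)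
    (p q : Fin t → α) (hp : Function.Injective p) (hpq : ∀ r s, p r ≠ q s)
    (h : ∀ x, N x p = 0) (x : Fin t → α) : N x q = 0 := by
  have key : ∀ m : ℕ, m ≤ t → ∀ x, N x (fun s : Fin t => if s.val < m then q s else p s) = 0 := by
    intro m
    induction m with
    | zero => intro _ x; simpa using h x
    | succ m ih =>
      intro hm x
      have := fft_step N hN _ (ih (by omega)) ⟨m, by omega⟩ ?_ (q ⟨m, by omega⟩) x
      · convert this using 2
        funext s
        by_cases hs : s = ⟨m, by omega⟩
        · subst hs; simp
        · rw [Function.update_of_ne hs]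
          have : s.val ≠ m := fun h => hs (Fin.ext h)
          by_cases h2 : s.val < m
          · rw [if_pos h2, if_pos (by omega)]
          · rw [if_neg h2, if_neg (by omega)]
      · intro s hs
        simp only [lt_irrefl, if_false] at hs
        by_cases h2 : s.val < m
        · rw [if_pos h2] at hs; exact absurd hs.symm (hpq _ _)
        · rw [if_neg h2] at hs; exact hp hs
  have := key t le_rfl x
  simpa using this

lemma fft_avoid (hcard : 3 * t ≤ Fintype.card α) (S : Finset α) (hS : S.card ≤ 2 * t) :
    ∃ p : Fin t → α, Function.Injective p ∧ ∀ r, p r ∉ S := by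
  have h1 : t ≤ Fintype.card {a // a ∉ S} := by
    rw [Fintype.card_subtype_compl]; simp; omega
  obtain ⟨f⟩ : Nonempty (Fin t ↪ {a // a ∉ S}) := by
    rw [Function.Embedding.nonempty_iff_card_le]; simpa using h1
  exact ⟨fun s => (f s).1, fun a b h => f.injective (Subtype.ext h), fun r => (f r).2⟩

lemma fft_main (hcard : 3 * t ≤ Fintype.card α) (N : Matrix (Fin t → α) (Fin t → α) ℂ)
    (hN : ∀ X : Matrix α α ℂ, tsumM t X * N = N * tsumM t X) :
    ∃ c : Equiv.Perm (Fin t) → ℂ, N = ∑ σ, c σ • permM σ := by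
  obtain ⟨x0, hx0, -⟩ := fft_avoid hcard ∅ (by simp)
  refine ⟨fun σ => N (x0 ∘ σ) x0, ?_⟩
  set N' := N - ∑ σ : Equiv.Perm (Fin t), N (x0 ∘ σ) x0 • (permM σ : Matrix (Fin t → α) (Fin t → α) ℂ) with hN'
  have hcomm : ∀ X : Matrix α α ℂ, tsumM t X * N' = N' * tsumM t X := by
    intro X
    rw [hN', mul_sub, sub_mul, hN, Finset.mul_sum, Finset.sum_mul]
    congr 1
    refine Finset.sum_congr rfl fun σ _ => ?_
    rw [Matrix.mul_smul, Matrix.smul_mul, tsumM_permM]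
  have hcount : ∀ x, N x x0 ≠ 0 → ∃ σ : Equiv.Perm (Fin t), x = x0 ∘ σ := by
    intro x hx
    have hc : ∀ i : α, (Finset.univ.filter fun s => x s = i).card = (Finset.univ.filter fun s => x0 s = i).card := by
      intro i
      have h := congrFun (congrFun (hN (Matrix.diagonal fun a => if a = i then (1 : ℂ) else 0)) x) x0
      have e : tsumM t (Matrix.diagonal fun a => if a = i then (1 : ℂ) else 0)
          = Matrix.diagonal fun x : Fin t → α => ((Finset.univ.filter fun s => x s = i).card : ℂ) := by
        rw [tsumM]; simp only [slot_diag]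
        ext u w
        rw [Matrix.sum_apply]
        by_cases h : u = w
        · subst h; simp
        · simp [Matrix.diagonal_apply_ne _ h]
      rw [e, Matrix.diagonal_mul, Matrix.mul_diagonal, mul_comm] at h
      exact_mod_cast mul_left_cancel₀ hx h
    have hex : ∀ s, ∃ s', x0 s' = x s := by
      intro s
      have h1 : 0 < (Finset.univ.filter fun s' => x s' = x s).card :=
        Finset.card_pos.2 ⟨s, by simp⟩
      rw [hc] at h1
      obtain ⟨s', hs'⟩ := Finset.card_pos.1 h1
      exact ⟨s', by simpa using hs'⟩
    choose f hf using hex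
    have hinj : Function.Injective f := by
      intro a b hab
      have hxab : x a = x b := by rw [← hf, ← hf, hab]
      have h1 : (Finset.univ.filter fun s' => x s' = x a).card ≤ 1 := by
        rw [hc]
        refine Finset.card_le_one.2 fun u hu w hw => ?_
        simp at hu hw
        exact hx0 (hu.trans hw.symm)
      exact Finset.card_le_one.1 h1 a (by simp) b (by simp [hxab])
    refine ⟨Equiv.ofBijective f (Finite.injective_iff_bijective.1 hinj), ?_⟩
    funext s; simp [hf]
  have hcol : ∀ x, N' x x0 = 0 := by
    intro x
    rw [hN', Matrix.sub_apply, Matrix.sum_apply]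
    simp only [Matrix.smul_apply, permM_apply, smul_eq_mul, mul_ite, mul_one, mul_zero]
    by_cases hx : N x x0 = 0
    · rw [hx, Finset.sum_eq_zero, sub_zero]
      intro σ _
      split_ifs with h
      · rw [← h, hx]
      · rfl
    · obtain ⟨σ, rfl⟩ := hcount x hx
      rw [Finset.sum_eq_single σ]
      · simp
      · intro τ _ hτ
        rw [if_neg]
        intro h; apply hτ
        ext s
        have := congrFun h s
        simp only [Function.comp_apply] at this
        rw [hx0 this]
      · simp
  have hall : N' = 0 := by
    ext x y
    obtain ⟨x1, hx1, hav⟩ := fft_avoid hcard (Finset.univ.image x0 ∪ Finset.univ.image y) (by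
      refine (Finset.card_union_le _ _).trans ?_
      have a := Finset.card_image_le (s := (Finset.univ : Finset (Fin t))) (f := x0)
      have b := Finset.card_image_le (s := (Finset.univ : Finset (Fin t))) (f := y)
      simp at a b; omega)
    have h1 : ∀ x, N' x x1 = 0 := fft_path N' hcomm x0 x1 hx0 (by
      intro r s h; apply hav s; rw [← h]; simp) hcol
    exact fft_path N' hcomm x1 y hx1 (by
      intro r s h; apply hav r; rw [h]; simp) h1 x
  rw [hN', sub_eq_zero] at hall
  exact hall

lemma invF_fft (hcard : 3 * t ≤ Fintype.card α) (v : HSp (Fin t → α)) (hv : v ∈ invF t α) :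
    ∃ c : Equiv.Perm (Fin t) → ℂ, toM v = ∑ σ, c σ • permM σ := by
  refine fft_main hcard (toM v) fun X => ?_
  have := dD_eq_zero_of_invF v hv X
  rw [dD_apply] at this
  exact sub_eq_zero.1 (toV_inj this)

lemma permM_inv (c : ℂ) (σ : Equiv.Perm (Fin t)) : toV (c • (permM σ : Matrix (Fin t → α) (Fin t → α) ℂ)) ∈ invF t α := by
  rw [mem_invF]
  intro U hU
  rw [ad, lrM_apply, toM_toV, Matrix.mul_smul, Matrix.smul_mul, pten_permM, mul_assoc, tpow_star, ← tpow_mul]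
  rw [Matrix.mem_unitaryGroup_iff, Matrix.star_eq_conjTranspose] at hU
  rw [hU, tpow_one, mul_one]

end fft

section emb
variable {I A B : Type*} [Fintype I] [Fintype A] [Fintype B] [DecidableEq I] [DecidableEq A] [DecidableEq B]

/-- embed a matrix on a tensor factor -/
def embE (e : I ≃ A × B) (M : Matrix A A ℂ) : Matrix I I ℂ :=
  fun x y => if (e x).2 = (e y).2 then M (e x).1 (e y).1 else 0

lemma embE_apply (e : I ≃ A × B) (M : Matrix A A ℂ) (x y : I) :
    embE e M x y = if (e x).2 = (e y).2 then M (e x).1 (e y).1 else 0 := rfl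

lemma embE_mul (e : I ≃ A × B) (M N : Matrix A A ℂ) : embE e (M * N) = embE e M * embE e N := by
  ext x y
  rw [Matrix.mul_apply, ← Equiv.sum_comp e.symm, Fintype.sum_prod_type]
  simp only [embE_apply, Equiv.apply_symm_apply, ite_mul, zero_mul, mul_ite, mul_zero]
  by_cases h : (e x).2 = (e y).2
  · simp [h, Matrix.mul_apply]
  · rw [if_neg h]
    symm
    refine Finset.sum_eq_zero fun a _ => Finset.sum_eq_zero fun b _ => ?_
    by_cases hb : (e x).2 = b
    · rw [if_pos hb, if_neg (fun hh => h (hb.trans hh))]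
    · rw [if_neg hb, ite_self]

lemma embE_one (e : I ≃ A × B) : embE e (1 : Matrix A A ℂ) = 1 := by
  ext x y
  rw [embE_apply, Matrix.one_apply, Matrix.one_apply, ← ite_and]
  refine if_congr ?_ rfl rfl
  rw [← e.injective.eq_iff, Prod.ext_iff, and_comm]

lemma embE_star (e : I ≃ A × B) (M : Matrix A A ℂ) : (embE e M)ᴴ = embE e Mᴴ := by
  ext x y
  simp only [Matrix.conjTranspose_apply, embE_apply]
  by_cases h : (e x).2 = (e y).2
  · rw [if_pos h, if_pos h.symm]
  · rw [if_neg h, if_neg (Ne.symm h), star_zero]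

lemma embE_add (e : I ≃ A × B) (M N : Matrix A A ℂ) : embE e (M + N) = embE e M + embE e N := by
  ext x y; simp only [embE_apply, Matrix.add_apply]; split_ifs <;> simp

lemma embE_smul (e : I ≃ A × B) (c : ℂ) (M : Matrix A A ℂ) : embE e (c • M) = c • embE e M := by
  ext x y; simp only [embE_apply, Matrix.smul_apply]; split_ifs <;> simp

lemma embE_sum {J : Type*} (s : Finset J) (e : I ≃ A × B) (f : J → Matrix A A ℂ) :
    embE e (∑ j ∈ s, f j) = ∑ j ∈ s, embE e (f j) := by
  ext x y; simp only [embE_apply, Matrix.sum_apply]; split_ifs <;> simp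

lemma embE_diag (e : I ≃ A × B) (d : A → ℂ) :
    embE e (Matrix.diagonal d) = Matrix.diagonal (fun x => d (e x).1) := by
  ext x y
  rw [embE_apply, Matrix.diagonal_apply, Matrix.diagonal_apply, ← ite_and]
  refine if_congr ?_ rfl rfl
  rw [← e.injective.eq_iff, Prod.ext_iff, and_comm]

lemma embE_inj [Nonempty B] (e : I ≃ A × B) {M N : Matrix A A ℂ} (h : embE e M = embE e N) : M = N := by
  obtain ⟨b⟩ := ‹Nonempty B›
  ext x y
  have := congrFun (congrFun h (e.symm (x, b))) (e.symm (y, b))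
  simpa [embE_apply] using this

lemma embE_unitary (e : I ≃ A × B) {M : Matrix A A ℂ} (h : M ∈ Matrix.unitaryGroup A ℂ) :
    embE e M ∈ Matrix.unitaryGroup I ℂ := by
  rw [Matrix.mem_unitaryGroup_iff, Matrix.star_eq_conjTranspose] at h ⊢
  rw [embE_star, ← embE_mul, h, embE_one]

lemma embE_unitary_iff [Nonempty B] (e : I ≃ A × B) {M : Matrix A A ℂ} :
    embE e M ∈ Matrix.unitaryGroup I ℂ ↔ M ∈ Matrix.unitaryGroup A ℂ := by
  refine ⟨fun h => ?_, embE_unitary e⟩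
  rw [Matrix.mem_unitaryGroup_iff, Matrix.star_eq_conjTranspose] at h ⊢
  rw [embE_star, ← embE_mul, ← embE_one e] at h
  exact embE_inj e h

/-- slices -/
def slc (e : I ≃ A × B) (b b' : B) : HSp I →ₗ[ℂ] HSp A where
  toFun v := WithLp.toLp 2 fun p => v (e.symm (p.1, b), e.symm (p.2, b'))
  map_add' _ _ := rfl
  map_smul' _ _ := rfl

lemma slc_apply (e : I ≃ A × B) (b b' : B) (v : HSp I) (p : A × A) :
    slc e b b' v p = v (e.symm (p.1, b), e.symm (p.2, b')) := rfl

lemma slc_ext (e : I ≃ A × B) {u v : HSp I} (h : ∀ b b', slc e b b' u = slc e b b' v) : u = v := by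
  ext p
  have := congrArg (fun w : HSp A => w ((e p.1).1, (e p.2).1)) (h (e p.1).2 (e p.2).2)
  simpa [slc_apply] using this

lemma slc_norm (e : I ≃ A × B) (v : HSp I) : ‖v‖ ^ 2 = ∑ b, ∑ b', ‖slc e b b' v‖ ^ 2 := by
  simp only [hsp_norm_sq, slc_apply]
  rw [← Equiv.sum_comp e.symm, Fintype.sum_prod_type_right]
  refine Finset.sum_congr rfl fun b _ => ?_
  rw [Finset.sum_comm (f := fun b' a => ∑ y, ‖v (e.symm (a, b), e.symm (y, b'))‖ ^ 2)]
  refine Finset.sum_congr rfl fun a _ => ?_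
  rw [← Equiv.sum_comp e.symm, Fintype.sum_prod_type_right]

lemma slc_lr (e : I ≃ A × B) (b b' : B) (L R : Matrix A A ℂ) (v : HSp I) :
    slc e b b' (lrM (embE e L) (embE e R) v) = lrM L R (slc e b b' v) := by
  ext p
  simp only [slc_apply, lrM_apply, toV_apply]
  rw [Matrix.mul_apply, ← Equiv.sum_comp e.symm, Fintype.sum_prod_type, Matrix.mul_apply]
  refine Finset.sum_congr rfl fun y _ => ?_
  simp only [embE_apply, Equiv.apply_symm_apply, mul_ite, mul_zero]
  rw [Finset.sum_ite_eq' Finset.univ b', if_pos (Finset.mem_univ _)]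
  congr 1
  rw [Matrix.mul_apply, ← Equiv.sum_comp e.symm, Fintype.sum_prod_type, Matrix.mul_apply]
  refine Finset.sum_congr rfl fun x _ => ?_
  simp only [embE_apply, Equiv.apply_symm_apply, ite_mul, zero_mul]
  rw [Finset.sum_ite_eq Finset.univ b, if_pos (Finset.mem_univ _)]
  rfl

/-- injections -/
def injE (e : I ≃ A × B) (b b' : B) (w : HSp A) : HSp I :=
  WithLp.toLp 2 fun p => if (e p.1).2 = b ∧ (e p.2).2 = b' then w ((e p.1).1, (e p.2).1) else 0

lemma slc_inj (e : I ≃ A × B) (b b' c c' : B) (w : HSp A) :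
    slc e c c' (injE e b b' w) = if c = b ∧ c' = b' then w else 0 := by
  ext p
  simp only [slc_apply, injE, Equiv.apply_symm_apply]
  split_ifs <;> rfl

lemma inj_inner (e : I ≃ A × B) (b b' : B) (w : HSp A) (u : HSp I) :
    inner ℂ (injE e b b' w) u = inner ℂ w (slc e b b' u) := by
  rw [PiLp.inner_apply, PiLp.inner_apply, ← Equiv.sum_comp (Equiv.prodCongr e.symm e.symm),
    Fintype.sum_prod_type, Fintype.sum_prod_type, Fintype.sum_prod_type]
  refine Finset.sum_congr rfl fun x _ => ?_
  rw [Finset.sum_eq_single b]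
  · rw [Fintype.sum_prod_type]
    refine Finset.sum_congr rfl fun y _ => ?_
    rw [Finset.sum_eq_single b']
    · simp [injE, slc_apply]
    · intro c _ hc
      simp [injE, hc]
    · simp
  · intro c _ hc
    refine Finset.sum_eq_zero fun y _ => ?_
    simp [injE, hc]
  · simp

end emb

section embt
variable {ξ α β : Type*} [Fintype ξ] [Fintype α] [Fintype β] [DecidableEq ξ] [DecidableEq α] [DecidableEq β]
  {t : ℕ}

/-- join equivalence on `t` copies -/
def Jn (t : ℕ) (e : ξ ≃ α × β) : (Fin t → ξ) ≃ (Fin t → α) × (Fin t → β) :=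
  (Equiv.arrowCongr (Equiv.refl _) e).trans (Equiv.arrowProdEquivProdArrow (Fin t) (fun _ => α) (fun _ => β))

lemma Jn_fst (e : ξ ≃ α × β) (x : Fin t → ξ) (s : Fin t) : (Jn t e x).1 s = (e (x s)).1 := rfl
lemma Jn_snd (e : ξ ≃ α × β) (x : Fin t → ξ) (s : Fin t) : (Jn t e x).2 s = (e (x s)).2 := rfl
lemma Jn_symm (e : ξ ≃ α × β) (x : (Fin t → α) × (Fin t → β)) (s : Fin t) :
    (Jn t e).symm x s = e.symm (x.1 s, x.2 s) := rfl

lemma tpow_embE (e : ξ ≃ α × β) (M : Matrix α α ℂ) :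
    tpowMat t (embE e M) = embE (Jn t e) (tpowMat t M) := by
  ext x y
  simp only [tpowMat, embE_apply]
  by_cases h : (Jn t e x).2 = (Jn t e y).2
  · rw [if_pos h]
    refine Finset.prod_congr rfl fun s _ => ?_
    exact if_pos (congrFun h s)
  · rw [if_neg h]
    obtain ⟨s, hs⟩ := Function.ne_iff.1 h
    refine Finset.prod_eq_zero (Finset.mem_univ s) ?_
    exact if_neg hs

/-- slices of `t`-fold vectors -/
abbrev slt (e : ξ ≃ α × β) (b b' : Fin t → β) : HSp (Fin t → ξ) →ₗ[ℂ] HSp (Fin t → α) :=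
  slc (Jn t e) b b'

lemma slt_ad (e : ξ ≃ α × β) (b b' : Fin t → β) (M : Matrix α α ℂ) (v : HSp (Fin t → ξ)) :
    slt e b b' (ad t (embE e M) v) = ad t M (slt e b b' v) := by
  rw [ad, tpow_embE, embE_star, slt, slc_lr, ad]

/-- invariants of an embedded unitary group -/
def InvE (t : ℕ) (e : ξ ≃ α × β) : Submodule ℂ (HSp (Fin t → ξ)) :=
  fixSub (fun U : Matrix.unitaryGroup α ℂ => ad t (embE e (U : Matrix α α ℂ)))

lemma mem_InvE (e : ξ ≃ α × β) (v : HSp (Fin t → ξ)) :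
    v ∈ InvE t e ↔ ∀ U ∈ Matrix.unitaryGroup α ℂ, ad t (embE e U) v = v :=
  ⟨fun h U hU => h ⟨U, hU⟩, fun h U => h U U.2⟩

lemma InvE_slt (e : ξ ≃ α × β) (v : HSp (Fin t → ξ)) :
    v ∈ InvE t e ↔ ∀ b b', slt e b b' v ∈ invF t α := by
  constructor
  · intro h b b'
    rw [mem_invF]
    intro U hU
    rw [← slt_ad, (mem_InvE e v).1 h U hU]
  · intro h
    rw [mem_InvE]
    intro U hU
    refine slc_ext (Jn t e) fun b b' => ?_
    exact (slt_ad e b b' U v).trans ((mem_invF _).1 (h b b') U hU)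

lemma slt_proj (e : ξ ≃ α × β) (b b' : Fin t → β) (v : HSp (Fin t → ξ)) :
    slt e b b' ((InvE t e).starProjection v) = (invF t α).starProjection (slt e b b' v) := by
  symm
  apply Submodule.eq_starProjection_of_mem_orthogonal
  · exact (InvE_slt e _).1 (Submodule.starProjection_apply_mem _ _) b b'
  · rw [← map_sub, Submodule.mem_orthogonal]
    intro w hw
    rw [← inj_inner]
    have h := Submodule.sub_starProjection_mem_orthogonal (K := InvE t e) v
    rw [Submodule.mem_orthogonal] at h
    apply h
    rw [InvE_slt]
    intro c c'
    rw [slt, slc_inj]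
    split_ifs
    · exact hw
    · exact Submodule.zero_mem _

/-- unitaries act with vanishing derivative on invariants -/
lemma dD_emb_zero (e : ξ ≃ α × β) (v : HSp (Fin t → ξ)) (hv : v ∈ InvE t e) (X : Matrix α α ℂ)
    (hX : X.IsHermitian) : dD t (embE e X) v = 0 := by
  obtain ⟨V, hV, hVX⟩ := herm_diag X hX
  have hV1 : embE e V * (embE e V)ᴴ = 1 := by rw [embE_star, ← embE_mul, hV, embE_one]
  rw [hVX, embE_mul, embE_mul, embE_diag, ← embE_star]
  refine dD_zero_of_exp (embE e V) hV1 (fun x => hX.eigenvalues (e x).1) v fun c => ?_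
  have := embE_diag e (fun i => Complex.exp (Complex.I * ((c * hX.eigenvalues i : ℝ) : ℂ)))
  rw [← this, embE_star, ← embE_mul, ← embE_mul]
  exact (mem_InvE e v).1 hv _ (diag_exp_unitary V hV _)

end embt

section loc
variable {n t : ℕ}

/-- matrices supported on the qubits in `W` -/
def IsLoc (W : Finset (Fin n)) (M : Matrix (Fin n → Fin 2) (Fin n → Fin 2) ℂ) : Prop :=
  (∀ x y, (¬ ∀ r, r ∉ W → x r = y r) → M x y = 0) ∧
  (∀ x y x' y', (∀ r ∈ W, x r = x' r) → (∀ r ∈ W, y r = y' r) → (∀ r, r ∉ W → x r = y r) →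
    (∀ r, r ∉ W → x' r = y' r) → M x y = M x' y')

lemma IsLoc.mono {W W' : Finset (Fin n)} (h : W ⊆ W') {M : Matrix (Fin n → Fin 2) (Fin n → Fin 2) ℂ}
    (hM : IsLoc W M) : IsLoc W' M := by
  refine ⟨fun x y hxy => hM.1 x y fun h' => hxy fun r hr => h' r fun hr' => hr (h hr'), ?_⟩
  intro x y x' y' hx hy hxy hxy'
  by_cases h1 : ∀ r, r ∉ W → x r = y r
  · refine hM.2 x y x' y' (fun r hr => hx r (h hr)) (fun r hr => hy r (h hr)) h1 fun r hr => ?_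
    by_cases hr' : r ∈ W'
    · rw [← hx r hr', h1 r hr, hy r hr']
    · exact hxy' r hr'
  · rw [hM.1 x y h1, hM.1 x' y']
    intro h2
    apply h1
    intro r hr
    by_cases hr' : r ∈ W'
    · rw [hx r hr', h2 r hr, hy r hr']
    · exact hxy r hr'

lemma IsLoc.comm {W W' : Finset (Fin n)} (h : Disjoint W W') {M M' : Matrix (Fin n → Fin 2) (Fin n → Fin 2) ℂ}
    (hM : IsLoc W M) (hM' : IsLoc W' M') : M * M' = M' * M := by
  have hd : ∀ r, r ∈ W → r ∉ W' := fun r h1 h2 => Finset.disjoint_left.1 h h1 h2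
  have key : ∀ (W W' : Finset (Fin n)) (M M' : Matrix (Fin n → Fin 2) (Fin n → Fin 2) ℂ), IsLoc W M → IsLoc W' M' →
      (∀ r, r ∈ W → r ∉ W') → ∀ x y, (M * M') x y =
        M x (fun r => if r ∈ W then y r else x r) * M' (fun r => if r ∈ W then y r else x r) y := by
    intro W W' M M' hM hM' hd x y
    rw [Matrix.mul_apply, Finset.sum_eq_single (fun r => if r ∈ W then y r else x r)]
    · intro z _ hz
      by_cases h1 : ∀ r, r ∉ W → x r = z r
      · rw [hM'.1 z y, mul_zero]
        intro h2
        apply hz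
        funext r
        by_cases hr : r ∈ W
        · rw [if_pos hr, h2 r (hd r hr)]
        · rw [if_neg hr, h1 r hr]
      · rw [hM.1 x z h1, zero_mul]
    · simp
  ext x y
  rw [key W W' M M' hM hM' hd x y, key W' W M' M hM' hM (fun r h1 h2 => hd r h2 h1) x y, mul_comm]
  by_cases hxy : ∀ r, r ∉ W → r ∉ W' → x r = y r
  · congr 1
    · apply hM'.2
      · intro r hr
        rw [if_neg (fun h' => hd r h' hr)]
      · intro r hr; rw [if_pos hr]
      · intro r hr
        by_cases h1 : r ∈ W
        · rw [if_pos h1]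
        · rw [if_neg h1]; exact hxy r h1 hr
      · intro r hr; rw [if_neg hr]
    · apply hM.2
      · intro r hr
        rw [if_neg (hd r hr)]
      · intro r hr; rw [if_pos hr]
      · intro r hr; rw [if_neg hr]
      · intro r hr
        by_cases h1 : r ∈ W'
        · rw [if_pos h1]
        · rw [if_neg h1]; exact hxy r hr h1
  · rw [hM'.1 _ y, hM.1 _ y, zero_mul, mul_zero]
    · intro h'
      apply hxy; intro r h1 h2
      have := h' r h1
      rwa [if_neg h2] at this
    · intro h'
      apply hxy; intro r h1 h2
      have := h' r h2
      rwa [if_neg h1] at this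

lemma isLoc_pten (W : Finset (Fin n)) (f : Fin n → Matrix (Fin 2) (Fin 2) ℂ) (hf : ∀ r, r ∉ W → f r = 1) :
    IsLoc W (pten f) := by
  constructor
  · intro x y h
    push Not at h
    obtain ⟨r, hr, hxy⟩ := h
    exact Finset.prod_eq_zero (Finset.mem_univ r) (by rw [hf r hr, Matrix.one_apply_ne hxy])
  · intro x y x' y' hx hy hxy hxy'
    refine Finset.prod_congr rfl fun r _ => ?_
    by_cases hr : r ∈ W
    · rw [hx r hr, hy r hr]
    · rw [hf r hr, hxy r hr, hxy' r hr, Matrix.one_apply_eq, Matrix.one_apply_eq]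

lemma IsLoc.add {W : Finset (Fin n)} {M N : Matrix (Fin n → Fin 2) (Fin n → Fin 2) ℂ}
    (hM : IsLoc W M) (hN : IsLoc W N) : IsLoc W (M + N) := by
  refine ⟨fun x y h => ?_, fun x y x' y' h1 h2 h3 h4 => ?_⟩
  · rw [Matrix.add_apply, hM.1 x y h, hN.1 x y h, add_zero]
  · rw [Matrix.add_apply, Matrix.add_apply, hM.2 x y x' y' h1 h2 h3 h4, hN.2 x y x' y' h1 h2 h3 h4]

lemma IsLoc.smul {W : Finset (Fin n)} {M : Matrix (Fin n → Fin 2) (Fin n → Fin 2) ℂ} (c : ℂ)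
    (hM : IsLoc W M) : IsLoc W (c • M) := by
  refine ⟨fun x y h => ?_, fun x y x' y' h1 h2 h3 h4 => ?_⟩
  · rw [Matrix.smul_apply, hM.1 x y h, smul_zero]
  · rw [Matrix.smul_apply, Matrix.smul_apply, hM.2 x y x' y' h1 h2 h3 h4]

/-- invariants of the unitaries supported on `W` -/
def InvW (t : ℕ) (W : Finset (Fin n)) : Submodule ℂ (HSp (Fin t → (Fin n → Fin 2))) :=
  fixSub (fun M : {M : Matrix (Fin n → Fin 2) (Fin n → Fin 2) ℂ // M ∈ Matrix.unitaryGroup _ ℂ ∧ IsLoc W M} =>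
    ad t M.1)

lemma mem_InvW (W : Finset (Fin n)) (v : HSp (Fin t → (Fin n → Fin 2))) :
    v ∈ InvW t W ↔ ∀ M ∈ Matrix.unitaryGroup (Fin n → Fin 2) ℂ, IsLoc W M → ad t M v = v :=
  ⟨fun h M hM hL => h ⟨M, hM, hL⟩, fun h M => h M.1 M.2.1 M.2.2⟩

lemma InvW_anti {W W' : Finset (Fin n)} (h : W ⊆ W') : InvW t W' ≤ InvW t W := by
  intro v hv
  rw [mem_InvW] at hv ⊢
  exact fun M hM hL => hv M hM (hL.mono h)

/-- compatibility of a tensor factorisation with a set of qubits -/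
structure Compat {α β : Type*} (e : (Fin n → Fin 2) ≃ α × β) (W : Finset (Fin n)) : Prop where
  h1 : ∀ x y, (e x).1 = (e y).1 ↔ ∀ r ∈ W, x r = y r
  h2 : ∀ x y, (e x).2 = (e y).2 ↔ ∀ r, r ∉ W → x r = y r

section compat
variable {α β : Type*} [Fintype α] [Fintype β] [DecidableEq α] [DecidableEq β]
  {e : (Fin n → Fin 2) ≃ α × β} {W : Finset (Fin n)}

lemma Compat.isLoc (h : Compat e W) (A : Matrix α α ℂ) : IsLoc W (embE e A) := by
  refine ⟨fun x y hxy => ?_, fun x y x' y' h1 h2 h3 h4 => ?_⟩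
  · rw [embE_apply, if_neg]; rwa [h.h2]
  · rw [embE_apply, embE_apply, if_pos ((h.h2 _ _).2 h3), if_pos ((h.h2 _ _).2 h4),
      (h.h1 _ _).2 h1, (h.h1 _ _).2 h2]

lemma Compat.exists_emb [Nonempty β] (h : Compat e W) {M : Matrix (Fin n → Fin 2) (Fin n → Fin 2) ℂ}
    (hM : IsLoc W M) : ∃ A : Matrix α α ℂ, M = embE e A := by
  obtain ⟨b⟩ := ‹Nonempty β›
  refine ⟨Matrix.of fun x y => M (e.symm (x, b)) (e.symm (y, b)), ?_⟩
  ext x y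
  rw [embE_apply, Matrix.of_apply]
  split_ifs with hxy
  · apply hM.2
    · rw [← h.h1]; simp
    · rw [← h.h1]; simp
    · rwa [← h.h2]
    · rw [← h.h2]; simp
  · rw [h.h2] at hxy
    exact hM.1 x y hxy

lemma Compat.inv_eq [Nonempty β] (h : Compat e W) : InvW t W = InvE t e := by
  ext v
  rw [mem_InvW, mem_InvE]
  constructor
  · intro hv U hU
    exact hv _ (embE_unitary e hU) (h.isLoc U)
  · intro hv M hM hL
    obtain ⟨A, rfl⟩ := h.exists_emb hL
    exact hv A ((embE_unitary_iff e).1 hM)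

end compat

/-- factorisation along `W` -/
def eW (W : Finset (Fin n)) : (Fin n → Fin 2) ≃ ({r // r ∈ W} → Fin 2) × ({r // ¬ r ∈ W} → Fin 2) :=
  Equiv.piEquivPiSubtypeProd (fun r => r ∈ W) (fun _ => Fin 2)

lemma eW_compat (W : Finset (Fin n)) : Compat (eW W) W := by
  constructor
  · intro x y
    constructor
    · intro h r hr; exact congrFun h ⟨r, hr⟩
    · intro h; funext r; exact h r.1 r.2
  · intro x y
    constructor
    · intro h r hr; exact congrFun h ⟨r, hr⟩
    · intro h; funext r; exact h r.1 r.2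

/-- factorisation along a pair of qubits -/
def eB (q q' : Fin n) (hq : q ≠ q') : (Fin n → Fin 2) ≃ Fin 4 × ({r // r ≠ q ∧ r ≠ q'} → Fin 2) where
  toFun x := (pairIdx (x q) (x q'), fun r => x r.1)
  invFun p := fun r => if h : r = q then ⟨p.1.val / 2, by omega⟩ else
    if h' : r = q' then ⟨p.1.val % 2, by omega⟩ else p.2 ⟨r, h, h'⟩
  left_inv x := by
    funext r
    by_cases h : r = q
    · subst h; simp [pairIdx]; ext; simp; omega
    · by_cases h' : r = q'
      · subst h'; simp [pairIdx, h]; ext; simp; omega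
      · simp [h, h']
  right_inv p := by
    refine Prod.ext ?_ ?_
    · ext; simp [pairIdx, hq.symm]; omega
    · funext r
      simp [r.2.1, r.2.2]

lemma pairIdx_inj {a b c d : Fin 2} : pairIdx a b = pairIdx c d ↔ a = c ∧ b = d := by
  revert a b c d; decide

lemma eB_compat (q q' : Fin n) (hq : q ≠ q') : Compat (eB q q' hq) {q, q'} := by
  constructor
  · intro x y
    show pairIdx _ _ = pairIdx _ _ ↔ _
    rw [pairIdx_inj]; simp
  · intro x y
    constructor
    · intro h r hr
      simp at hr
      exact congrFun h ⟨r, hr⟩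
    · intro h; funext r; exact h r.1 (by simpa using r.2)

lemma applyGate_eq (q q' : Fin n) (hq : q ≠ q') (U : Matrix (Fin 4) (Fin 4) ℂ) :
    applyGate n q q' U = embE (eB q q' hq) U := by
  ext x y
  rw [embE_apply, applyGate]
  refine if_congr ?_ rfl rfl
  rw [(eB_compat q q' hq).h2]
  simp

lemma InvW_stable {W W' : Finset (Fin n)} (h : Disjoint W W') (M : Matrix (Fin n → Fin 2) (Fin n → Fin 2) ℂ)
    (hL : IsLoc W M) (v : HSp (Fin t → (Fin n → Fin 2))) (hv : v ∈ InvW t W') :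
    ad t M v ∈ InvW t W' := by
  rw [mem_InvW] at hv ⊢
  intro N hN hNL
  rw [← ad_mul, ← IsLoc.comm h hL hNL, ad_mul, hv N hN hNL]

lemma IsLoc.star {W : Finset (Fin n)} {M : Matrix (Fin n → Fin 2) (Fin n → Fin 2) ℂ} (hM : IsLoc W M) :
    IsLoc W Mᴴ := by
  obtain ⟨A, rfl⟩ := (eW_compat W).exists_emb hM
  rw [embE_star]; exact (eW_compat W).isLoc _

lemma IsLoc.mul {W : Finset (Fin n)} {M N : Matrix (Fin n → Fin 2) (Fin n → Fin 2) ℂ} (hM : IsLoc W M)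
    (hN : IsLoc W N) : IsLoc W (M * N) := by
  obtain ⟨A, rfl⟩ := (eW_compat W).exists_emb hM
  obtain ⟨B, rfl⟩ := (eW_compat W).exists_emb hN
  rw [← embE_mul]; exact (eW_compat W).isLoc _

/-- a matrix which, together with its adjoint, preserves an invariant space commutes with the projection -/
lemma ad_proj_comm (K : Submodule ℂ (HSp (Fin t → (Fin n → Fin 2)))) (M : Matrix (Fin n → Fin 2) (Fin n → Fin 2) ℂ)
    (h1 : ∀ v ∈ K, ad t M v ∈ K) (h2 : ∀ v ∈ K, ad t Mᴴ v ∈ K) (v : HSp (Fin t → (Fin n → Fin 2))) :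
    K.starProjection (ad t M v) = ad t M (K.starProjection v) := by
  refine hs_proj_comm_of K (ad t M) h1 ?_ v
  intro w hw
  rw [Submodule.mem_orthogonal] at hw ⊢
  intro u hu
  have := ad_inner (t := t) Mᴴ u w
  rw [Matrix.conjTranspose_conjTranspose] at this
  rw [← this]
  exact hw _ (h2 u hu)

lemma InvW_comm {W W' : Finset (Fin n)} (h : Disjoint W W') (v : HSp (Fin t → (Fin n → Fin 2))) :
    (InvW t W).starProjection ((InvW t W').starProjection v)
      = (InvW t W').starProjection ((InvW t W).starProjection v) := by
  refine hs_proj_comm_sym _ _ ?_ v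
  intro u hu
  rw [mem_InvW] at hu ⊢
  intro M hM hL
  rw [← ad_proj_comm (InvW t W') M (fun w hw => InvW_stable h M hL w hw)
    (fun w hw => InvW_stable h Mᴴ hL.star w hw), hu M hM hL]

/-- distance moved by a local unitary -/
lemma ad_loc_move {W : Finset (Fin n)} {M : Matrix (Fin n → Fin 2) (Fin n → Fin 2) ℂ}
    (hM : M ∈ Matrix.unitaryGroup _ ℂ) (hL : IsLoc W M) (v : HSp (Fin t → (Fin n → Fin 2))) :
    ‖ad t M v - v‖ ≤ 2 * ‖v - (InvW t W).starProjection v‖ := by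
  set p := (InvW t W).starProjection v with hp
  have h1 : ad t M p = p := (mem_InvW W p).1 (Submodule.starProjection_apply_mem _ _) M hM hL
  have h2 : ad t M v - v = ad t M (v - p) - (v - p) := by rw [map_sub, h1]; abel
  rw [h2]
  refine (norm_sub_le _ _).trans ?_
  rw [ad_norm M (Matrix.mem_unitaryGroup_iff'.1 hM)]
  linarith

lemma dD_loc_le {W : Finset (Fin n)} {M : Matrix (Fin n → Fin 2) (Fin n → Fin 2) ℂ}
    (hM : Mᴴ * M = 1) (hH : M.IsHermitian) (hL : IsLoc W M) (v : HSp (Fin t → (Fin n → Fin 2))) :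
    ‖dD t M v‖ ≤ 2 * t * ‖v - (InvW t W).starProjection v‖ := by
  set p := (InvW t W).starProjection v with hp
  obtain ⟨A, hA⟩ := (eW_compat W).exists_emb hL
  have hp' : p ∈ InvE t (eW W) := by
    rw [← (eW_compat W).inv_eq]; exact Submodule.starProjection_apply_mem _ _
  have hAH : A.IsHermitian := by
    apply embE_inj (eW W); rw [← embE_star, ← hA]; exact hH
  have h1 : dD t M p = 0 := by rw [hA]; exact dD_emb_zero _ _ hp' A hAH
  have h2 : dD t M v = dD t M (v - p) := by rw [map_sub, h1, sub_zero]
  rw [h2]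
  exact dD_norm_le M hM _

end loc

abbrev PI := Fin 2 × Fin 2

/-- single-qubit Pauli matrices -/
def pa (a : PI) : Matrix (Fin 2) (Fin 2) ℂ :=
  if a = (0, 0) then !![1, 0; 0, 1] else if a = (0, 1) then !![1, 0; 0, -1] else
  if a = (1, 0) then !![0, 1; 1, 0] else !![0, -Complex.I; Complex.I, 0]

lemma pa00 : pa (0, 0) = !![1, 0; 0, 1] := by simp [pa]
lemma pa01 : pa (0, 1) = !![1, 0; 0, -1] := by simp [pa]
lemma pa10 : pa (1, 0) = !![0, 1; 1, 0] := by simp [pa]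
lemma pa11 : pa (1, 1) = !![0, -Complex.I; Complex.I, 0] := by simp [pa]

/-- commutation sign -/
def sg (a b : PI) : ℂ := if a.1 * b.2 + a.2 * b.1 = 0 then 1 else -1

lemma PI_cases (Q : PI → Prop) (h0 : Q (0,0)) (h1 : Q (0,1)) (h2 : Q (1,0)) (h3 : Q (1,1)) : ∀ a, Q a := by
  rintro ⟨a, b⟩
  fin_cases a <;> fin_cases b <;> assumption

lemma pa_herm (a : PI) : (pa a)ᴴ = pa a := by
  refine PI_cases (fun a => (pa a)ᴴ = pa a) ?_ ?_ ?_ ?_ a <;>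
    simp only [pa00, pa01, pa10, pa11] <;> ext i j <;> fin_cases i <;> fin_cases j <;> simp

lemma pa_zero : pa 0 = 1 := by
  show pa (0, 0) = 1
  rw [pa00]; ext i j; fin_cases i <;> fin_cases j <;> simp

lemma pa_sq (a : PI) : pa a * pa a = 1 := by
  refine PI_cases (fun a => pa a * pa a = 1) ?_ ?_ ?_ ?_ a <;>
    simp only [pa00, pa01, pa10, pa11] <;> ext i j <;> fin_cases i <;> fin_cases j <;> simp

lemma pa_comm (a b : PI) : pa a * pa b = sg a b • (pa b * pa a) := by
  refine PI_cases (fun a => pa a * pa b = sg a b • (pa b * pa a)) ?_ ?_ ?_ ?_ a <;>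
  refine PI_cases (fun b => pa _ * pa b = sg _ b • (pa b * pa _)) ?_ ?_ ?_ ?_ b <;>
    simp only [pa00, pa01, pa10, pa11, sg] <;> ext i j <;> fin_cases i <;> fin_cases j <;> simp

lemma pa_mul (a b : PI) : ∃ θ : ℂ, ‖θ‖ = 1 ∧ pa a * pa b = θ • pa (a + b) := by
  have key : ∀ θ : ℂ, θ ∈ ({1, Complex.I, -Complex.I} : Set ℂ) → ‖θ‖ = 1 := by
    intro θ h; simp at h; rcases h with h | h | h <;> simp [h]
  suffices h : ∃ θ ∈ ({1, Complex.I, -Complex.I} : Set ℂ), pa a * pa b = θ • pa (a + b) by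
    obtain ⟨θ, h1, h2⟩ := h; exact ⟨θ, key θ h1, h2⟩
  refine PI_cases (fun a => ∃ θ ∈ ({1, Complex.I, -Complex.I} : Set ℂ), pa a * pa b = θ • pa (a + b)) ?_ ?_ ?_ ?_ a <;>
  refine PI_cases (fun b => ∃ θ ∈ ({1, Complex.I, -Complex.I} : Set ℂ), pa _ * pa b = θ • pa (_ + b)) ?_ ?_ ?_ ?_ b <;>
    simp only [Prod.mk_add_mk, add_zero, zero_add, show (1 : Fin 2) + 1 = 0 from rfl] <;>
    simp only [pa00, pa01, pa10, pa11] <;>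
    first
    | (refine ⟨1, by simp, ?_⟩; ext i j; fin_cases i <;> fin_cases j <;> simp; done)
    | (refine ⟨Complex.I, by simp, ?_⟩; ext i j; fin_cases i <;> fin_cases j <;> simp; done)
    | (refine ⟨-Complex.I, by simp, ?_⟩; ext i j; fin_cases i <;> fin_cases j <;> simp; done)

lemma pa_compl (x y x' y' : Fin 2) : ∑ a, star (pa a x y) * pa a x' y' = if x = x' ∧ y = y' then 2 else 0 := by
  rw [Fintype.sum_prod_type]
  simp only [Fin.sum_univ_two, pa00, pa01, pa10, pa11]
  fin_cases x <;> fin_cases y <;> fin_cases x' <;> fin_cases y' <;> simp <;> norm_num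

lemma sg_orth (a b : PI) : ∑ q, sg q a * sg q b = if a = b then 4 else 0 := by
  rw [Fintype.sum_prod_type]
  simp only [Fin.sum_univ_two, sg]
  rcases a with ⟨a1, a2⟩
  rcases b with ⟨b1, b2⟩
  fin_cases a1 <;> fin_cases a2 <;> fin_cases b1 <;> fin_cases b2 <;> simp <;> norm_num

lemma sg_sq (a b : PI) : sg a b * sg a b = 1 := by
  unfold sg; split_ifs <;> norm_num

lemma sg_real (a b : PI) : star (sg a b) = sg a b := by
  unfold sg; split_ifs <;> simp

section pauli
variable {ι : Type*} [Fintype ι] [DecidableEq ι]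

/-- Pauli strings -/
def PS (c : ι → PI) : Matrix (ι → Fin 2) (ι → Fin 2) ℂ := pten (fun r => pa (c r))

def sgn (c d : ι → PI) : ℂ := ∏ r, sg (c r) (d r)

lemma PS_herm (c : ι → PI) : (PS c)ᴴ = PS c := by
  rw [PS, pten_conjTranspose]; simp only [pa_herm]

lemma PS_sq (c : ι → PI) : PS c * PS c = 1 := by
  rw [PS, pten_mul]; simp only [pa_sq]; exact pten_one

lemma PS_comm (c d : ι → PI) : PS c * PS d = sgn c d • (PS d * PS c) := by
  rw [PS, PS, pten_mul, pten_mul, sgn, ← pten_smul]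
  congr 1; funext r; exact pa_comm _ _

lemma PS_mul (c d : ι → PI) : ∃ θ : ℂ, ‖θ‖ = 1 ∧ PS c * PS d = θ • PS (c + d) := by
  choose θ h1 h2 using fun r => pa_mul (c r) (d r)
  refine ⟨∏ r, θ r, ?_, ?_⟩
  · rw [norm_prod]; simp [h1]
  · rw [PS, PS, pten_mul, PS, ← pten_smul]
    congr 1; funext r; exact h2 r

lemma PS_conj (q c : ι → PI) : PS q * PS c * (PS q)ᴴ = sgn q c • PS c := by
  rw [PS_comm, PS_herm, Matrix.smul_mul, mul_assoc, PS_sq, mul_one]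

lemma sgn_real (c d : ι → PI) : star (sgn c d) = sgn c d := by
  rw [sgn, Complex.star_def, map_prod]
  exact Finset.prod_congr rfl fun r _ => sg_real _ _

lemma sgn_orth (a b : ι → PI) : ∑ q, sgn q a * sgn q b = if a = b then (4 : ℂ) ^ Fintype.card ι else 0 := by
  simp only [sgn, ← Finset.prod_mul_distrib]
  have := (Finset.prod_univ_sum (fun _ : ι => (Finset.univ : Finset PI)) (fun r q => sg q (a r) * sg q (b r))).symm
  rw [Fintype.piFinset_univ] at this
  rw [this]
  simp only [sg_orth]
  split_ifs with h
  · subst h; simp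
  · obtain ⟨r, hr⟩ := Function.ne_iff.1 h
    exact Finset.prod_eq_zero (Finset.mem_univ r) (if_neg hr)

lemma PS_compl (x y x' y' : ι → Fin 2) :
    ∑ c, star (PS c x y) * PS c x' y' = if x = x' ∧ y = y' then (2 : ℂ) ^ Fintype.card ι else 0 := by
  simp only [PS, pten, Complex.star_def, map_prod, ← Finset.prod_mul_distrib]
  have := (Finset.prod_univ_sum (fun _ : ι => (Finset.univ : Finset PI))
    (fun r a => (starRingEnd ℂ) (pa a (x r) (y r)) * pa a (x' r) (y' r))).symm
  rw [Fintype.piFinset_univ] at this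
  rw [this]
  have h2 : ∀ r, ∑ a, (starRingEnd ℂ) (pa a (x r) (y r)) * pa a (x' r) (y' r)
      = if x r = x' r ∧ y r = y' r then 2 else 0 := fun r => pa_compl _ _ _ _
  simp only [h2]
  by_cases h : x = x' ∧ y = y'
  · rw [if_pos h]; simp [h.1, h.2]
  · rw [if_neg h]
    have : ∃ r, ¬ (x r = x' r ∧ y r = y' r) := by
      by_contra hc
      push Not at hc
      exact h ⟨funext fun r => (hc r).1, funext fun r => (hc r).2⟩
    obtain ⟨r, hr⟩ := this
    exact Finset.prod_eq_zero (Finset.mem_univ r) (if_neg hr)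

/-- Pauli coefficients -/
def pcoef (A : Matrix (ι → Fin 2) (ι → Fin 2) ℂ) (c : ι → PI) : ℂ :=
  ((2 : ℂ) ^ Fintype.card ι)⁻¹ * ∑ x, ∑ y, star (PS c x y) * A x y

lemma pauli_expand (A : Matrix (ι → Fin 2) (ι → Fin 2) ℂ) : A = ∑ c, pcoef A c • PS c := by
  ext x' y'
  rw [Matrix.sum_apply]
  simp only [Matrix.smul_apply, smul_eq_mul, pcoef, mul_assoc, Finset.sum_mul]
  rw [← Finset.mul_sum, Finset.sum_comm]
  have : ∀ x, ∑ c : ι → PI, ∑ y, star (PS c x y) * (A x y * PS c x' y')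
      = ∑ y, A x y * if x = x' ∧ y = y' then (2 : ℂ) ^ Fintype.card ι else 0 := by
    intro x
    rw [Finset.sum_comm]
    refine Finset.sum_congr rfl fun y _ => ?_
    rw [← PS_compl, Finset.mul_sum]
    exact Finset.sum_congr rfl fun c _ => by ring
  simp only [this]
  rw [Finset.sum_eq_single x', Finset.sum_eq_single y']
  · have : (2 : ℂ) ^ Fintype.card ι ≠ 0 := by positivity
    simp; field_simp
  · intro y _ hy; simp [hy]
  · simp
  · intro x _ hx; simp [hx]
  · simp

lemma pauli_parseval (A : Matrix (ι → Fin 2) (ι → Fin 2) ℂ) :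
    ∑ c, ‖pcoef A c‖ ^ 2 = ((2 : ℝ) ^ Fintype.card ι)⁻¹ * ∑ x, ∑ y, ‖A x y‖ ^ 2 := by
  have h2 : (2 : ℂ) ^ Fintype.card ι ≠ 0 := by positivity
  have key : ∑ c, star (pcoef A c) * pcoef A c = ((2 : ℂ) ^ Fintype.card ι)⁻¹ * ∑ x, ∑ y, star (A x y) * A x y := by
    have hexp : ∀ c, star (pcoef A c) * pcoef A c
        = ((2 : ℂ) ^ Fintype.card ι)⁻¹ * ∑ x, ∑ y, star (A x y) * (pcoef A c * PS c x y) := by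
      intro c
      conv_lhs => rw [pcoef]
      simp only [star_mul', star_inv₀, star_pow, star_sum, star_star]
      rw [show star (2:ℂ) = 2 by simp, mul_assoc]
      congr 1
      rw [Finset.sum_mul]
      refine Finset.sum_congr rfl fun x _ => ?_
      rw [Finset.sum_mul]
      refine Finset.sum_congr rfl fun y _ => ?_
      rw [pcoef]; ring
    simp only [hexp]
    rw [← Finset.mul_sum, Finset.sum_comm]
    congr 1
    refine Finset.sum_congr rfl fun x _ => ?_
    rw [Finset.sum_comm]
    refine Finset.sum_congr rfl fun y _ => ?_
    rw [← Finset.mul_sum]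
    congr 1
    conv_rhs => rw [pauli_expand A, Matrix.sum_apply]
    rfl
  have hn : ∀ z : ℂ, star z * z = ((‖z‖ ^ 2 : ℝ) : ℂ) := by
    intro z; rw [Complex.star_def, mul_comm, Complex.mul_conj, Complex.normSq_eq_norm_sq]
  simp only [hn] at key
  apply Complex.ofReal_injective
  push_cast at key ⊢
  exact key

end pauli

section multi
variable {E : Type*} [NormedAddCommGroup E] [InnerProductSpace ℂ E] [FiniteDimensional ℂ E]

/-- diagonal operator on a finite direct sum -/
def diagOp (Q : Type*) [Fintype Q] (T : E →L[ℂ] E) : PiLp 2 (fun _ : Q => E) →L[ℂ] PiLp 2 (fun _ : Q => E) :=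
  LinearMap.toContinuousLinearMap
    { toFun := fun V => WithLp.toLp 2 fun q => T (V q)
      map_add' := by intro x y; ext q; simp
      map_smul' := by intro c x; ext q; simp }

lemma diagOp_apply (Q : Type*) [Fintype Q] (T : E →L[ℂ] E) (V : PiLp 2 (fun _ : Q => E)) (q : Q) :
    diagOp Q T V q = T (V q) := rfl

lemma hs_orbit_multi {G Q : Type*} [Nonempty G] [Fintype Q] (π : G → E →L[ℂ] E) (hiso : ∀ i v, ‖π i v‖ = ‖v‖)
    (hmul : ∀ i j, ∃ k, ∀ v, π k v = π i (π j v))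
    (V : Q → E) (r : ℝ) (hr0 : 0 ≤ r) (hr : ∀ i, ∑ q, ‖π i (V q) - V q‖ ^ 2 ≤ r ^ 2) :
    ∑ q, ‖V q - (fixSub π).starProjection (V q)‖ ^ 2 ≤ r ^ 2 := by
  have hnorm : ∀ V : PiLp 2 (fun _ : Q => E), ‖V‖ ^ 2 = ∑ q, ‖V q‖ ^ 2 := fun V => PiLp.norm_sq_eq_of_L2 _ V
  set V' : PiLp 2 (fun _ : Q => E) := WithLp.toLp 2 V with hV'
  have hVq : ∀ q, V' q = V q := fun q => rfl
  have main : ‖V' - (fixSub (fun i => diagOp Q (π i))).starProjection V'‖ ≤ r := by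
    apply hs_orbit (fun i => diagOp Q (π i))
    · intro i W
      have : ‖diagOp Q (π i) W‖ ^ 2 = ‖W‖ ^ 2 := by
        rw [hnorm, hnorm]
        exact Finset.sum_congr rfl fun q _ => by rw [diagOp_apply, hiso]
      exact (sq_eq_sq₀ (norm_nonneg _) (norm_nonneg _)).1 this
    · intro i j
      obtain ⟨k, hk⟩ := hmul i j
      refine ⟨k, fun W => ?_⟩
      ext q
      rw [diagOp_apply, diagOp_apply, diagOp_apply, hk]
    · intro i
      refine le_of_sq_le_sq ?_ hr0
      rw [hnorm]
      exact hr i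
  refine le_trans ?_ (pow_le_pow_left₀ (norm_nonneg _) main 2)
  rw [hnorm]
  refine Finset.sum_le_sum fun q _ => pow_le_pow_left₀ (norm_nonneg _) ?_ 2
  rw [PiLp.sub_apply, hVq]
  apply hs_proj_min
  set W := (fixSub (fun i => diagOp Q (π i))).starProjection V' with hW
  have hWm : W ∈ fixSub (fun i => diagOp Q (π i)) := Submodule.starProjection_apply_mem _ _
  intro i
  have := congrArg (fun Z : PiLp 2 (fun _ : Q => E) => Z q) (hWm i)
  exact this

end multi

section baseabs
variable {ξ ι β : Type*} [Fintype ξ] [Fintype ι] [Fintype β] [DecidableEq ξ] [DecidableEq ι] [DecidableEq β]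
  {t : ℕ}

lemma herm_diag_frob {κ : Type*} [Fintype κ] [DecidableEq κ] (V : Matrix κ κ ℂ) (hV : V * Vᴴ = 1) (θ : κ → ℝ)
    (hθ : ∀ i, |θ i| ≤ Real.pi) :
    ∑ x, ∑ y, ‖(V * (Matrix.diagonal fun i => (θ i : ℂ)) * Vᴴ) x y‖ ^ 2 ≤ Fintype.card κ * Real.pi ^ 2 := by
  have hV' : Vᴴ * V = 1 := mul_eq_one_comm.1 hV
  have h1 := hsp_norm_sq (toV (V * (Matrix.diagonal fun i => (θ i : ℂ)) * Vᴴ))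
  simp only [toV_apply] at h1
  rw [← h1]
  have h2 : toV (V * (Matrix.diagonal fun i => (θ i : ℂ)) * Vᴴ)
      = lrM V Vᴴ (toV (Matrix.diagonal fun i => (θ i : ℂ))) := by rw [lrM_apply, toM_toV]
  rw [h2, lrM_norm _ _ hV' (by rw [Matrix.conjTranspose_conjTranspose, hV']), hsp_norm_sq]
  simp only [toV_apply]
  calc ∑ x, ∑ y, ‖Matrix.diagonal (fun i => (θ i : ℂ)) x y‖ ^ 2 = ∑ x : κ, ‖(θ x : ℂ)‖ ^ 2 := by
        refine Finset.sum_congr rfl fun x _ => ?_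
        rw [Finset.sum_eq_single x]
        · simp
        · intro y _ hy; rw [Matrix.diagonal_apply_ne _ hy.symm]; simp
        · simp
    _ ≤ ∑ x : κ, Real.pi ^ 2 := by
        refine Finset.sum_le_sum fun x _ => ?_
        rw [Complex.norm_real, Real.norm_eq_abs]
        exact pow_le_pow_left₀ (abs_nonneg _) (hθ x) 2
    _ = _ := by simp

lemma pauli_twirl_sum {E : Type*} [NormedAddCommGroup E] [InnerProductSpace ℂ E]
    (z : (ι → PI) → E) :
    ∑ q, ‖∑ c, sgn q c • z c‖ ^ 2 = (4 : ℝ) ^ Fintype.card ι * ∑ c, ‖z c‖ ^ 2 := by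
  have key : ∑ q, inner ℂ (∑ c, sgn q c • z c) (∑ c, sgn q c • z c)
      = (4 : ℂ) ^ Fintype.card ι * ∑ c, inner ℂ (z c) (z c) := by
    have h1 : ∀ q, inner ℂ (∑ c, sgn q c • z c) (∑ c, sgn q c • z c)
        = ∑ c, ∑ d, (sgn q c * sgn q d) * inner ℂ (z c) (z d) := by
      intro q
      rw [sum_inner]
      refine Finset.sum_congr rfl fun c _ => ?_
      rw [inner_sum]
      refine Finset.sum_congr rfl fun d _ => ?_
      rw [inner_smul_left, inner_smul_right]
      have := sgn_real q c
      rw [Complex.star_def] at this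
      rw [this, mul_assoc]
    simp only [h1]
    rw [Finset.sum_comm, Finset.mul_sum]
    refine Finset.sum_congr rfl fun c _ => ?_
    rw [Finset.sum_comm]
    simp only [← Finset.sum_mul, sgn_orth, ite_mul, zero_mul]
    simp
  simp only [inner_self_eq_norm_sq_to_K] at key
  apply Complex.ofReal_injective
  push_cast
  exact key

set_option maxHeartbeats 1600000 in
/-- abstract base case -/
lemma base_abs (e : ξ ≃ (ι → Fin 2) × β) (v : HSp (Fin t → ξ)) (B : ℝ) (hB : 0 ≤ B)
    (h : ∀ c : ι → PI, ‖dD t (embE e (PS c)) v‖ ≤ B) :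
    ‖v - (InvE t e).starProjection v‖ ≤ Real.pi * B := by
  set N : ℝ := (4 : ℝ) ^ Fintype.card ι with hN
  have hN0 : 0 < N := by positivity
  have hcard : (Fintype.card (ι → PI) : ℝ) = N := by
    rw [Fintype.card_fun]; simp [hN]
  have hPu : ∀ q : ι → PI, PS q ∈ Matrix.unitaryGroup (ι → Fin 2) ℂ := by
    intro q
    rw [Matrix.mem_unitaryGroup_iff, Matrix.star_eq_conjTranspose, PS_herm, PS_sq]
  have hun : ∀ U : Matrix.unitaryGroup (ι → Fin 2) ℂ,
      (embE e (U : Matrix (ι → Fin 2) (ι → Fin 2) ℂ))ᴴ * embE e U = 1 := fun U =>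
    Matrix.mem_unitaryGroup_iff'.1 (embE_unitary e U.2)
  have main : ∑ q, ‖ad t (embE e (PS q)) v - (InvE t e).starProjection (ad t (embE e (PS q)) v)‖ ^ 2
      ≤ (Real.sqrt N * (Real.pi * B)) ^ 2 := by
    refine hs_orbit_multi (fun U : Matrix.unitaryGroup (ι → Fin 2) ℂ => ad t (embE e U.1)) ?_ ?_
      (fun q => ad t (embE e (PS q)) v) _ (by positivity) ?_
    · intro U W
      exact ad_norm _ (hun U) W
    · intro U U'
      refine ⟨U * U', fun W => ?_⟩
      rw [← ad_mul, ← embE_mul]; rfl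
    · intro U
      obtain ⟨Vd, θ, hVd, hθ, hA⟩ := unitary_diag U.1 U.2
      set X := Vd * (Matrix.diagonal fun i => (θ i : ℂ)) * Vdᴴ with hX
      rw [mul_pow, Real.sq_sqrt hN0.le]
      have hsq : ∑ q, ‖ad t (embE e U.1) (ad t (embE e (PS q)) v) - ad t (embE e (PS q)) v‖ ^ 2
          ≤ N * (Real.pi * B) ^ 2 := by
        have h1 : ∀ q, ‖ad t (embE e U.1) (ad t (embE e (PS q)) v) - ad t (embE e (PS q)) v‖
            ≤ ‖∑ c, sgn q c • (pcoef X c • dD t (embE e (PS c)) v)‖ := by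
          intro q
          have e1 : ad t (embE e U.1) (ad t (embE e (PS q)) v) - ad t (embE e (PS q)) v
              = ad t (embE e (PS q)) (ad t (embE e (PS q * U.1 * (PS q)ᴴ)) v - v) := by
            rw [map_sub, ← ad_mul, ← ad_mul, ← embE_mul, ← embE_mul, PS_herm]
            rw [← mul_assoc, ← mul_assoc, PS_sq, one_mul]
          rw [e1, ad_norm _ (hun ⟨PS q, hPu q⟩)]
          have e2 : embE e (PS q * U.1 * (PS q)ᴴ) = embE e (PS q * Vd) *
              (Matrix.diagonal fun x => Complex.exp (Complex.I * θ (e x).1)) * (embE e (PS q * Vd))ᴴ := by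
            rw [hA, ← embE_diag e (fun i => Complex.exp (Complex.I * θ i)), embE_star, ← embE_mul, ← embE_mul,
              Matrix.conjTranspose_mul]
            simp only [mul_assoc]
          have e3 : embE e (PS q * X * (PS q)ᴴ) = embE e (PS q * Vd) *
              (Matrix.diagonal fun x => (θ (e x).1 : ℂ)) * (embE e (PS q * Vd))ᴴ := by
            rw [hX, ← embE_diag e (fun i => (θ i : ℂ)), embE_star, ← embE_mul, ← embE_mul,
              Matrix.conjTranspose_mul]
            simp only [mul_assoc]
          have e4 : embE e (PS q * Vd) * (embE e (PS q * Vd))ᴴ = 1 := by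
            rw [embE_star, ← embE_mul, Matrix.conjTranspose_mul, mul_assoc, ← mul_assoc Vd, hVd, one_mul,
              PS_herm, PS_sq, embE_one]
          rw [e2]
          refine (exp_conj_le _ e4 (fun x => θ (e x).1) v).trans (le_of_eq ?_)
          rw [← e3]
          congr 1
          conv_lhs => rw [pauli_expand X]
          rw [Finset.mul_sum, Finset.sum_mul, embE_sum, dD_sum]
          refine Finset.sum_congr rfl fun c _ => ?_
          rw [Matrix.mul_smul, Matrix.smul_mul, PS_conj, embE_smul, embE_smul, dD_smul, dD_smul, smul_comm]
        calc ∑ q, ‖ad t (embE e U.1) (ad t (embE e (PS q)) v) - ad t (embE e (PS q)) v‖ ^ 2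
            ≤ ∑ q, ‖∑ c, sgn q c • (pcoef X c • dD t (embE e (PS c)) v)‖ ^ 2 :=
              Finset.sum_le_sum fun q _ => pow_le_pow_left₀ (norm_nonneg _) (h1 q) 2
          _ = N * ∑ c, ‖pcoef X c • dD t (embE e (PS c)) v‖ ^ 2 := pauli_twirl_sum _
          _ ≤ N * ∑ c, ‖pcoef X c‖ ^ 2 * B ^ 2 := by
              refine mul_le_mul_of_nonneg_left (Finset.sum_le_sum fun c _ => ?_) hN0.le
              rw [norm_smul, mul_pow]
              exact mul_le_mul_of_nonneg_left (pow_le_pow_left₀ (norm_nonneg _) (h c) 2) (by positivity)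
          _ ≤ N * (Real.pi * B) ^ 2 := by
              refine mul_le_mul_of_nonneg_left ?_ hN0.le
              rw [← Finset.sum_mul, mul_pow]
              refine mul_le_mul_of_nonneg_right ?_ (by positivity)
              rw [pauli_parseval]
              have := herm_diag_frob Vd hVd θ hθ
              rw [← hX, Fintype.card_fun] at this
              rw [inv_mul_le_iff₀ (by positivity)]
              simpa using this
      exact hsq
  have hlow : N * ‖v - (InvE t e).starProjection v‖ ^ 2 ≤
      ∑ q, ‖ad t (embE e (PS q)) v - (InvE t e).starProjection (ad t (embE e (PS q)) v)‖ ^ 2 := by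
    rw [← hcard, ← nsmul_eq_mul, ← Finset.card_univ, ← Finset.sum_const]
    refine Finset.sum_le_sum fun q _ => ?_
    refine pow_le_pow_left₀ (norm_nonneg _) ?_ 2
    set W := (InvE t e).starProjection (ad t (embE e (PS q)) v) with hW
    have hWq : W ∈ InvE t e := Submodule.starProjection_apply_mem _ _
    have e1 : W = ad t (embE e (PS q)) W := ((mem_InvE e _).1 hWq _ (hPu q)).symm
    rw [e1, ← map_sub, ad_norm _ (hun ⟨PS q, hPu q⟩)]
    exact hs_proj_min _ _ _ hWq
  have h3 : N * ‖v - (InvE t e).starProjection v‖ ^ 2 ≤ N * (Real.pi * B) ^ 2 := by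
    refine hlow.trans (main.trans (le_of_eq ?_))
    rw [mul_pow, Real.sq_sqrt hN0.le]
  have h4 := le_of_mul_le_mul_left h3 hN0
  exact le_of_sq_le_sq h4 (by positivity)

end baseabs

section sweep
variable {n t : ℕ}

/-- the bond `{j, j+1}` -/
def bd (n j : ℕ) : Finset (Fin n) := Finset.univ.filter fun r => r.val = j ∨ r.val = j + 1

lemma mem_bd (j : ℕ) (r : Fin n) : r ∈ bd n j ↔ r.val = j ∨ r.val = j + 1 := by simp [bd]

/-- Pauli strings related by conjugation with a unitary on `W` -/
def Mv (W : Finset (Fin n)) (c d : Fin n → PI) : Prop :=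
  ∃ U ∈ Matrix.unitaryGroup (Fin n → Fin 2) ℂ, IsLoc W U ∧ ∃ φ : ℂ, ‖φ‖ = 1 ∧ U * PS c * Uᴴ = φ • PS d

lemma Mv.trans {W : Finset (Fin n)} {c d e : Fin n → PI} (h1 : Mv W c d) (h2 : Mv W d e) : Mv W c e := by
  obtain ⟨U, hU, hL, φ, hφ, h⟩ := h1
  obtain ⟨U', hU', hL', φ', hφ', h'⟩ := h2
  refine ⟨U' * U, mul_mem hU' hU, hL'.mul hL, φ * φ', by rw [norm_mul, hφ, hφ', one_mul], ?_⟩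
  have : U' * U * PS c * (U' * U)ᴴ = U' * (U * PS c * Uᴴ) * U'ᴴ := by
    rw [Matrix.conjTranspose_mul]; simp only [mul_assoc]
  rw [this, h, Matrix.mul_smul, Matrix.smul_mul, h', smul_smul]

lemma PS_loc (W : Finset (Fin n)) (c : Fin n → PI) (hc : ∀ r, r ∉ W → c r = 0) : IsLoc W (PS c) :=
  isLoc_pten W _ fun r hr => by rw [hc r hr, pa_zero]

lemma one_loc (W : Finset (Fin n)) : IsLoc W (1 : Matrix (Fin n → Fin 2) (Fin n → Fin 2) ℂ) := by
  rw [← pten_one]; exact isLoc_pten W _ fun r hr => rfl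

lemma Mv_basic (W : Finset (Fin n)) (c e : Fin n → PI) (he : ∀ r, r ∉ W → e r = 0) (hs : sgn e c = -1) :
    Mv W c (c + e) := by
  set s : ℂ := (((Real.sqrt 2)⁻¹ : ℝ) : ℂ) with hs'
  have hss : s * s = 1 / 2 := by
    rw [hs', ← Complex.ofReal_mul, ← mul_inv, Real.mul_self_sqrt (by norm_num)]; norm_num
  have hsr : star s = s := by rw [hs']; simp
  have hcom : PS e * PS c = -(PS c * PS e) := by
    rw [PS_comm, hs, neg_one_smul]
  set U : Matrix (Fin n → Fin 2) (Fin n → Fin 2) ℂ := s • (1 + Complex.I • PS e) with hU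
  have hUs : Uᴴ = s • (1 - Complex.I • PS e) := by
    rw [hU, Matrix.conjTranspose_smul, hsr, Matrix.conjTranspose_add, Matrix.conjTranspose_smul, PS_herm,
      Matrix.conjTranspose_one]
    simp [sub_eq_add_neg]
  obtain ⟨θ, hθ, hm⟩ := PS_mul c e
  refine ⟨U, ?_, ?_, -Complex.I * θ, by simp [hθ], ?_⟩
  · rw [Matrix.mem_unitaryGroup_iff, Matrix.star_eq_conjTranspose, hUs, hU, Matrix.smul_mul, Matrix.mul_smul,
      smul_smul, hss]
    have : (1 + Complex.I • PS e) * (1 - Complex.I • PS e) = (2 : ℂ) • (1 : Matrix (Fin n → Fin 2) (Fin n → Fin 2) ℂ) := by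
      rw [add_mul, mul_sub, mul_sub, one_mul, one_mul, mul_one, Matrix.smul_mul, Matrix.mul_smul, PS_sq, smul_smul,
        Complex.I_mul_I, two_smul]
      simp
      abel
    rw [this, smul_smul]; norm_num
  · exact (((one_loc W).add ((PS_loc W e he).smul _)).smul _)
  · rw [hUs, hU, Matrix.smul_mul, Matrix.smul_mul, Matrix.mul_smul, smul_smul, hss]
    have : (1 + Complex.I • PS e) * PS c * (1 - Complex.I • PS e) = (-2 * Complex.I) • (PS c * PS e) := by
      have h1 : (1 + Complex.I • PS e) * PS c = PS c * (1 - Complex.I • PS e) := by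
        rw [add_mul, mul_sub, one_mul, mul_one, Matrix.smul_mul, Matrix.mul_smul, hcom, smul_neg, sub_eq_add_neg]
      have h2 : (1 - Complex.I • PS e) * (1 - Complex.I • PS e) = (-2 * Complex.I) • PS e := by
        rw [sub_mul, mul_sub, mul_sub, one_mul, one_mul, mul_one, Matrix.smul_mul, Matrix.mul_smul, PS_sq, smul_smul,
          Complex.I_mul_I]
        rw [mul_smul, neg_smul, neg_smul, two_smul, one_smul]; abel
      rw [h1, mul_assoc, h2, Matrix.mul_smul]
    rw [this, hm, smul_smul, smul_smul]
    congr 1; ring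

/-- two-site Pauli string -/
def pr (p q : Fin n) (a b : PI) : Fin n → PI := fun r => if r = p then a else if r = q then b else 0

lemma sg_zero_left (a : PI) : sg 0 a = 1 := by simp [sg]
lemma sg_zero_right (a : PI) : sg a 0 = 1 := by simp [sg]

lemma sgn_pr (p q : Fin n) (hpq : p ≠ q) (a b : PI) (c : Fin n → PI) :
    sgn (pr p q a b) c = sg a (c p) * sg b (c q) := by
  rw [sgn, ← Finset.prod_subset (Finset.subset_univ {p, q}), Finset.prod_pair hpq]
  · simp [pr, hpq.symm]
  · intro r _ hr
    simp only [Finset.mem_insert, Finset.mem_singleton, not_or] at hr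
    simp [pr, hr.1, hr.2, sg_zero_left]

lemma sg_exists (a : PI) (ha : a ≠ 0) : ∃ b, b ≠ a ∧ sg b a = -1 := by
  have : ∀ a : PI, a ≠ 0 → ∃ b : PI, b ≠ a ∧ ¬ (b.1 * a.2 + b.2 * a.1 = 0) := by decide
  obtain ⟨b, h1, h2⟩ := this a ha
  exact ⟨b, h1, by rw [sg, if_neg h2]⟩

lemma sg_self (a : PI) : sg a a = 1 := by
  have : ∀ a : PI, a.1 * a.2 + a.2 * a.1 = 0 := by decide
  rw [sg, if_pos (this a)]

lemma PI_add_self (a : PI) : a + a = 0 := by revert a; decide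
lemma PI_add_ne (a b : PI) (h : b ≠ a) : a + b ≠ 0 := by revert a b; decide

lemma Mv_kill (W : Finset (Fin n)) (p q : Fin n) (hp : p ∈ W) (hq : q ∈ W) (hpq : p ≠ q) (c : Fin n → PI)
    (hc : c p ≠ 0) : ∃ d, Mv W c d ∧ d p = 0 ∧ ∀ r, r ≠ p → r ≠ q → d r = c r := by
  have hW : ∀ a b, ∀ r, r ∉ W → pr p q a b r = 0 := by
    intro a b r hr
    rw [pr, if_neg (by rintro rfl; exact hr hp), if_neg (by rintro rfl; exact hr hq)]
  have key : ∀ c : Fin n → PI, c q ≠ 0 → ∃ d, Mv W c d ∧ d p = 0 ∧ ∀ r, r ≠ p → r ≠ q → d r = c r := by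
    intro c hcq
    obtain ⟨b, hb, hb'⟩ := sg_exists _ hcq
    refine ⟨c + pr p q (c p) b, Mv_basic W c _ (hW _ _) ?_, ?_, ?_⟩
    · rw [sgn_pr p q hpq, sg_self, hb', one_mul]
    · simp [pr, PI_add_self]
    · intro r h1 h2; simp [pr, h1, h2]
  by_cases hcq : c q = 0
  · obtain ⟨b, hb, hb'⟩ := sg_exists _ hc
    have hmv : Mv W c (c + pr p q b (1, 0)) := by
      refine Mv_basic W c _ (hW _ _) ?_
      rw [sgn_pr p q hpq, hb', hcq, sg_zero_right, mul_one]
    obtain ⟨d, h1, h2, h3⟩ := key (c + pr p q b (1, 0)) (by simp [pr, hpq.symm, hcq])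
    refine ⟨d, hmv.trans h1, h2, fun r hr hr' => ?_⟩
    rw [h3 r hr hr']; simp [pr, hr, hr']
  · exact key c hcq

lemma Mv_cost {W : Finset (Fin n)} {c d : Fin n → PI} (h : Mv W c d) (v : HSp (Fin t → (Fin n → Fin 2))) :
    ‖dD t (PS c) v‖ ≤ ‖dD t (PS d) v‖ + 4 * t * ‖v - (InvW t W).starProjection v‖ := by
  obtain ⟨U, hU, hL, φ, hφ, h⟩ := h
  have hU1 : U * Uᴴ = 1 := Matrix.mem_unitaryGroup_iff.1 hU
  have hU2 : Uᴴ * U = 1 := Matrix.mem_unitaryGroup_iff'.1 hU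
  have h1 := dD_conj U (PS c) hU1 v
  rw [h, dD_smul] at h1
  have h2 : ‖dD t (PS d) (ad t U v)‖ = ‖dD t (PS c) v‖ := by
    have := congrArg norm h1
    rwa [norm_smul, hφ, one_mul, ad_norm _ hU2] at this
  rw [← h2]
  have h3 : ad t U v = v + (ad t U v - v) := by abel
  rw [h3, map_add]
  refine (norm_add_le _ _).trans ?_
  have h4 := dD_norm_le (PS d) (by rw [PS_herm, PS_sq]) (ad t U v - v)
  have h5 := ad_loc_move hU hL v
  have ht : (0:ℝ) ≤ t := by positivity
  nlinarith [mul_le_mul_of_nonneg_left h5 (mul_nonneg zero_le_two ht)]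

/-- bond defect -/
def eb (t j : ℕ) (v : HSp (Fin t → (Fin n → Fin 2))) : ℝ := ‖v - (InvW t (bd n j)).starProjection v‖

lemma eb_nonneg (j : ℕ) (v : HSp (Fin t → (Fin n → Fin 2))) : 0 ≤ eb t j v := norm_nonneg _

lemma sweep (h : ℕ) (hn : h < n) (v : HSp (Fin t → (Fin n → Fin 2))) :
    ∀ m j : ℕ, j + m + 1 = h → ∀ c : Fin n → PI, (∀ r : Fin n, ¬ (j ≤ r.val ∧ r.val ≤ h) → c r = 0) →
      ‖dD t (PS c) v‖ ≤ 4 * t * ∑ i ∈ Finset.Ico j h, eb t i v := by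
  have ht : (0:ℝ) ≤ t := by positivity
  intro m
  induction m with
  | zero =>
    intro j hj c hc
    have hl : IsLoc (bd n j) (PS c) := by
      refine PS_loc _ c fun r hr => hc r fun hr' => hr ?_
      rw [mem_bd]; omega
    have := dD_loc_le (t := t) (by rw [PS_herm, PS_sq]) (PS_herm c) hl v
    have h2 : Finset.Ico j h = {j} := by
      subst hj; simp
    rw [h2, Finset.sum_singleton]
    refine this.trans ?_
    have := eb_nonneg j v
    show 2 * t * eb t j v ≤ _
    nlinarith [mul_nonneg ht this]
  | succ m ih =>
    intro j hj c hc
    rw [Finset.sum_eq_sum_Ico_succ_bot (by omega), mul_add]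
    have hnn := mul_nonneg (mul_nonneg (by norm_num : (0:ℝ) ≤ 4) ht) (eb_nonneg j v)
    by_cases hcj : c ⟨j, by omega⟩ = 0
    · have := ih (j + 1) (by omega) c (fun r hr => by
        by_cases hrj : r.val = j
        · rw [← hcj]; congr 1; ext; exact hrj
        · exact hc r (by omega))
      linarith
    · obtain ⟨d, h1, h2, h3⟩ := Mv_kill (bd n j) ⟨j, by omega⟩ ⟨j + 1, by omega⟩ (by simp [mem_bd]) (by simp [mem_bd])
        (by simp) c hcj
      have h4 := ih (j + 1) (by omega) d (fun r hr => by
        by_cases hrj : r.val = j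
        · rw [← h2]; congr 1; ext; exact hrj
        · rw [h3 r (by intro h; exact hrj (congrArg Fin.val h)) (by
            intro h; have := congrArg Fin.val h; simp at this; omega)]
          exact hc r (by omega))
      have h5 := Mv_cost (t := t) h1 v
      have : 4 * (t:ℝ) * ‖v - (InvW t (bd n j)).starProjection v‖ = 4 * t * eb t j v := rfl
      linarith

/-- interval of qubits -/
def itv (n l h : ℕ) : Finset (Fin n) := Finset.univ.filter fun r => l ≤ r.val ∧ r.val ≤ h

lemma mem_itv (l h : ℕ) (r : Fin n) : r ∈ itv n l h ↔ l ≤ r.val ∧ r.val ≤ h := by simp [itv]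

lemma embE_PS (W : Finset (Fin n)) (c : {r // r ∈ W} → PI) :
    embE (eW W) (PS c) = PS (fun r => if h : r ∈ W then c ⟨r, h⟩ else 0) := by
  ext x y
  rw [embE_apply]
  by_cases h : (eW W x).2 = (eW W y).2
  · rw [if_pos h, PS, PS, pten, pten]
    rw [← Fintype.prod_subtype_mul_prod_subtype (fun r => r ∈ W)
      (fun r => pa (if h : r ∈ W then c ⟨r, h⟩ else 0) (x r) (y r))]
    rw [show (∏ i : {r // ¬ r ∈ W}, pa (if h : i.1 ∈ W then c ⟨i.1, h⟩ else 0) (x i.1) (y i.1)) = 1 from ?_, mul_one]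
    · refine Finset.prod_congr (Finset.ext (by simp)) fun r _ => ?_
      rw [dif_pos r.2]; rfl
    · refine Finset.prod_eq_one fun r _ => ?_
      rw [dif_neg r.2, pa_zero, ((eW_compat W).h2 x y).1 h r.1 r.2, Matrix.one_apply_eq]
  · rw [if_neg h]
    rw [(eW_compat W).h2] at h
    exact ((PS_loc W _ (fun r hr => dif_neg hr)).1 x y h).symm

/-- base case on an interval -/
lemma base_itv (l h : ℕ) (hl : l < h) (hn : h < n) (v : HSp (Fin t → (Fin n → Fin 2))) :
    ‖v - (InvW t (itv n l h)).starProjection v‖ ≤ Real.pi * (4 * t * ∑ i ∈ Finset.Ico l h, eb t i v) := by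
  rw [(eW_compat (itv n l h)).inv_eq]
  apply base_abs
  · exact mul_nonneg (by positivity) (Finset.sum_nonneg fun i _ => eb_nonneg i v)
  · intro c
    rw [embE_PS]
    refine sweep h hn v (h - l - 1) l (by omega) _ fun r hr => ?_
    rw [dif_neg]; rwa [mem_itv]

lemma base_itv_sq (l h : ℕ) (hl : l < h) (hn : h < n) (v : HSp (Fin t → (Fin n → Fin 2))) :
    ‖v - (InvW t (itv n l h)).starProjection v‖ ^ 2 ≤
      16 * Real.pi ^ 2 * t ^ 2 * (h - l : ℕ) * ∑ i ∈ Finset.Ico l h, eb t i v ^ 2 := by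
  have h1 := pow_le_pow_left₀ (norm_nonneg _) (base_itv l h hl hn v) 2
  have h2 := sq_sum_le_card_mul_sum_sq (s := Finset.Ico l h) (f := fun i => eb t i v)
  rw [Nat.card_Ico] at h2
  refine h1.trans ?_
  have : (Real.pi * (4 * t * ∑ i ∈ Finset.Ico l h, eb t i v)) ^ 2
    = 16 * Real.pi ^ 2 * t ^ 2 * (∑ i ∈ Finset.Ico l h, eb t i v) ^ 2 := by ring
  rw [this, mul_assoc _ ((h - l : ℕ) : ℝ)]
  exact mul_le_mul_of_nonneg_left h2 (by positivity)

end sweep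

section tri_abs
variable {S : Type*} [Fintype S]

lemma offd_cs (a b : S → ℝ) :
    ∑ σ, ∑ τ ∈ Finset.univ.erase σ, a σ * b τ
      ≤ ((Fintype.card S : ℝ) - 1) * (Real.sqrt (∑ σ, a σ ^ 2) * Real.sqrt (∑ σ, b σ ^ 2)) := by
  by_cases hN : IsEmpty S
  · simp
  have hc : 1 ≤ Fintype.card S := Fintype.card_pos_iff.2 (not_isEmpty_iff.1 hN)
  have hc' : (0:ℝ) ≤ (Fintype.card S : ℝ) - 1 := by
    have : (1:ℝ) ≤ Fintype.card S := by exact_mod_cast hc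
    linarith
  have e1 : ∀ f : S → S → ℝ, ∑ σ, ∑ τ ∈ Finset.univ.erase σ, f σ τ
      = ∑ p ∈ (Finset.univ : Finset S).sigma (fun σ => Finset.univ.erase σ), f p.1 p.2 :=
    fun f => (Finset.sum_sigma Finset.univ (fun σ => Finset.univ.erase σ) (fun p : (_ : S) × S => f p.1 p.2)).symm
  have h := Finset.sum_mul_sq_le_sq_mul_sq ((Finset.univ : Finset S).sigma (fun σ => Finset.univ.erase σ))
    (fun p => a p.1) (fun p => b p.2)
  rw [← e1 (fun σ τ => a σ * b τ), ← e1 (fun σ τ => a σ ^ 2), ← e1 (fun σ τ => b τ ^ 2)] at h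
  have h1 : ∑ σ, ∑ τ ∈ Finset.univ.erase σ, a σ ^ 2 = ((Fintype.card S : ℝ) - 1) * ∑ σ, a σ ^ 2 := by
    rw [Finset.mul_sum]
    refine Finset.sum_congr rfl fun σ _ => ?_
    rw [Finset.sum_const, Finset.card_erase_of_mem (Finset.mem_univ _), Finset.card_univ, nsmul_eq_mul,
      Nat.cast_sub hc]
    simp
  have h2 : ∑ σ, ∑ τ ∈ Finset.univ.erase σ, b τ ^ 2 = ((Fintype.card S : ℝ) - 1) * ∑ σ, b σ ^ 2 := by
    have : ∀ σ : S, ∑ τ ∈ Finset.univ.erase σ, b τ ^ 2 = (∑ τ, b τ ^ 2) - b σ ^ 2 := fun σ => by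
      rw [← Finset.add_sum_erase _ _ (Finset.mem_univ σ)]; ring
    simp only [this]
    rw [Finset.sum_sub_distrib, Finset.sum_const, Finset.card_univ, nsmul_eq_mul]; ring
  rw [h1, h2] at h
  refine (le_abs_self _).trans (abs_le_of_sq_le_sq ?_ (by positivity))
  refine h.trans (le_of_eq ?_)
  rw [mul_pow, mul_pow, Real.sq_sqrt (by positivity), Real.sq_sqrt (by positivity)]; ring

variable {E : Type*} [NormedAddCommGroup E] [InnerProductSpace ℂ E]

lemma gram_low (u : S → E) (θ : ℝ) (hθ : 0 ≤ θ)
    (h : ∀ σ τ, σ ≠ τ → ‖inner ℂ (u σ) (u τ)‖ ≤ θ * ‖u σ‖ * ‖u τ‖) :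
    (1 - ((Fintype.card S : ℝ) - 1) * θ) * ∑ σ, ‖u σ‖ ^ 2 ≤ ‖∑ σ, u σ‖ ^ 2 := by
  have h0 : ‖∑ σ, u σ‖ ^ 2 = ∑ σ, ∑ τ, (inner ℂ (u σ) (u τ)).re := by
    rw [← inner_self_eq_norm_sq (𝕜 := ℂ), sum_inner]
    simp only [inner_sum]
    simp [Complex.re_sum]
  have h1 : ∀ σ, ‖u σ‖ ^ 2 - ∑ τ ∈ Finset.univ.erase σ, θ * (‖u σ‖ * ‖u τ‖) ≤ ∑ τ, (inner ℂ (u σ) (u τ)).re := by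
    intro σ
    rw [← Finset.add_sum_erase _ _ (Finset.mem_univ σ)]
    have e : (inner ℂ (u σ) (u σ)).re = ‖u σ‖ ^ 2 := by
      rw [← inner_self_eq_norm_sq (𝕜 := ℂ)]; rfl
    rw [e, sub_eq_add_neg, ← Finset.sum_neg_distrib]
    refine add_le_add le_rfl (Finset.sum_le_sum fun τ hτ => ?_)
    have := h σ τ (Finset.ne_of_mem_erase hτ).symm
    have h3 := Complex.abs_re_le_norm (inner ℂ (u σ) (u τ))
    have h4 := neg_abs_le (inner ℂ (u σ) (u τ)).re
    nlinarith
  have h2 := Finset.sum_le_sum fun σ (_ : σ ∈ Finset.univ) => h1 σ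
  rw [← h0, Finset.sum_sub_distrib] at h2
  have h3 := offd_cs (fun σ => ‖u σ‖) (fun σ => ‖u σ‖)
  rw [Real.mul_self_sqrt (by positivity)] at h3
  have h4 : ∑ σ, ∑ τ ∈ Finset.univ.erase σ, θ * (‖u σ‖ * ‖u τ‖) = θ * ∑ σ, ∑ τ ∈ Finset.univ.erase σ, ‖u σ‖ * ‖u τ‖ := by
    simp only [Finset.mul_sum]
  rw [h4] at h2
  have := mul_le_mul_of_nonneg_left h3 hθ
  nlinarith

lemma hs_tri (u w : S → E) (θ : ℝ) (hθ : 0 ≤ θ) (hx : ((Fintype.card S : ℝ) - 1) * θ < 1)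
    (hu : ∀ σ τ, σ ≠ τ → ‖inner ℂ (u σ) (u τ)‖ ≤ θ * ‖u σ‖ * ‖u τ‖)
    (hw : ∀ σ τ, σ ≠ τ → ‖inner ℂ (w σ) (w τ)‖ ≤ θ * ‖w σ‖ * ‖w τ‖)
    (hwu : ∀ σ τ, σ ≠ τ → ‖inner ℂ (w σ) (u τ)‖ ≤ θ * ‖w σ‖ * ‖u τ‖)
    (hd : ∀ σ, ‖inner ℂ (w σ) (u σ)‖ ≤ ‖w σ‖ * ∑ τ ∈ Finset.univ.erase σ, θ * ‖u τ‖)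
    (hN : 1 ≤ Fintype.card S) :
    (1 - ((Fintype.card S : ℝ) - 1) * θ) * ‖inner ℂ (∑ σ, w σ) (∑ σ, u σ)‖
      ≤ 2 * (((Fintype.card S : ℝ) - 1) * θ) * ‖∑ σ, w σ‖ * ‖∑ σ, u σ‖ := by
  set x := ((Fintype.card S : ℝ) - 1) * θ with hxd
  have hN' : (0:ℝ) ≤ (Fintype.card S : ℝ) - 1 := by
    have : (1:ℝ) ≤ Fintype.card S := by exact_mod_cast hN
    linarith
  have hx0 : 0 ≤ x := mul_nonneg hN' hθ
  set X := ∑ σ, ∑ τ ∈ Finset.univ.erase σ, ‖w σ‖ * ‖u τ‖ with hX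
  have h1 : ‖inner ℂ (∑ σ, w σ) (∑ σ, u σ)‖ ≤ 2 * θ * X := by
    rw [sum_inner]
    refine (norm_sum_le _ _).trans ?_
    rw [hX, Finset.mul_sum]
    refine Finset.sum_le_sum fun σ _ => ?_
    rw [inner_sum, ← Finset.add_sum_erase _ _ (Finset.mem_univ σ)]
    refine (norm_add_le _ _).trans ?_
    have a1 := hd σ
    have a2 : ‖∑ τ ∈ Finset.univ.erase σ, inner ℂ (w σ) (u τ)‖ ≤ ∑ τ ∈ Finset.univ.erase σ, θ * ‖w σ‖ * ‖u τ‖ :=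
      (norm_sum_le _ _).trans (Finset.sum_le_sum fun τ hτ => hwu σ τ (Finset.ne_of_mem_erase hτ).symm)
    have a3 : ∑ τ ∈ Finset.univ.erase σ, θ * ‖w σ‖ * ‖u τ‖ = θ * ∑ τ ∈ Finset.univ.erase σ, ‖w σ‖ * ‖u τ‖ := by
      rw [Finset.mul_sum]; exact Finset.sum_congr rfl fun τ _ => by ring
    have a4 : ‖w σ‖ * ∑ τ ∈ Finset.univ.erase σ, θ * ‖u τ‖ = θ * ∑ τ ∈ Finset.univ.erase σ, ‖w σ‖ * ‖u τ‖ := by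
      rw [Finset.mul_sum, Finset.mul_sum]; exact Finset.sum_congr rfl fun τ _ => by ring
    linarith
  have h2 := offd_cs (fun σ => ‖w σ‖) (fun σ => ‖u σ‖)
  have gu := gram_low u θ hθ hu
  have gw := gram_low w θ hθ hw
  rw [← hxd] at gu gw
  set a := Real.sqrt (∑ σ, ‖w σ‖ ^ 2)
  set b := Real.sqrt (∑ σ, ‖u σ‖ ^ 2)
  have ha : a ^ 2 = ∑ σ, ‖w σ‖ ^ 2 := Real.sq_sqrt (by positivity)
  have hb : b ^ 2 = ∑ σ, ‖u σ‖ ^ 2 := Real.sq_sqrt (by positivity)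
  have ha0 : 0 ≤ a := Real.sqrt_nonneg _
  have hb0 : 0 ≤ b := Real.sqrt_nonneg _
  rw [← hb] at gu
  rw [← ha] at gw
  have h3 : (1 - x) * (a * b) ≤ ‖∑ σ, w σ‖ * ‖∑ σ, u σ‖ := by
    refine (le_abs_self _).trans (abs_le_of_sq_le_sq ?_ (by positivity))
    have := mul_le_mul gw gu (by have : 0 ≤ 1 - x := by linarith
                                 positivity) (by positivity)
    nlinarith
  have h4 : 2 * θ * X ≤ 2 * x * (a * b) := by
    have := mul_le_mul_of_nonneg_left h2 hθ
    rw [hxd]; nlinarith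
  have h5 : (1 - x) * ‖inner ℂ (∑ σ, w σ) (∑ σ, u σ)‖ ≤ (1 - x) * (2 * x * (a * b)) :=
    mul_le_mul_of_nonneg_left (h1.trans h4) (by linarith)
  nlinarith [mul_le_mul_of_nonneg_left h3 hx0]

end tri_abs

section PiOps
variable {n t : ℕ}

abbrev ZZ (t : ℕ) := (Fin t → Fin 2) × (Fin t → Fin 2)
abbrev XX (t n : ℕ) := Fin t → Fin n → Fin 2

def rix (t n : ℕ) : (XX t n × XX t n) ≃ (Fin n → ZZ t) where
  toFun p r := (fun s => p.1 s r, fun s => p.2 s r)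
  invFun z := (fun s r => (z r).1 s, fun s r => (z r).2 s)
  left_inv _ := rfl
  right_inv _ := rfl

def phs (t : ℕ) : ℝ := (Real.sqrt 2 ^ t)⁻¹

lemma phs_sq (t : ℕ) : phs t * phs t = ((2:ℝ) ^ t)⁻¹ := by
  rw [phs, ← mul_inv, ← mul_pow, Real.mul_self_sqrt (by norm_num)]

lemma phs_pos (t : ℕ) : 0 < phs t := by rw [phs]; positivity

def ph (σ : Equiv.Perm (Fin t)) (z : ZZ t) : ℂ := if z.1 = z.2 ∘ σ then (phs t : ℂ) else 0

lemma ph_star (σ : Equiv.Perm (Fin t)) (z : ZZ t) : star (ph σ z) = ph σ z := by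
  rw [ph]; split_ifs <;> simp

def ovl (σ τ : Equiv.Perm (Fin t)) : ℂ := ∑ z, ph σ z * ph τ z

lemma ovl_eq (σ τ : Equiv.Perm (Fin t)) :
    ovl σ τ = (((2:ℝ) ^ t)⁻¹ * ((Finset.univ.filter fun b : Fin t → Fin 2 => b ∘ σ = b ∘ τ).card : ℝ) : ℝ) := by
  rw [ovl, Fintype.sum_prod_type_right, Finset.card_filter, Nat.cast_sum, Finset.mul_sum, Complex.ofReal_sum]
  refine Finset.sum_congr rfl fun b _ => ?_
  rw [Finset.sum_eq_single (b ∘ σ)]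
  · simp only [ph]
    by_cases h : b ∘ σ = b ∘ τ
    · rw [if_pos True.intro, if_pos h, if_pos h, ← Complex.ofReal_mul, phs_sq]; simp
    · rw [if_neg h, if_neg h]; simp
  · intro a _ ha; simp [ph, ha]
  · simp

lemma ovl_self (σ : Equiv.Perm (Fin t)) : ovl σ σ = 1 := by
  rw [ovl_eq]; simp

lemma ovl_le (σ τ : Equiv.Perm (Fin t)) (h : σ ≠ τ) : ‖ovl σ τ‖ ≤ 1 / 2 := by
  rw [ovl_eq, Complex.norm_real, Real.norm_of_nonneg (by positivity)]
  set A := Finset.univ.filter fun b : Fin t → Fin 2 => b ∘ σ = b ∘ τ with hA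
  obtain ⟨i, hi⟩ : ∃ i, σ i ≠ τ i := by
    by_contra hc; push Not at hc; exact h (Equiv.ext hc)
  let fl : (Fin t → Fin 2) → (Fin t → Fin 2) := fun b => Function.update b (σ i) (b (σ i) + 1)
  have hfl : ∀ b, fl (fl b) = b := by
    intro b
    funext s
    by_cases hs : s = σ i
    · subst hs
      have : ∀ x : Fin 2, x + 1 + 1 = x := by decide
      simp [fl, this]
    · simp [fl, hs]
  have h1 : (A.image fl).card = A.card := Finset.card_image_of_injective _ (fun x y hxy => by
    rw [← hfl x, ← hfl y]; exact congrArg fl hxy)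
  have h2 : Disjoint A (A.image fl) := by
    rw [Finset.disjoint_left]
    intro b hb hb'
    obtain ⟨b', hb1, rfl⟩ := Finset.mem_image.1 hb'
    have e1 := congrFun (Finset.mem_filter.1 hb).2 i
    have e2 := congrFun (Finset.mem_filter.1 hb1).2 i
    simp only [Function.comp, fl] at e1 e2
    rw [Function.update_self, Function.update_of_ne hi.symm, e2] at e1
    revert e1; generalize b' (τ i) = x; revert x; decide
  have h3 := Finset.card_le_univ (A ∪ A.image fl)
  rw [Finset.card_union_of_disjoint h2, h1] at h3
  have h4 : Fintype.card (Fin t → Fin 2) = 2 ^ t := by simp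
  rw [h4] at h3
  have h5 : (A.card : ℝ) + A.card ≤ 2 ^ t := by exact_mod_cast h3
  rw [inv_mul_le_iff₀ (by positivity)]; linarith

def PiM (σ : Equiv.Perm (Fin t)) (S : Finset (Fin n)) : Matrix (XX t n × XX t n) (XX t n × XX t n) ℂ :=
  (pten fun r => if r ∈ S then Matrix.vecMulVec (ph σ) (ph σ) else 1).submatrix (rix t n) (rix t n)

lemma vmv_mul (σ τ : Equiv.Perm (Fin t)) : Matrix.vecMulVec (ph σ) (ph σ) * Matrix.vecMulVec (ph τ) (ph τ)
    = ovl σ τ • Matrix.vecMulVec (ph σ) (ph τ) := by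
  ext x y
  simp only [Matrix.mul_apply, Matrix.vecMulVec_apply, Matrix.smul_apply, smul_eq_mul, ovl, Finset.sum_mul]
  exact Finset.sum_congr rfl fun z _ => by ring

lemma vmv_sand (σ τ : Equiv.Perm (Fin t)) : Matrix.vecMulVec (ph σ) (ph σ) * Matrix.vecMulVec (ph τ) (ph τ) *
    Matrix.vecMulVec (ph σ) (ph σ) = (ovl σ τ * ovl τ σ) • Matrix.vecMulVec (ph σ) (ph σ) := by
  rw [vmv_mul, Matrix.smul_mul]
  ext x y
  simp only [Matrix.mul_apply, Matrix.vecMulVec_apply, Matrix.smul_apply, smul_eq_mul]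
  rw [show ovl τ σ = ∑ z, ph τ z * ph σ z from rfl]
  simp only [Finset.sum_mul, Finset.mul_sum]
  exact Finset.sum_congr rfl fun z _ => by ring

lemma PiM_mul (σ : Equiv.Perm (Fin t)) (S T : Finset (Fin n)) : PiM σ S * PiM σ T = PiM σ (S ∪ T) := by
  rw [PiM, PiM, PiM, Matrix.submatrix_mul_equiv, pten_mul]
  congr 2; funext r
  by_cases h1 : r ∈ S <;> by_cases h2 : r ∈ T <;> simp [h1, h2, vmv_mul, ovl_self]

lemma PiM_star (σ : Equiv.Perm (Fin t)) (S : Finset (Fin n)) : (PiM σ S)ᴴ = PiM σ S := by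
  rw [PiM, Matrix.conjTranspose_submatrix, pten_conjTranspose]
  congr 2; funext r
  by_cases h1 : r ∈ S
  · rw [if_pos h1]
    ext x y
    simp only [Matrix.conjTranspose_apply, Matrix.vecMulVec_apply, star_mul, ph_star]
    
  · rw [if_neg h1]; simp

lemma PiM_sand (σ τ : Equiv.Perm (Fin t)) (S : Finset (Fin n)) :
    PiM σ S * PiM τ S * PiM σ S = ((ovl σ τ * ovl τ σ) ^ S.card) • PiM σ S := by
  have : (ovl σ τ * ovl τ σ) ^ S.card = ∏ r, if r ∈ S then (ovl σ τ * ovl τ σ) else 1 := by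
    rw [Finset.prod_ite_mem]; simp
  rw [this, PiM, PiM, Matrix.submatrix_mul_equiv, Matrix.submatrix_mul_equiv, pten_mul, pten_mul]
  show _ = Matrix.submatrix ((∏ r, if r ∈ S then ovl σ τ * ovl τ σ else 1) • pten (fun r => if r ∈ S then Matrix.vecMulVec (ph σ) (ph σ) else 1)) (rix t n) (rix t n)
  rw [← pten_smul]
  congr 2; funext r
  by_cases h1 : r ∈ S
  · simp only [if_pos h1]; rw [vmv_sand]
  · simp [h1]

def PiO (σ : Equiv.Perm (Fin t)) (S : Finset (Fin n)) : HSp (XX t n) →L[ℂ] HSp (XX t n) :=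
  Matrix.toEuclideanCLM (𝕜 := ℂ) (PiM σ S)

lemma PiO_mul (σ : Equiv.Perm (Fin t)) (S T : Finset (Fin n)) (v : HSp (XX t n)) :
    PiO σ S (PiO σ T v) = PiO σ (S ∪ T) v := by
  rw [PiO, PiO, PiO, ← PiM_mul, map_mul]; rfl

lemma PiO_inner (σ : Equiv.Perm (Fin t)) (S : Finset (Fin n)) (u v : HSp (XX t n)) :
    inner ℂ (PiO σ S u) v = inner ℂ u (PiO σ S v) := by
  have : ContinuousLinearMap.adjoint (PiO σ S) = PiO σ S := by
    rw [← ContinuousLinearMap.star_eq_adjoint, PiO, ← map_star, Matrix.star_eq_conjTranspose, PiM_star]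
  conv_rhs => rw [← this]
  rw [ContinuousLinearMap.adjoint_inner_right]

lemma PiO_norm_sq (σ : Equiv.Perm (Fin t)) (S : Finset (Fin n)) (v : HSp (XX t n)) :
    (‖PiO σ S v‖ ^ 2 : ℝ) = (inner ℂ v (PiO σ S v)).re := by
  rw [← inner_self_eq_norm_sq (𝕜 := ℂ), PiO_inner, PiO_mul, Finset.union_self]; rfl

lemma PiO_le (σ : Equiv.Perm (Fin t)) (S : Finset (Fin n)) (v : HSp (XX t n)) : ‖PiO σ S v‖ ≤ ‖v‖ := by
  have h := PiO_norm_sq σ S v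
  have h1 := (Complex.re_le_norm _).trans (norm_inner_le_norm (𝕜 := ℂ) v (PiO σ S v))
  by_contra hc
  push Not at hc
  nlinarith [norm_nonneg v]

lemma PiO_ov (σ τ : Equiv.Perm (Fin t)) (hne : σ ≠ τ) (S : Finset (Fin n)) (v : HSp (XX t n)) (hv : PiO σ S v = v) :
    ‖PiO τ S v‖ ≤ (1 / 2) ^ S.card * ‖v‖ := by
  have h := PiO_norm_sq τ S v
  have h1 : PiO σ S (PiO τ S (PiO σ S v)) = ((ovl σ τ * ovl τ σ) ^ S.card) • PiO σ S v := by
    have : PiO σ S * PiO τ S * PiO σ S = ((ovl σ τ * ovl τ σ) ^ S.card) • PiO σ S := by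
      rw [PiO, PiO, ← map_mul, ← map_mul, PiM_sand, map_smul]
    exact congrArg (fun f : HSp (XX t n) →L[ℂ] HSp (XX t n) => f v) this
  have h2 : inner ℂ v (PiO τ S v) = (ovl σ τ * ovl τ σ) ^ S.card * inner ℂ v v := by
    conv_lhs => rw [← hv]
    rw [PiO_inner, h1, hv, inner_smul_right]
  have h3 : ‖PiO τ S v‖ ^ 2 ≤ ((1 / 2) ^ S.card * ‖v‖) ^ 2 := by
    rw [h]
    refine (Complex.re_le_norm _).trans ?_
    rw [h2, norm_mul, norm_pow, norm_mul, mul_pow ((1 / 2 : ℝ) ^ S.card), ← pow_mul, mul_comm S.card 2, pow_mul]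
    have a1 := ovl_le σ τ hne
    have a2 := ovl_le τ σ hne.symm
    have a3 : ‖inner ℂ v v‖ = ‖v‖ ^ 2 := by
      rw [inner_self_eq_norm_sq_to_K]; simp
    rw [a3]
    refine mul_le_mul_of_nonneg_right (pow_le_pow_left₀ (by positivity) ?_ _) (by positivity)
    calc ‖ovl σ τ‖ * ‖ovl τ σ‖ ≤ (1/2) * (1/2) := mul_le_mul a1 a2 (norm_nonneg _) (by norm_num)
      _ = (1/2)^2 := by norm_num
  exact (le_abs_self _).trans (abs_le_of_sq_le_sq h3 (by positivity))

end PiOps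

section PiMem
variable {n t : ℕ}

def FF (σ : Equiv.Perm (Fin t)) (W : Finset (Fin n)) (h : XX t n × XX t n → ℂ) : HSp (XX t n) :=
  WithLp.toLp 2 fun p => (∏ r ∈ W, ph σ (rix t n p r)) * h p

lemma FF_apply (σ : Equiv.Perm (Fin t)) (W : Finset (Fin n)) (h : XX t n × XX t n → ℂ) (p : XX t n × XX t n) :
    FF σ W h p = (∏ r ∈ W, ph σ (rix t n p r)) * h p := rfl

def OffD (W : Finset (Fin n)) (h : XX t n × XX t n → ℂ) : Prop :=
  ∀ p q, (∀ r, r ∉ W → rix t n p r = rix t n q r) → h p = h q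

def GG (σ : Equiv.Perm (Fin t)) (W : Finset (Fin n)) (p q : XX t n × XX t n) : ℂ :=
  ∏ r, if r ∈ W then ph σ (rix t n q r) else if rix t n p r = rix t n q r then 1 else 0

lemma PiM_apply (σ : Equiv.Perm (Fin t)) (W : Finset (Fin n)) (p q : XX t n × XX t n) :
    PiM σ W p q = (∏ r ∈ W, ph σ (rix t n p r)) * GG σ W p q := by
  have : ∏ r ∈ W, ph σ (rix t n p r) = ∏ r, if r ∈ W then ph σ (rix t n p r) else 1 := by
    rw [Finset.prod_ite_mem]; simp
  rw [this, GG, ← Finset.prod_mul_distrib, PiM, Matrix.submatrix_apply, pten]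
  refine Finset.prod_congr rfl fun r _ => ?_
  by_cases h : r ∈ W
  · simp only [if_pos h]; rfl
  · simp only [if_neg h, Matrix.one_apply, one_mul]

lemma PiO_apply (σ : Equiv.Perm (Fin t)) (W : Finset (Fin n)) (v : HSp (XX t n)) (p : XX t n × XX t n) :
    PiO σ W v p = ∑ q, PiM σ W p q * v q := rfl

lemma PiO_eq_FF (σ : Equiv.Perm (Fin t)) (W : Finset (Fin n)) (v : HSp (XX t n)) :
    ∃ h, OffD W h ∧ PiO σ W v = FF σ W h := by
  refine ⟨fun p => ∑ q, GG σ W p q * v q, ?_, ?_⟩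
  · intro p q hpq
    refine Finset.sum_congr rfl fun z _ => ?_
    congr 1
    refine Finset.prod_congr rfl fun r _ => ?_
    by_cases h : r ∈ W
    · rw [if_pos h, if_pos h]
    · rw [if_neg h, if_neg h, hpq r h]
  · ext p
    rw [PiO_apply, FF_apply, Finset.mul_sum]
    exact Finset.sum_congr rfl fun q _ => by rw [PiM_apply, mul_assoc]

lemma PiO_FF (σ : Equiv.Perm (Fin t)) (W : Finset (Fin n)) (h : XX t n × XX t n → ℂ) (hh : OffD W h) :
    PiO σ W (FF σ W h) = FF σ W h := by
  ext p
  rw [PiO_apply, FF_apply]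
  have h1 : ∀ q, PiM σ W p q * FF σ W h q = (∏ r ∈ W, ph σ (rix t n p r)) * h p *
      ∏ r, (if r ∈ W then ph σ (rix t n q r) * ph σ (rix t n q r) else if rix t n p r = rix t n q r then 1 else 0) := by
    intro q
    have e : ∏ r ∈ W, ph σ (rix t n q r) = ∏ r, if r ∈ W then ph σ (rix t n q r) else 1 := by
      rw [Finset.prod_ite_mem]; simp
    rw [PiM_apply, FF_apply]
    have e2 : GG σ W p q * (∏ r ∈ W, ph σ (rix t n q r)) =
      ∏ r, (if r ∈ W then ph σ (rix t n q r) * ph σ (rix t n q r) else if rix t n p r = rix t n q r then 1 else 0) := by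
      rw [e, GG, ← Finset.prod_mul_distrib]
      refine Finset.prod_congr rfl fun r _ => ?_
      by_cases h : r ∈ W <;> simp [h]
    rw [← e2]
    by_cases hq : ∀ r, r ∉ W → rix t n p r = rix t n q r
    · rw [hh p q hq]; ring
    · push Not at hq
      obtain ⟨r, hr, hne⟩ := hq
      have : GG σ W p q = 0 := Finset.prod_eq_zero (Finset.mem_univ r) (by rw [if_neg hr, if_neg hne])
      rw [this]; ring
  rw [Finset.sum_congr rfl fun q _ => h1 q, ← Finset.mul_sum]
  have h2 : ∑ q, ∏ r, (if r ∈ W then ph σ (rix t n q r) * ph σ (rix t n q r) else if rix t n p r = rix t n q r then 1 else 0)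
     = 1 := by
    rw [Equiv.sum_comp (rix t n) (fun z => ∏ r, (if r ∈ W then ph σ (z r) * ph σ (z r) else if rix t n p r = z r then (1:ℂ) else 0))]
    have := Finset.prod_univ_sum (fun _ : Fin n => (Finset.univ : Finset (ZZ t)))
      (fun r z => (if r ∈ W then ph σ z * ph σ z else if rix t n p r = z then (1:ℂ) else 0))
    rw [Fintype.piFinset_univ] at this
    rw [← this]
    refine Finset.prod_eq_one fun r _ => ?_
    by_cases hr : r ∈ W
    · simp only [if_pos hr]; exact ovl_self σ
    · simp [hr]
  rw [h2, mul_one]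

lemma prod_ph (σ : Equiv.Perm (Fin t)) (W : Finset (Fin n)) (p : XX t n × XX t n) :
    ∏ r ∈ W, ph σ (rix t n p r) = (phs t : ℂ) ^ W.card *
      permM σ (Jn t (eW W) p.1).1 (Jn t (eW W) p.2).1 := by
  rw [permM_apply]
  by_cases h : (Jn t (eW W) p.1).1 = (Jn t (eW W) p.2).1 ∘ σ
  · rw [if_pos h, mul_one, ← Finset.prod_const]
    refine Finset.prod_congr rfl fun r hr => ?_
    rw [ph, if_pos]
    funext s
    exact congrFun (congrFun h s) ⟨r, hr⟩
  · rw [if_neg h, mul_zero]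
    have : ∃ r ∈ W, (rix t n p r).1 ≠ (rix t n p r).2 ∘ σ := by
      by_contra hc; push Not at hc
      apply h
      funext s r
      exact congrFun (hc r.1 r.2) s
    obtain ⟨r, hr, hne⟩ := this
    exact Finset.prod_eq_zero hr (by rw [ph, if_neg hne])

lemma FF_mem (σ : Equiv.Perm (Fin t)) (W : Finset (Fin n)) (h : XX t n × XX t n → ℂ) (hh : OffD W h) :
    FF σ W h ∈ InvW t W := by
  rw [(eW_compat W).inv_eq, InvE_slt]
  intro b b'
  have : slt (eW W) b b' (FF σ W h) = toV (((phs t : ℂ) ^ W.card *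
      h ((Jn t (eW W)).symm (0, b), (Jn t (eW W)).symm (0, b'))) • permM σ) := by
    ext q
    rw [slc_apply, FF_apply, prod_ph, toV_apply, Matrix.smul_apply, smul_eq_mul]
    simp only [Equiv.apply_symm_apply]
    rw [hh _ ((Jn t (eW W)).symm (0, b), (Jn t (eW W)).symm (0, b'))]
    · ring
    · intro r hr
      simp only [rix, Equiv.coe_fn_mk, Jn_symm]
      have key : ∀ (a : {r // r ∈ W} → Fin 2) (c : {r // ¬ r ∈ W} → Fin 2), (eW W).symm (a, c) r = c ⟨r, hr⟩ := by
        intro a c; simp [eW, hr]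
      simp only [key]
  rw [this]
  exact permM_inv _ _

lemma PiO_mem (σ : Equiv.Perm (Fin t)) (W : Finset (Fin n)) (v : HSp (XX t n)) : PiO σ W v ∈ InvW t W := by
  obtain ⟨h, hh, e⟩ := PiO_eq_FF σ W v
  rw [e]; exact FF_mem σ W h hh

lemma InvW_dec (W : Finset (Fin n)) (hc : 3 * t ≤ 2 ^ W.card) (u : HSp (XX t n)) (hu : u ∈ InvW t W) :
    ∃ f : Equiv.Perm (Fin t) → HSp (XX t n), u = ∑ σ, f σ ∧ ∀ σ, PiO σ W (f σ) = f σ := by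
  rw [(eW_compat W).inv_eq, InvE_slt] at hu
  have hcard : 3 * t ≤ Fintype.card ({r // r ∈ W} → Fin 2) := by simpa using hc
  choose c hcc using fun b b' => invF_fft hcard _ (hu b b')
  let h : Equiv.Perm (Fin t) → XX t n × XX t n → ℂ := fun σ p =>
    ((phs t : ℂ) ^ W.card)⁻¹ * c (Jn t (eW W) p.1).2 (Jn t (eW W) p.2).2 σ
  have hoff : ∀ σ, OffD W (h σ) := by
    intro σ p q hpq
    have e1 : (Jn t (eW W) p.1).2 = (Jn t (eW W) q.1).2 := by
      funext s r; exact congrFun (congrArg Prod.fst (hpq r.1 r.2)) s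
    have e2 : (Jn t (eW W) p.2).2 = (Jn t (eW W) q.2).2 := by
      funext s r; exact congrFun (congrArg Prod.snd (hpq r.1 r.2)) s
    simp only [h, e1, e2]
  refine ⟨fun σ => FF σ W (h σ), ?_, fun σ => PiO_FF σ W _ (hoff σ)⟩
  ext p
  have h1 := congrFun (congrFun (hcc (Jn t (eW W) p.1).2 (Jn t (eW W) p.2).2) (Jn t (eW W) p.1).1) (Jn t (eW W) p.2).1
  rw [toM_apply, slc_apply] at h1
  simp only [Prod.mk.eta, Equiv.symm_apply_apply] at h1
  have h2 : (∑ σ, FF σ W (h σ)) p = ∑ σ, FF σ W (h σ) p := by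
    rw [WithLp.ofLp_sum, Finset.sum_apply]
  rw [h2]
  have h3 : u p = u (p.1, p.2) := rfl
  rw [h3, h1, Matrix.sum_apply]
  refine Finset.sum_congr rfl fun σ _ => ?_
  rw [FF_apply, prod_ph, Matrix.smul_apply, smul_eq_mul]
  have hne : (phs t : ℂ) ^ W.card ≠ 0 := pow_ne_zero _ (by exact_mod_cast (phs_pos t).ne')
  simp only [h]
  field_simp

/-- overlap of the invariant spaces of two windows -/
lemma tri_overlap (ht : 1 ≤ t) (S T : Finset (Fin n)) (hS : 3 * t ≤ 2 ^ S.card) (hT : 3 * t ≤ 2 ^ T.card)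
    (x : ℝ) (hx : x = ((t.factorial : ℝ) - 1) * (1 / 2) ^ (S ∩ T).card) (hx1 : x < 1)
    (u w : HSp (XX t n)) (hu : u ∈ InvW t S) (hw : w ∈ InvW t T) (hperp : u ∈ (InvW t S ⊓ InvW t T)ᗮ) :
    (1 - x) * ‖inner ℂ w u‖ ≤ 2 * x * ‖w‖ * ‖u‖ := by
  obtain ⟨f, hf, hfp⟩ := InvW_dec S hS u hu
  obtain ⟨g, hg, hgp⟩ := InvW_dec T hT w hw
  set W := S ∩ T with hW
  have absorb : ∀ (σ : Equiv.Perm (Fin t)) (A B : Finset (Fin n)) (v : HSp (XX t n)), B ⊆ A → PiO σ A v = v → PiO σ B v = v := by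
    intro σ A B v hBA hv
    conv_lhs => rw [← hv]
    rw [PiO_mul, Finset.union_eq_right.2 hBA, hv]
  have hfW : ∀ σ, PiO σ W (f σ) = f σ := fun σ => absorb σ S W _ Finset.inter_subset_left (hfp σ)
  have hgW : ∀ σ, PiO σ W (g σ) = g σ := fun σ => absorb σ T W _ Finset.inter_subset_right (hgp σ)
  set θ : ℝ := (1 / 2) ^ W.card with hθ
  have hθ0 : 0 ≤ θ := by positivity
  have gen : ∀ σ τ (a b : HSp (XX t n)), σ ≠ τ → PiO σ W a = a → PiO τ W b = b → ‖inner ℂ a b‖ ≤ θ * ‖a‖ * ‖b‖ := by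
    intro σ τ a b hne ha hb
    rw [← hb, ← PiO_inner]
    refine (norm_inner_le_norm _ _).trans ?_
    rw [hb]
    exact mul_le_mul_of_nonneg_right (PiO_ov σ τ hne W a ha) (norm_nonneg _)
  have hcard : (Fintype.card (Equiv.Perm (Fin t)) : ℝ) = t.factorial := by
    rw [Fintype.card_perm, Fintype.card_fin]
  have hC0 : ∀ τ, PiO τ (S ∪ T) u = 0 := by
    intro τ
    have hmem : PiO τ (S ∪ T) u ∈ InvW t S ⊓ InvW t T := by
      constructor
      · rw [← PiO_mul]; exact PiO_mem _ _ _
      · rw [Finset.union_comm, ← PiO_mul]; exact PiO_mem _ _ _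
    have h1 := PiO_norm_sq τ (S ∪ T) u
    have h2 : inner ℂ u (PiO τ (S ∪ T) u) = 0 := Submodule.inner_left_of_mem_orthogonal hmem hperp
    rw [h2] at h1
    have : ‖PiO τ (S ∪ T) u‖ = 0 := by simpa using h1
    exact norm_eq_zero.1 this
  have key := hs_tri f g θ hθ0 (by rw [hcard, ← hx]; exact hx1)
    (fun σ τ h => gen σ τ _ _ h (hfW σ) (hfW τ)) (fun σ τ h => gen σ τ _ _ h (hgW σ) (hgW τ))
    (fun σ τ h => gen σ τ _ _ h (hgW σ) (hfW τ)) ?_ Fintype.card_pos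
  · rw [hcard, ← hx, ← hf, ← hg] at key; exact key
  · intro σ
    have e1 : inner ℂ (g σ) (f σ) = inner ℂ (g σ) (PiO σ (S ∪ T) (f σ)) := by
      conv_lhs => rw [← hgp σ, ← hfp σ, PiO_inner, PiO_mul, Finset.union_comm]
    rw [e1]
    refine (norm_inner_le_norm _ _).trans (mul_le_mul_of_nonneg_left ?_ (norm_nonneg _))
    have e2 : PiO σ (S ∪ T) (f σ) = - ∑ τ ∈ Finset.univ.erase σ, PiO σ (S ∪ T) (f τ) := by
      have := hC0 σ
      rw [hf, map_sum, ← Finset.add_sum_erase _ _ (Finset.mem_univ σ)] at this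
      exact eq_neg_of_add_eq_zero_left this
    rw [e2, norm_neg]
    refine (norm_sum_le _ _).trans ?_
    refine le_trans (b := ∑ τ ∈ Finset.univ.erase σ, θ * ‖f τ‖) (Finset.sum_le_sum fun τ hτ => ?_)
      (le_of_eq (Finset.sum_congr (Finset.ext (by simp)) fun _ _ => rfl))
    have hne := Finset.ne_of_mem_erase hτ
    have e3 : PiO σ (S ∪ T) (f τ) = PiO σ (S ∪ T) (PiO σ W (f τ)) := by
      rw [PiO_mul, Finset.union_eq_left.2 (Finset.inter_subset_left.trans Finset.subset_union_left)]
    rw [e3]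
    exact (PiO_le _ _ _).trans (PiO_ov τ σ hne W _ (hfW τ))

end PiMem

section gap
variable {n t : ℕ}

lemma card_itv (l h : ℕ) (hn : h < n) : (itv n l h).card = h + 1 - l := by
  rw [← Nat.card_Icc l h, ← Finset.card_map Fin.valEmbedding]
  congr 1
  ext r
  simp only [Finset.mem_map, mem_itv, Fin.valEmbedding_apply, Finset.mem_Icc]
  constructor
  · rintro ⟨a, ha, rfl⟩; exact ha
  · intro hr; exact ⟨⟨r, by omega⟩, hr, rfl⟩

def whi (n ℓ j : ℕ) : ℕ := if j = n / ℓ - 2 then n - 1 else (j + 2) * ℓ - 1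

lemma three_le (t : ℕ) : 3 * t ≤ 2 ^ (2 * t ^ 2) := by
  have h1 : 2 * t ^ 2 + 1 ≤ 2 ^ (2 * t ^ 2) := Nat.lt_two_pow_self
  rcases Nat.eq_zero_or_pos t with h | h
  · subst h; simp
  · nlinarith

lemma gap_main (ht : 1 ≤ t) (hn : 3 * t ^ 2 ≤ n) (ε x : ℝ) (hε0 : 0 ≤ ε) (hε : ε < 1 / 2)
    (hx : x = ((t.factorial : ℝ) - 1) * (1 / 2) ^ (t ^ 2)) (hx1 : x < 1) (hxe : 2 * x ≤ ε * (1 - x))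
    (v : HSp (XX t n)) (hv : v ∈ (InvW t (Finset.univ : Finset (Fin n)))ᗮ) :
    (1 - 2 * ε) * ‖v‖ ^ 2 ≤ 32 * Real.pi ^ 2 * t ^ 2 * (3 * t ^ 2 - 2) * ∑ i ∈ Finset.range (n - 1), eb t i v ^ 2 := by
  obtain ⟨ℓ, hℓ⟩ : ∃ ℓ, ℓ = t ^ 2 := ⟨_, rfl⟩
  have hℓ1 : 1 ≤ ℓ := by rw [hℓ]; exact Nat.one_le_pow _ _ ht
  rw [← hℓ] at hn
  obtain ⟨q, hq⟩ : ∃ q, q = n / ℓ := ⟨_, rfl⟩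
  have hq3 : 3 ≤ q := by rw [hq, Nat.le_div_iff_mul_le (by omega)]; omega
  have hqn : q * ℓ ≤ n := by rw [hq]; exact Nat.div_mul_le_self _ _
  have hqn' : n < q * ℓ + ℓ := by
    rw [hq]; have := Nat.lt_div_mul_add (a := n) (b := ℓ) (by omega); omega
  have hwl : whi n ℓ (q - 2) = n - 1 := by rw [whi, if_pos (by omega)]
  have hwo : ∀ j, j ≠ q - 2 → whi n ℓ j = (j + 2) * ℓ - 1 := fun j hj => by rw [whi, if_neg (by omega)]
  have hmul : ∀ a b, a ≤ b → a * ℓ ≤ b * ℓ := fun a b h => Nat.mul_le_mul_right _ h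
  have e2 : (q - 2) * ℓ + 2 * ℓ = q * ℓ := by rw [← add_mul]; congr 1; omega
  have hlh : ∀ j, j < q - 1 → j * ℓ < whi n ℓ j ∧ whi n ℓ j < n ∧ whi n ℓ j - j * ℓ ≤ 3 * ℓ - 2 ∧ (j + 2) * ℓ - 1 ≤ whi n ℓ j := by
    intro j hj
    by_cases h : j = q - 2
    · rw [h, hwl]
      have : (q - 2 + 2) * ℓ = q * ℓ := by congr 1; omega
      omega
    · rw [hwo j h]
      have := hmul (j + 2) q (by omega)
      have e : (j + 2) * ℓ = j * ℓ + 2 * ℓ := by ring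
      omega
  let K : Fin (q - 1) → Submodule ℂ (HSp (XX t n)) := fun j => InvW t (itv n (j.val * ℓ) (whi n ℓ j.val))
  have hcover : ∀ i, i < n - 1 → ∃ j, j < q - 1 ∧ j * ℓ ≤ i ∧ i < whi n ℓ j := by
    intro i hi
    by_cases h : i / ℓ < q - 2
    · refine ⟨i / ℓ, by omega, Nat.div_mul_le_self _ _, ?_⟩
      rw [hwo _ (by omega)]
      have := Nat.lt_div_mul_add (a := i) (b := ℓ) (by omega)
      have e : (i / ℓ + 2) * ℓ = i / ℓ * ℓ + 2 * ℓ := by ring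
      omega
    · refine ⟨q - 2, by omega, ?_, by rw [hwl]; exact hi⟩
      exact (hmul _ _ (by omega)).trans (Nat.div_mul_le_self i ℓ)
  have hinf : (⨅ j, K j) ≤ InvW t (Finset.univ : Finset (Fin n)) := by
    intro w hw
    rw [Submodule.mem_iInf] at hw
    have hz : ∀ i ∈ Finset.Ico 0 (n - 1), eb t i w = 0 := by
      intro i hi
      obtain ⟨j, hj, h1, h2⟩ := hcover i (Finset.mem_Ico.1 hi).2
      have : w ∈ InvW t (bd n i) := by
        refine InvW_anti ?_ (hw ⟨j, hj⟩)
        intro r hr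
        rw [mem_bd] at hr
        rw [mem_itv]
        simp only
        omega
      rw [eb, Submodule.starProjection_eq_self_iff.2 this, sub_self, norm_zero]
    have hb := base_itv (t := t) (n := n) 0 (n - 1) (by omega) (by omega) w
    rw [Finset.sum_eq_zero hz] at hb
    have huniv : itv n 0 (n - 1) = Finset.univ := by
      ext r; rw [mem_itv]; simp; omega
    rw [huniv] at hb
    have h0 : w - (InvW t (Finset.univ : Finset (Fin n))).starProjection w = 0 := by
      rw [← norm_le_zero_iff]; simpa using hb
    rw [sub_eq_zero.1 h0]
    exact Submodule.starProjection_apply_mem _ _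
  have hchain := hs_chain_gap (q - 1) K ε hε0 hε ?_ ?_ v (Submodule.orthogonal_le hinf hv)
  · refine hchain.trans ?_
    have hb : ∀ j : Fin (q - 1), ‖v - (K j).starProjection v‖ ^ 2 ≤ 16 * Real.pi ^ 2 * t ^ 2 * (3 * t ^ 2 - 2) *
        ∑ i ∈ Finset.range (n - 1), if j.val * ℓ ≤ i ∧ i < whi n ℓ j.val then eb t i v ^ 2 else 0 := by
      intro j
      obtain ⟨h1, h2, h3, _⟩ := hlh j.val j.2
      refine (base_itv_sq _ _ h1 h2 v).trans ?_
      have e : ∑ i ∈ Finset.Ico (j.val * ℓ) (whi n ℓ j.val), eb t i v ^ 2 =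
          ∑ i ∈ Finset.range (n - 1), if j.val * ℓ ≤ i ∧ i < whi n ℓ j.val then eb t i v ^ 2 else 0 := by
        rw [← Finset.sum_filter]
        refine Finset.sum_congr ?_ fun _ _ => rfl
        ext i; simp; omega
      rw [e]
      refine mul_le_mul_of_nonneg_right (mul_le_mul_of_nonneg_left ?_ (by positivity))
        (Finset.sum_nonneg fun i _ => by split_ifs <;> positivity)
      have h3' : (whi n ℓ j.val - j.val * ℓ) + 2 ≤ 3 * ℓ := by omega
      have : ((whi n ℓ j.val - j.val * ℓ : ℕ) : ℝ) + 2 ≤ 3 * (t:ℝ) ^ 2 := by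
        rw [hℓ] at h3' ⊢; exact_mod_cast h3'
      linarith
    refine (Finset.sum_le_sum fun j _ => hb j).trans ?_
    rw [← Finset.mul_sum, Finset.sum_comm]
    have hcount : ∀ i, ∑ j : Fin (q - 1), (if j.val * ℓ ≤ i ∧ i < whi n ℓ j.val then eb t i v ^ 2 else 0) ≤ 2 * eb t i v ^ 2 := by
      intro i
      rw [← Finset.sum_filter, Finset.sum_const, nsmul_eq_mul]
      refine mul_le_mul_of_nonneg_right ?_ (by positivity)
      set c := min (i / ℓ) (q - 2) with hc
      have hsub : ((Finset.univ.filter fun j : Fin (q - 1) => j.val * ℓ ≤ i ∧ i < whi n ℓ j.val).map Fin.valEmbedding) ⊆ {c, c - 1} := by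
        intro j hj
        rw [Finset.mem_map] at hj
        obtain ⟨j', hj', rfl⟩ := hj
        rw [Finset.mem_filter] at hj'
        obtain ⟨_, h1, h2⟩ := hj'
        have a1 : j'.val ≤ i / ℓ := (Nat.le_div_iff_mul_le (by omega)).2 h1
        have a2 := j'.2
        simp only [Fin.valEmbedding_apply, Finset.mem_insert, Finset.mem_singleton]
        by_cases h : j'.val = q - 2
        · left; omega
        · rw [hwo _ h] at h2
          have : i / ℓ < j'.val + 2 := (Nat.div_lt_iff_lt_mul (by omega)).2 (by omega)
          omega
      have := (Finset.card_le_card hsub).trans Finset.card_le_two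
      rw [Finset.card_map] at this
      exact_mod_cast this
    have ht2 : (0:ℝ) ≤ 3 * t ^ 2 - 2 := by
      have : (1:ℝ) ≤ t := by exact_mod_cast ht
      nlinarith
    have := mul_le_mul_of_nonneg_left (Finset.sum_le_sum fun i (_ : i ∈ Finset.range (n - 1)) => hcount i)
      (show 0 ≤ 16 * Real.pi ^ 2 * t ^ 2 * (3 * (t:ℝ) ^ 2 - 2) by positivity)
    refine this.trans (le_of_eq ?_)
    rw [← Finset.mul_sum]; ring
  · intro i j hij w
    apply InvW_comm
    rw [Finset.disjoint_left]
    intro r hr hr'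
    rw [mem_itv] at hr hr'
    have := j.2
    rw [hwo i.val (by omega)] at hr
    have := hmul (i.val + 2) j.val (by omega)
    have : 1 ≤ (i.val + 2) * ℓ := Nat.mul_pos (by omega) hℓ1
    omega
  · intro i j hij a ha b hb ha' hb'
    have hj2 := j.2
    obtain ⟨i1, i2, i3, i4⟩ := hlh i.val i.2
    obtain ⟨j1, j2, j3, j4⟩ := hlh j.val j.2
    have hwi := hwo i.val (by omega)
    have eij : j.val * ℓ = i.val * ℓ + ℓ := by rw [← hij]; ring
    have eji : (j.val + 2) * ℓ = i.val * ℓ + 3 * ℓ := by rw [← hij]; ring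
    have eii : (i.val + 2) * ℓ = i.val * ℓ + 2 * ℓ := by ring
    have hInt : itv n (j.val * ℓ) (whi n ℓ j.val) ∩ itv n (i.val * ℓ) (whi n ℓ i.val) = itv n (j.val * ℓ) (whi n ℓ i.val) := by
      ext r; simp only [Finset.mem_inter, mem_itv]; omega
    have hc : (itv n (j.val * ℓ) (whi n ℓ j.val) ∩ itv n (i.val * ℓ) (whi n ℓ i.val)).card = ℓ := by
      rw [hInt, card_itv _ _ i2]; omega
    have big : ∀ l h, h < n → 2 * ℓ ≤ h + 1 - l → 3 * t ≤ 2 ^ (itv n l h).card := by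
      intro l h hh hlh
      rw [card_itv _ _ hh]
      refine (three_le t).trans (Nat.pow_le_pow_right (by norm_num) (by rw [← hℓ]; exact hlh))
    have := tri_overlap ht (itv n (j.val * ℓ) (whi n ℓ j.val)) (itv n (i.val * ℓ) (whi n ℓ i.val))
      (big _ _ j2 (by omega)) (big _ _ i2 (by omega)) x (by rw [hc, hx, hℓ]) hx1 b a hb ha (by rw [inf_comm]; exact hb')
    have h1x : 0 < 1 - x := by linarith
    have h2 : 2 * x * ‖a‖ * ‖b‖ ≤ ε * (1 - x) * ‖a‖ * ‖b‖ :=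
      mul_le_mul_of_nonneg_right (mul_le_mul_of_nonneg_right hxe (norm_nonneg _)) (norm_nonneg _)
    have h3 : (1 - x) * ‖inner ℂ a b‖ ≤ (1 - x) * (ε * ‖a‖ * ‖b‖) := by nlinarith
    exact le_of_mul_le_mul_left h3 h1x

end gap

section chn
variable {E : Type*} [NormedAddCommGroup E] [InnerProductSpace ℂ E]

def chn (f : ℕ → E →L[ℂ] E) : ℕ → ℕ → E → E
  | 0, _, v => v
  | d + 1, s, v => f s (chn f d (s + 1) v)

lemma chn_hybrid (f g : ℕ → E →L[ℂ] E) (κ : ℝ) (hκ : 0 ≤ κ) (hf : ∀ i v, ‖f i v‖ ≤ ‖v‖) (hg : ∀ i v, ‖g i v‖ ≤ ‖v‖)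
    (m : ℕ) (hfg : ∀ i, i < m → ∀ v, ‖f i v - g i v‖ ≤ κ * ‖v‖) (d s : ℕ) (hd : s + d ≤ m) (v : E) :
    ‖chn g d s v‖ ≤ ‖v‖ ∧ ‖chn f d s v - chn g d s v‖ ≤ d * κ * ‖v‖ := by
  induction d generalizing s with
  | zero => simp [chn]
  | succ d ih =>
    obtain ⟨h1, h2⟩ := ih (s + 1) (by omega)
    refine ⟨(hg _ _).trans h1, ?_⟩
    have e : chn f (d + 1) s v - chn g (d + 1) s v
        = f s (chn f d (s + 1) v - chn g d (s + 1) v) + (f s (chn g d (s + 1) v) - g s (chn g d (s + 1) v)) := by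
      simp only [chn, map_sub]; abel
    rw [e]
    refine (norm_add_le _ _).trans ?_
    have a1 := (hf s _).trans h2
    have a2 := (hfg s (by omega) (chn g d (s + 1) v)).trans (mul_le_mul_of_nonneg_left h1 hκ)
    push_cast
    linarith

lemma chn_norm (g : ℕ → E →L[ℂ] E) (hg : ∀ i v, ‖g i v‖ ≤ ‖v‖) (d s : ℕ) (v : E) : ‖chn g d s v‖ ≤ ‖v‖ :=
  (chn_hybrid g g 0 le_rfl hg hg (s + d) (by simp) d s le_rfl v).1

lemma chn_sub (f : ℕ → E →L[ℂ] E) (d s : ℕ) (u v : E) : chn f d s (u - v) = chn f d s u - chn f d s v := by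
  induction d generalizing s with
  | zero => rfl
  | succ d ih => simp only [chn, ih, map_sub]

lemma chn_fix (f : ℕ → E →L[ℂ] E) (d s : ℕ) (v : E) (h : ∀ i, f i v = v) : chn f d s v = v := by
  induction d generalizing s with
  | zero => rfl
  | succ d ih => simp only [chn, ih, h]

lemma chn_pres (f : ℕ → E →L[ℂ] E) (K : Submodule ℂ E) (h : ∀ i, ∀ v ∈ K, f i v ∈ K) (d s : ℕ) (v : E) (hv : v ∈ K) :
    chn f d s v ∈ K := by
  induction d generalizing s with
  | zero => exact hv
  | succ d ih => exact h _ _ (ih _)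

end chn

section brick
variable {n t : ℕ}

def Kb (t n j : ℕ) : Submodule ℂ (HSp (XX t n)) := if j < n - 1 then InvW t (bd n j) else ⊤

lemma proj_top' (v : HSp (XX t n)) : (⊤ : Submodule ℂ (HSp (XX t n))).starProjection v = v :=
  Submodule.starProjection_eq_self_iff.2 trivial

lemma Kb_comm (i j : ℕ) (h : i + 1 < j) (v : HSp (XX t n)) :
    (Kb t n i).starProjection ((Kb t n j).starProjection v) = (Kb t n j).starProjection ((Kb t n i).starProjection v) := by
  by_cases hj : j < n - 1
  · rw [Kb, Kb, if_pos hj, if_pos (by omega)]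
    apply InvW_comm
    rw [Finset.disjoint_left]
    intro r h1 h2
    rw [mem_bd] at h1 h2; omega
  · rw [Kb, Kb, if_neg hj, proj_top', proj_top']

lemma Kb_ge (j : ℕ) : InvW t (Finset.univ : Finset (Fin n)) ≤ Kb t n j := by
  rw [Kb]; split_ifs
  · exact InvW_anti (Finset.subset_univ _)
  · exact le_top

lemma proj_perp {E : Type*} [NormedAddCommGroup E] [InnerProductSpace ℂ E] [FiniteDimensional ℂ E] (K L : Submodule ℂ E) (h : L ≤ K) (v : E) (hv : v ∈ Lᗮ) : K.starProjection v ∈ Lᗮ := by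
  rw [Submodule.mem_orthogonal] at hv ⊢
  intro u hu
  rw [← Submodule.inner_starProjection_left_eq_right, Submodule.starProjection_eq_self_iff.2 (h hu)]
  exact hv u hu

def evP (t n : ℕ) : ℕ → HSp (XX t n) →L[ℂ] HSp (XX t n) := fun i => (Kb t n (2 * i)).starProjection
def odP (t n : ℕ) : ℕ → HSp (XX t n) →L[ℂ] HSp (XX t n) := fun i => (Kb t n (2 * i + 1)).starProjection

lemma proj_norm_le' {E : Type*} [NormedAddCommGroup E] [InnerProductSpace ℂ E] [FiniteDimensional ℂ E] (K : Submodule ℂ E) (v : E) : ‖K.starProjection v‖ ≤ ‖v‖ :=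
  K.norm_starProjection_apply_le v

lemma brick_gap (Δ : ℝ)
    (hgap : ∀ v ∈ (InvW t (Finset.univ : Finset (Fin n)))ᗮ, Δ * ‖v‖ ^ 2 ≤ ∑ i ∈ Finset.range (n - 1), eb t i v ^ 2)
    (ψ : HSp (XX t n)) (hψ : ψ ∈ (InvW t (Finset.univ : Finset (Fin n)))ᗮ) :
    (1 + Δ / 4) * ‖chn (odP t n) ((n - 1) / 2) 0 (chn (evP t n) (n / 2) 0 ψ)‖ ^ 2 ≤ ‖ψ‖ ^ 2 ∧
    chn (odP t n) ((n - 1) / 2) 0 (chn (evP t n) (n / 2) 0 ψ) ∈ (InvW t (Finset.univ : Finset (Fin n)))ᗮ := by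
  set χ := chn (evP t n) (n / 2) 0 ψ with hχ
  set φ := chn (odP t n) ((n - 1) / 2) 0 χ with hφ
  have hχp : χ ∈ (InvW t (Finset.univ : Finset (Fin n)))ᗮ :=
    chn_pres _ _ (fun i v hv => proj_perp _ _ (Kb_ge _) v hv) _ _ _ hψ
  have hφp : φ ∈ (InvW t (Finset.univ : Finset (Fin n)))ᗮ :=
    chn_pres _ _ (fun i v hv => proj_perp _ _ (Kb_ge _) v hv) _ _ _ hχp
  refine ⟨?_, hφp⟩
  have step : ∀ (f : ℕ → HSp (XX t n) →L[ℂ] HSp (XX t n)) (m : ℕ) (w : HSp (XX t n)) (htop : ∀ j, m ≤ j → ∀ v, f j v = v) (j : ℕ),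
      chn f (m - j) j w = f j (chn f (m - (j + 1)) (j + 1) w) := by
    intro f m w htop j
    by_cases h : j < m
    · rw [show m - j = (m - (j + 1)) + 1 by omega]; rfl
    · rw [show m - j = 0 by omega, show m - (j + 1) = 0 by omega]
      simp only [chn]; rw [htop j (by omega)]
  have hev : ∀ a, χ ∈ Kb t n (2 * a) := by
    have := (hs_detect (fun j => if j % 2 = 0 then (⊤ : Submodule ℂ (HSp (XX t n))) else Kb t n (j - 1)) (n / 2) ?_ ψ ?_
      (fun j => chn (evP t n) (n / 2 - j) j ψ) ?_ ?_).1
    · intro a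
      have h := this a
      simp only [show ¬ ((2 * a + 1) % 2 = 0) by omega, if_false] at h
      exact h
    · intro i j hij v
      by_cases hi : i % 2 = 0
      · simp only [hi, if_true]; rw [proj_top', proj_top']
      · by_cases hj : j % 2 = 0
        · simp only [hj, if_true]; rw [proj_top', proj_top']
        · simp only [hi, hj, if_false]
          exact Kb_comm _ _ (by omega) v
    · intro a; simp
    · intro j
      have h := step (evP t n) (n / 2) ψ (fun j hj v => by
        show (Kb t n (2 * j)).starProjection v = v
        have e : Kb t n (2 * j) = ⊤ := if_neg (by omega)
        rw [e]; exact proj_top' v) j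
      simp only [show ¬ ((2 * j + 1) % 2 = 0) by omega, if_false]
      exact h
    · intro j hj
      simp only [show n / 2 - j = 0 by omega, chn]
  obtain ⟨h1, h2⟩ := hs_detect (Kb t n) ((n - 1) / 2) (fun i j h v => Kb_comm i j h v) χ hev
    (fun j => chn (odP t n) ((n - 1) / 2 - j) j χ)
    (step (odP t n) _ χ fun j hj v => by
      show (Kb t n (2 * j + 1)).starProjection v = v
      have e : Kb t n (2 * j + 1) = ⊤ := if_neg (by omega)
      rw [e]; exact proj_top' v)
    (fun j hj => by simp only [show (n - 1) / 2 - j = 0 by omega, chn])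
  have h3 := h2 n
  simp only [Nat.sub_zero] at h1 h3
  rw [← hφ] at h1 h3
  have h4 : ∑ i ∈ Finset.range (n - 1), eb t i φ ^ 2 ≤ ∑ a ∈ Finset.range n, ‖φ - (Kb t n (2 * a)).starProjection φ‖ ^ 2 := by
    have hz : ∀ i ∈ Finset.range (n - 1), i % 2 ≠ 0 → eb t i φ ^ 2 = 0 := by
      intro i hi ho
      have hh := h1 (i / 2)
      rw [show 2 * (i / 2) + 1 = i by omega, Kb, if_pos (Finset.mem_range.1 hi)] at hh
      rw [eb, Submodule.starProjection_eq_self_iff.2 hh]; simp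
    rw [← Finset.sum_filter_of_ne (p := fun i => i % 2 = 0) (fun i hi hne => by
      by_contra hc; exact hne (hz i hi hc))]
    have hinj : ∑ i ∈ (Finset.range (n - 1)).filter (fun i => i % 2 = 0), eb t i φ ^ 2
       = ∑ a ∈ ((Finset.range (n - 1)).filter (fun i => i % 2 = 0)).image (fun i => i / 2), ‖φ - (Kb t n (2 * a)).starProjection φ‖ ^ 2 := by
      rw [Finset.sum_image]
      · refine Finset.sum_congr rfl fun i hi => ?_
        rw [Finset.mem_filter, Finset.mem_range] at hi
        rw [show 2 * (i / 2) = i by omega, Kb, if_pos hi.1, eb]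
      · intro a ha b hb hab
        simp only [Finset.coe_filter, Set.mem_setOf_eq] at ha hb
        have hab' : a / 2 = b / 2 := hab
        omega
    rw [hinj]
    refine Finset.sum_le_sum_of_subset_of_nonneg ?_ fun _ _ _ => by positivity
    intro a ha
    rw [Finset.mem_image] at ha
    obtain ⟨i, hi, rfl⟩ := ha
    rw [Finset.mem_filter, Finset.mem_range] at hi
    rw [Finset.mem_range]; omega
  have h5 := hgap φ hφp
  have h6 : ‖χ‖ ^ 2 ≤ ‖ψ‖ ^ 2 :=
    pow_le_pow_left₀ (norm_nonneg _) (chn_norm _ (fun i v => proj_norm_le' _ v) _ _ _) 2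
  nlinarith

end brick

section gen

lemma sum_ofFn_prod {A : Type*} [Semiring A] {X : Type*} [Fintype X] (k : ℕ) (F : Fin k → X → A) :
    ∑ f : Fin k → X, (List.ofFn fun i => F i (f i)).prod = (List.ofFn fun i => ∑ x, F i x).prod := by
  induction k with
  | zero => simp
  | succ k ih =>
    rw [← (Fin.consEquiv fun _ : Fin (k + 1) => X).sum_comp, Fintype.sum_prod_type]
    simp only [Fin.consEquiv, Equiv.coe_fn_mk, List.ofFn_succ, Fin.cons_zero, Fin.cons_succ, List.prod_cons]
    simp only [← Finset.mul_sum]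
    rw [ih (fun i => F i.succ), Finset.sum_mul]

variable {E : Type*} [NormedAddCommGroup E] [InnerProductSpace ℂ E] [FiniteDimensional ℂ E]

lemma spec_contr (T : E →L[ℂ] E) (h : ∀ (c : ℂ) (v : E), v ≠ 0 → T v = c • v → ‖c‖ < 1) :
    ∃ r : ℝ, 0 < r ∧ r < 1 ∧ ∃ K : ℕ, ∀ k, K ≤ k → ‖T ^ k‖ ≤ r ^ k := by
  haveI : CompleteSpace E := FiniteDimensional.complete ℂ E
  have hs : ∀ c ∈ spectrum ℂ T, ‖c‖ < 1 := by
    intro c hc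
    have h1 : spectrum ℂ ((Module.End.toContinuousLinearMap E) (T : E →ₗ[ℂ] E)) = spectrum ℂ (T : E →ₗ[ℂ] E) :=
      AlgEquiv.spectrum_eq _ _
    have h2 : (Module.End.toContinuousLinearMap E) (T : E →ₗ[ℂ] E) = T := by ext v; rfl
    rw [h2] at h1
    rw [h1] at hc
    have h3 := Module.End.hasEigenvalue_iff_mem_spectrum.2 hc
    obtain ⟨v, hv⟩ := h3.exists_hasEigenvector
    exact h c v hv.2 hv.apply_eq_smul
  have hr : spectralRadius ℂ T < 1 := by
    by_cases hne : (spectrum ℂ T).Nonempty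
    · exact spectrum.spectralRadius_lt_of_forall_lt_of_nonempty (r := 1) hne (fun c hc => by
        have := hs c hc
        exact_mod_cast this)
    · rw [Set.not_nonempty_iff_eq_empty] at hne
      simp [spectralRadius, hne]
  obtain ⟨q, hq1, hq2⟩ := ENNReal.lt_iff_exists_nnreal_btwn.1 hr
  have hq3 : q < 1 := by exact_mod_cast hq2
  have ev := (spectrum.pow_nnnorm_pow_one_div_tendsto_nhds_spectralRadius T).eventually (gt_mem_nhds hq1)
  rw [Filter.eventually_atTop] at ev
  obtain ⟨K, hK⟩ := ev
  have hq0 : 0 < q := by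
    have : (0 : ENNReal) < q := lt_of_le_of_lt (by simp) hq1
    exact_mod_cast this
  refine ⟨q, by exact_mod_cast hq0, by exact_mod_cast hq3, K + 1, fun k hk => ?_⟩
  have h4 := (hK k (by omega)).le
  have hk0 : (k : ℝ) ≠ 0 := by exact_mod_cast (by omega : k ≠ 0)
  have h5 : ((‖T ^ k‖₊ : ENNReal) ^ (1 / (k : ℝ))) ^ (k : ℝ) ≤ (q : ENNReal) ^ (k : ℝ) :=
    ENNReal.rpow_le_rpow h4 (by positivity)
  rw [← ENNReal.rpow_mul, one_div_mul_cancel hk0, ENNReal.rpow_one, ENNReal.rpow_natCast] at h5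
  exact_mod_cast h5

/-- equality case in an average of isometries -/
lemma avg_eq {J : Type*} (s : Finset J) (A : J → E →L[ℂ] E) (hA : ∀ j ∈ s, ∀ v, ‖A j v‖ = ‖v‖) (v : E) (c : ℂ) (hc : 1 ≤ ‖c‖)
    (h : ∑ j ∈ s, A j v = (s.card : ℂ) • c • v) : ∀ j ∈ s, A j v = c • v := by
  have h1 : ∑ j ∈ s, ‖A j v - c • v‖ ^ 2 = s.card * ‖v‖ ^ 2 * (1 - ‖c‖ ^ 2) := by
    have e : ∀ j ∈ s, ‖A j v - c • v‖ ^ 2 = (‖v‖ ^ 2 + ‖c • v‖ ^ 2) - 2 * (inner ℂ (A j v) (c • v)).re := by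
      intro j hj
      rw [hs_norm_sub_sq, hA j hj]; ring
    rw [Finset.sum_congr rfl e, Finset.sum_sub_distrib, Finset.sum_const, ← Finset.mul_sum, ← Complex.re_sum, ← sum_inner, h,
      inner_smul_left, map_natCast]
    have : ((s.card : ℂ) * inner ℂ (c • v) (c • v)).re = s.card * ‖c • v‖ ^ 2 := by
      rw [← hs_re_self]; simp
    rw [this, norm_smul, nsmul_eq_mul]; ring
  have h2 : ∑ j ∈ s, ‖A j v - c • v‖ ^ 2 ≤ 0 := by
    rw [h1]
    have : 1 - ‖c‖ ^ 2 ≤ 0 := by nlinarith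
    exact mul_nonpos_of_nonneg_of_nonpos (by positivity) this
  have h3 := (Finset.sum_eq_zero_iff_of_nonneg (fun j _ => by positivity)).1
    (le_antisymm h2 (Finset.sum_nonneg fun j _ => by positivity))
  intro j hj
  have := h3 j hj
  rw [sq_eq_zero_iff, norm_eq_zero, sub_eq_zero] at this
  exact this
lemma avg_pow {J : Type*} (UB : Finset J) (hne : UB.Nonempty) (A : J → E →L[ℂ] E) (hA : ∀ j ∈ UB, ∀ v, ‖A j v‖ = ‖v‖)
    (P : E →L[ℂ] E) (hPA : ∀ j ∈ UB, ∀ v, P (A j v) = P v) (hAP : ∀ j ∈ UB, ∀ v, A j (P v) = P v)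
    (hPP : ∀ v, P (P v) = P v)
    (hfix : ∀ (c : ℂ) (v : E), v ≠ 0 → (∀ j ∈ UB, A j v = c • v) → P v = v) :
    ∃ r : ℝ, 0 < r ∧ r < 1 ∧ ∃ K : ℕ, ∀ k, K ≤ k →
      ‖(∑ U ∈ UB, A U) ^ k - ((UB.card : ℂ) ^ k) • P‖ ≤ (UB.card : ℝ) ^ k * r ^ k := by
  have hN0 : (UB.card : ℂ) ≠ 0 := by exact_mod_cast (Finset.card_pos.2 hne).ne'
  obtain ⟨N, hN⟩ : ∃ N : ℂ, N = (UB.card : ℂ) := ⟨_, rfl⟩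
  rw [← hN] at hN0 ⊢
  obtain ⟨S, hS⟩ : ∃ S : E →L[ℂ] E, S = ∑ U ∈ UB, A U := ⟨_, rfl⟩
  rw [← hS]
  have hPS : P * S = N • P := by
    ext1 v
    show P (S v) = N • P v
    rw [hS, ContinuousLinearMap.sum_apply, map_sum, Finset.sum_congr rfl fun j hj => hPA j hj v, Finset.sum_const, hN]
    exact (Nat.cast_smul_eq_nsmul ℂ _ _).symm
  have hSP : S * P = N • P := by
    ext1 v
    show S (P v) = N • P v
    rw [hS, ContinuousLinearMap.sum_apply, Finset.sum_congr rfl fun j hj => hAP j hj v, Finset.sum_const, hN]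
    exact (Nat.cast_smul_eq_nsmul ℂ _ _).symm
  have hPP : P * P = P := by
    ext1 v; exact hPP v
  obtain ⟨r, hr0, hr1, K, hK⟩ := spec_contr (N⁻¹ • S - P) (by
    intro c v hv hc
    by_contra hlt
    push Not at hlt
    have hP0 : P v = 0 := by
      have e : P * (N⁻¹ • S - P) = 0 := by
        rw [mul_sub, mul_smul_comm, hPS, smul_smul, inv_mul_cancel₀ hN0, one_smul, hPP, sub_self]
      have e2 : P ((N⁻¹ • S - P) v) = 0 := by
        have := congrArg (fun T : E →L[ℂ] E => T v) e
        exact this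
      rw [hc, map_smul] at e2
      rcases smul_eq_zero.1 e2 with h | h
      · rw [h, norm_zero] at hlt; linarith
      · exact h
    have hSv : ∑ U ∈ UB, A U v = N • c • v := by
      have e : (N⁻¹ • S - P) v = N⁻¹ • S v - P v := rfl
      rw [e, hP0, sub_zero] at hc
      rw [← hc, smul_smul, mul_inv_cancel₀ hN0, one_smul, hS, ContinuousLinearMap.sum_apply]
    have h1 := avg_eq UB A hA v c hlt (hN ▸ hSv)
    have h3 := hfix c v hv h1
    exact hv (by rw [← h3, hP0]))
  refine ⟨r, hr0, hr1, K + 1, fun k hk => ?_⟩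
  have hpow : ∀ k : ℕ, (N⁻¹ • S - P) ^ (k + 1) = (N⁻¹ ^ (k + 1)) • S ^ (k + 1) - P := by
    intro k
    have hSkP : ∀ j : ℕ, S ^ j * P = N ^ j • P := by
      intro j
      induction j with
      | zero => simp
      | succ j ih => rw [pow_succ, mul_assoc, hSP, mul_smul_comm, ih, smul_smul]; ring_nf
    induction k with
    | zero => simp
    | succ k ih =>
      rw [pow_succ, ih, mul_sub, sub_mul, sub_mul, mul_smul_comm, mul_smul_comm, hPS, hPP, smul_mul_assoc, smul_mul_assoc,
        hSkP, smul_smul, smul_smul, smul_smul, ← pow_succ, inv_mul_cancel₀ hN0, one_smul, ← mul_pow,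
        inv_mul_cancel₀ hN0, one_pow, one_smul, sub_self, sub_zero, pow_succ N⁻¹ (k + 1), mul_comm N⁻¹]
  obtain ⟨k, rfl⟩ : ∃ j, k = j + 1 := ⟨k - 1, by omega⟩
  have h1 := hK (k + 1) (by omega)
  rw [hpow] at h1
  have h2 : S ^ (k + 1) - (N ^ (k + 1)) • P = (N ^ (k + 1)) • ((N⁻¹ ^ (k + 1)) • S ^ (k + 1) - P) := by
    rw [smul_sub, smul_smul, ← mul_pow, mul_inv_cancel₀ hN0, one_pow, one_smul]
  rw [h2, norm_smul, norm_pow]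
  have h3 : ‖N‖ = (UB.card : ℝ) := by rw [hN]; simp
  rw [h3]
  exact mul_le_mul_of_nonneg_left h1 (by positivity)
end gen

section gate
variable {ξ : Type*} [Fintype ξ] [DecidableEq ξ] {t : ℕ}

lemma ad_mul' (A B : Matrix ξ ξ ℂ) : ad t (A * B) = ad t A * ad t B := by
  ext1 v; exact ad_mul A B v

lemma ad_one' : ad t (1 : Matrix ξ ξ ℂ) = 1 := by ext1 v; exact ad_one v

lemma ad_prod (l : List (Matrix ξ ξ ℂ)) : ad t l.prod = (l.map (ad t)).prod := by
  induction l with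
  | nil => simp [ad_one']
  | cons a l ih => simp [ad_mul', ih]

lemma unit_star {U : Matrix ξ ξ ℂ} (hU : U ∈ Matrix.unitaryGroup ξ ℂ) : Uᴴ * U = 1 := by
  have := Matrix.mem_unitaryGroup_iff'.1 hU
  rwa [Matrix.star_eq_conjTranspose] at this

lemma invF_proj_ad (U : Matrix ξ ξ ℂ) (hU : U ∈ Matrix.unitaryGroup ξ ℂ) (v : HSp (Fin t → ξ)) :
    (invF t ξ).starProjection (ad t U v) = (invF t ξ).starProjection v := by
  apply Submodule.eq_starProjection_of_mem_of_inner_eq_zero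
  · exact Submodule.starProjection_apply_mem _ _
  · intro w hw
    have hw' : ad t Uᴴ w = w := (mem_invF w).1 hw _ (by
      rw [← Matrix.star_eq_conjTranspose]; exact Unitary.star_mem hU)
    have h1 : inner ℂ (ad t U v) w = inner ℂ v w := by rw [ad_inner, hw']
    rw [inner_sub_left, h1, ← inner_sub_left]
    exact Submodule.starProjection_inner_eq_zero v w hw

lemma tpow_continuous : Continuous fun U : Matrix ξ ξ ℂ => tpowMat t U := by
  refine continuous_matrix fun x y => ?_
  exact continuous_finset_prod _ fun s _ => continuous_id.matrix_elem _ _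

lemma ad_continuous (v : HSp (Fin t → ξ)) : Continuous fun U : Matrix.unitaryGroup ξ ℂ => ad t (U : Matrix ξ ξ ℂ) v := by
  have h0 : Continuous fun U : Matrix.unitaryGroup ξ ℂ => tpowMat t (U : Matrix ξ ξ ℂ) :=
    tpow_continuous.comp continuous_subtype_val
  have h : Continuous fun U : Matrix.unitaryGroup ξ ℂ => tpowMat t (U : Matrix ξ ξ ℂ) * toM v * (tpowMat t (U : Matrix ξ ξ ℂ))ᴴ :=
    (h0.matrix_mul continuous_const).matrix_mul h0.matrix_conjTranspose
  refine (PiLp.continuous_toLp 2 _).comp (continuous_pi fun p => ?_)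
  exact h.matrix_elem _ _

/-- every unitary is a square of a unitary -/
lemma unitary_sqrt (U : Matrix ξ ξ ℂ) (hU : U ∈ Matrix.unitaryGroup ξ ℂ) : ∃ W ∈ Matrix.unitaryGroup ξ ℂ, U = W * W := by
  obtain ⟨V, θ, hV, -, h⟩ := unitary_diag U hU
  have hV' : Vᴴ * V = 1 := mul_eq_one_comm.1 hV
  refine ⟨_, diag_exp_unitary V hV (fun i => θ i / 2), ?_⟩
  have e : ∀ D : Matrix ξ ξ ℂ, V * D * Vᴴ * (V * D * Vᴴ) = V * (D * (Vᴴ * V) * D) * Vᴴ := by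
    intro D; simp only [mul_assoc]
  rw [e, hV', mul_one, Matrix.diagonal_mul_diagonal, h]
  congr 3; funext i
  rw [← Complex.exp_add]; congr 1; push_cast; ring

lemma gate_fix (UB UM : Finset (Matrix.unitaryGroup ξ ℂ)) (hMB : UM ⊆ UB) (hMne : UM.Nonempty)
    (hMinv : ∀ U ∈ UM, U⁻¹ ∈ UM)
    (hdense : Dense ((Subgroup.closure (↑UB : Set (Matrix.unitaryGroup ξ ℂ)) :
        Subgroup (Matrix.unitaryGroup ξ ℂ)) : Set (Matrix.unitaryGroup ξ ℂ)))
    (v : HSp (Fin t → ξ)) (hv : v ≠ 0) (c : ℂ) (h : ∀ U ∈ UB, ad t (U : Matrix ξ ξ ℂ) v = c • v) :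
    v ∈ invF t ξ := by
  obtain ⟨U, hU⟩ := hMne
  have hinv : ∀ U : Matrix.unitaryGroup ξ ℂ, ∀ v, ad t ((U⁻¹ : Matrix.unitaryGroup ξ ℂ) : Matrix ξ ξ ℂ) (ad t (U : Matrix ξ ξ ℂ) v) = v := by
    intro U v
    rw [← ad_mul, ← Submonoid.coe_mul, inv_mul_cancel, Submonoid.coe_one, ad_one]
  have hc : c * c = 1 := by
    have h1 := hinv U v
    rw [h U (hMB hU), map_smul, h _ (hMB (hMinv U hU)), smul_smul] at h1
    have h2 : (c * c - 1) • v = 0 := by rw [sub_smul, h1, one_smul, sub_self]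
    rcases smul_eq_zero.1 h2 with h3 | h3
    · linear_combination h3
    · exact absurd h3 hv
  have hc' : c = 1 ∨ c = -1 := mul_self_eq_one_iff.1 hc
  have hall : ∀ g : Matrix.unitaryGroup ξ ℂ, ad t (g : Matrix ξ ξ ℂ) v = v ∨ ad t (g : Matrix ξ ξ ℂ) v = -v := by
    have hcl : IsClosed {g : Matrix.unitaryGroup ξ ℂ | ad t (g : Matrix ξ ξ ℂ) v = v ∨ ad t (g : Matrix ξ ξ ℂ) v = -v} :=
      (isClosed_eq (ad_continuous v) continuous_const).union (isClosed_eq (ad_continuous v) continuous_const)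
    have hsub : ((Subgroup.closure (↑UB : Set (Matrix.unitaryGroup ξ ℂ)) :
        Subgroup (Matrix.unitaryGroup ξ ℂ)) : Set (Matrix.unitaryGroup ξ ℂ)) ⊆
        {g : Matrix.unitaryGroup ξ ℂ | ad t (g : Matrix ξ ξ ℂ) v = v ∨ ad t (g : Matrix ξ ξ ℂ) v = -v} := by
      intro g hg
      induction hg using Subgroup.closure_induction with
      | mem x hx =>
        rcases hc' with rfl | rfl
        · left; simpa using h x hx
        · right; simpa using h x hx
      | one => left; simpa using ad_one v
      | mul x y _ _ hx hy =>
        simp only [Set.mem_setOf_eq, Submonoid.coe_mul, ad_mul] at *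
        rcases hx with hx | hx <;> rcases hy with hy | hy <;> simp [hx, hy]
      | inv x _ hx =>
        simp only [Set.mem_setOf_eq] at *
        have h1 := hinv x v
        rcases hx with hx | hx
        · left; rwa [hx] at h1
        · right; rw [hx, map_neg] at h1
          rw [← neg_eq_iff_eq_neg]; exact h1
    intro g
    have : g ∈ closure {g : Matrix.unitaryGroup ξ ℂ | ad t (g : Matrix ξ ξ ℂ) v = v ∨ ad t (g : Matrix ξ ξ ℂ) v = -v} :=
      closure_mono hsub (hdense g)
    rw [hcl.closure_eq] at this
    exact this
  rw [mem_invF]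
  intro U hU
  obtain ⟨W, hW, rfl⟩ := unitary_sqrt U hU
  rw [ad_mul]
  rcases hall ⟨W, hW⟩ with h1 | h1
  · rw [h1, h1]
  · rw [h1, map_neg, h1, neg_neg]

lemma gate_kappa (UB UM : Finset (Matrix.unitaryGroup ξ ℂ)) (hMB : UM ⊆ UB) (hMne : UM.Nonempty)
    (hMinv : ∀ U ∈ UM, U⁻¹ ∈ UM)
    (hdense : Dense ((Subgroup.closure (↑UB : Set (Matrix.unitaryGroup ξ ℂ)) :
        Subgroup (Matrix.unitaryGroup ξ ℂ)) : Set (Matrix.unitaryGroup ξ ℂ))) :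
    ∃ r : ℝ, 0 < r ∧ r < 1 ∧ ∃ K : ℕ, ∀ k, K ≤ k →
      ‖(∑ U ∈ UB, ad t (U : Matrix ξ ξ ℂ)) ^ k - ((UB.card : ℂ) ^ k) • (invF t ξ).starProjection‖ ≤ (UB.card : ℝ) ^ k * r ^ k := by
  refine avg_pow UB (hMne.mono hMB) (fun U => ad t (U : Matrix ξ ξ ℂ)) (fun U _ w => ad_norm _ (unit_star U.2) w)
    (invF t ξ).starProjection (fun U _ v => invF_proj_ad _ U.2 v)
    (fun U _ v => (mem_invF _).1 (Submodule.starProjection_apply_mem _ _) _ U.2)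
    (fun v => Submodule.starProjection_eq_self_iff.2 (Submodule.starProjection_apply_mem _ _)) ?_
  intro c v hv h
  exact Submodule.starProjection_eq_self_iff.2 (gate_fix UB UM hMB hMne hMinv hdense v hv c h)
end gate

section transfer
variable {ξ α β : Type*} [Fintype ξ] [Fintype α] [Fintype β] [DecidableEq ξ] [DecidableEq α] [DecidableEq β]
  {t : ℕ}

lemma emb_transfer {J : Type*} [Fintype J] (e : ξ ≃ α × β) (A : J → Matrix α α ℂ) (c : ℂ) (κ : ℝ) (hκ : 0 ≤ κ)
    (h : ∀ u : HSp (Fin t → α), ‖∑ j, ad t (A j) u - c • (invF t α).starProjection u‖ ≤ κ * ‖u‖) (v : HSp (Fin t → ξ)) :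
    ‖∑ j, ad t (embE e (A j)) v - c • (InvE t e).starProjection v‖ ≤ κ * ‖v‖ := by
  refine le_of_sq_le_sq ?_ (by positivity)
  rw [mul_pow, slc_norm (Jn t e), slc_norm (Jn t e) v, Finset.mul_sum]
  refine Finset.sum_le_sum fun b _ => ?_
  rw [Finset.mul_sum]
  refine Finset.sum_le_sum fun b' _ => ?_
  have e1 : slc (Jn t e) b b' (∑ j, ad t (embE e (A j)) v - c • (InvE t e).starProjection v)
      = ∑ j, ad t (A j) (slc (Jn t e) b b' v) - c • (invF t α).starProjection (slc (Jn t e) b b' v) := by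
    rw [map_sub, map_sum, map_smul]
    congr 1
    · exact Finset.sum_congr rfl fun j _ => slt_ad e b b' (A j) v
    · congr 1; exact slt_proj e b b' v
  rw [e1, ← mul_pow]
  exact pow_le_pow_left₀ (norm_nonneg _) (h _) 2
end transfer

section words
variable {t : ℕ}

lemma card_relaxed (UB UM : Finset (Matrix.unitaryGroup (Fin 4) ℂ)) (hMB : UM ⊆ UB) (k : ℕ) :
    (Finset.univ.filter fun f : Fin k → {x // x ∈ UB} => ¬ ∃ i, (f i : Matrix.unitaryGroup (Fin 4) ℂ) ∉ UM).card = UM.card ^ k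
    ∧ Fintype.card (RelaxedWord UB UM k) + UM.card ^ k = UB.card ^ k := by
  have h1 : (Finset.univ.filter fun f : Fin k → {x // x ∈ UB} => ¬ ∃ i, (f i : Matrix.unitaryGroup (Fin 4) ℂ) ∉ UM)
      = Fintype.piFinset (fun _ : Fin k => Finset.univ.filter fun x : {x // x ∈ UB} => (x : Matrix.unitaryGroup (Fin 4) ℂ) ∈ UM) := by
    ext f; simp [Fintype.mem_piFinset]
  have h2 : (Finset.univ.filter fun x : {x // x ∈ UB} => (x : Matrix.unitaryGroup (Fin 4) ℂ) ∈ UM).card = UM.card := by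
    refine Finset.card_bij (fun x _ => x.1) ?_ ?_ ?_
    · intro x hx; simpa using hx
    · intro x _ y _ h; exact Subtype.ext h
    · intro y hy; exact ⟨⟨y, hMB hy⟩, by simpa using hy, rfl⟩
  have h3 : (Finset.univ.filter fun f : Fin k → {x // x ∈ UB} => ¬ ∃ i, (f i : Matrix.unitaryGroup (Fin 4) ℂ) ∉ UM).card = UM.card ^ k := by
    rw [h1, Fintype.card_piFinset, Finset.prod_const, h2, Finset.card_fin]
  refine ⟨h3, ?_⟩
  rw [← h3, Fintype.card_subtype]
  rw [Finset.card_filter_add_card_filter_not]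
  simp

lemma word_unitary {k : ℕ} (f : Fin k → Matrix.unitaryGroup (Fin 4) ℂ) : wordMat f ∈ Matrix.unitaryGroup (Fin 4) ℂ := by
  unfold wordMat
  refine Submonoid.list_prod_mem _ fun x hx => ?_
  rw [List.mem_ofFn] at hx
  obtain ⟨i, rfl⟩ := hx
  exact (f i).2

lemma relaxed_sum (UB UM : Finset (Matrix.unitaryGroup (Fin 4) ℂ)) (hMB : UM ⊆ UB) (k : ℕ) (q : ℝ) 
    (hq : ‖(∑ U ∈ UB, ad t (U : Matrix (Fin 4) (Fin 4) ℂ)) ^ k - ((UB.card : ℂ) ^ k) • (invF t (Fin 4)).starProjection‖ ≤ (UB.card : ℝ) ^ k * q)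
    (u : HSp (Fin t → Fin 4)) :
    ‖∑ w : RelaxedWord UB UM k, ad t (wordMat fun j => (w.1 j : Matrix.unitaryGroup (Fin 4) ℂ)) u
      - (Fintype.card (RelaxedWord UB UM k) : ℂ) • (invF t (Fin 4)).starProjection u‖
      ≤ ((UB.card : ℝ) ^ k * q + 2 * (UM.card : ℝ) ^ k) * ‖u‖ := by
  obtain ⟨c1, c2⟩ := card_relaxed UB UM hMB k
  set P : HSp (Fin t → Fin 4) →L[ℂ] HSp (Fin t → Fin 4) := (invF t (Fin 4)).starProjection with hP
  have hw : ∀ f : Fin k → {x // x ∈ UB}, ad t (wordMat fun j => (f j : Matrix.unitaryGroup (Fin 4) ℂ))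
      = (List.ofFn fun j => ad t ((f j : Matrix.unitaryGroup (Fin 4) ℂ) : Matrix (Fin 4) (Fin 4) ℂ)).prod := by
    intro f
    rw [wordMat, ad_prod, List.map_ofFn]; rfl
  have hall : ∑ f : Fin k → {x // x ∈ UB}, ad t (wordMat fun j => (f j : Matrix.unitaryGroup (Fin 4) ℂ))
      = (∑ U ∈ UB, ad t (U : Matrix (Fin 4) (Fin 4) ℂ)) ^ k := by
    rw [Finset.sum_congr rfl fun f _ => hw f,
      sum_ofFn_prod k (fun _ (x : {x // x ∈ UB}) => ad t ((x : Matrix.unitaryGroup (Fin 4) ℂ) : Matrix (Fin 4) (Fin 4) ℂ))]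
    rw [List.ofFn_const, List.prod_replicate]
    congr 1
    exact Finset.sum_coe_sort UB (fun U => ad t (U : Matrix (Fin 4) (Fin 4) ℂ))
  set F : (Fin k → {x // x ∈ UB}) → HSp (Fin t → Fin 4) := fun f => ad t (wordMat fun j => (f j : Matrix.unitaryGroup (Fin 4) ℂ)) u with hF
  have hFn : ∀ f, ‖F f‖ = ‖u‖ := fun f => ad_norm _ (unit_star (word_unitary _)) u
  have hsplit := Finset.sum_filter_add_sum_filter_not (Finset.univ : Finset (Fin k → {x // x ∈ UB}))
    (fun f => ∃ i, (f i : Matrix.unitaryGroup (Fin 4) ℂ) ∉ UM) F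
  have hrel : ∑ w : RelaxedWord UB UM k, F w.1 = ∑ f ∈ Finset.univ.filter (fun f : Fin k → {x // x ∈ UB} => ∃ i, (f i : Matrix.unitaryGroup (Fin 4) ℂ) ∉ UM), F f := by
    symm; apply Finset.sum_subtype; simp
  have htot : ∑ f, F f = ((∑ U ∈ UB, ad t (U : Matrix (Fin 4) (Fin 4) ℂ)) ^ k) u := by
    rw [← hall, ContinuousLinearMap.sum_apply]
  have hR : ‖∑ f ∈ Finset.univ.filter (fun f : Fin k → {x // x ∈ UB} => ¬ ∃ i, (f i : Matrix.unitaryGroup (Fin 4) ℂ) ∉ UM), F f‖ ≤ (UM.card : ℝ) ^ k * ‖u‖ := by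
    refine (norm_sum_le _ _).trans ?_
    rw [Finset.sum_congr rfl fun f _ => hFn f, Finset.sum_const, c1]; simp
  have hPn : ‖P u‖ ≤ ‖u‖ := Submodule.norm_starProjection_apply_le _ _
  have hmain : ‖((∑ U ∈ UB, ad t (U : Matrix (Fin 4) (Fin 4) ℂ)) ^ k) u - ((UB.card : ℂ) ^ k) • P u‖ ≤ (UB.card : ℝ) ^ k * q * ‖u‖ :=
    (ContinuousLinearMap.le_opNorm (_ - ((UB.card : ℂ) ^ k) • P) u).trans (mul_le_mul_of_nonneg_right hq (norm_nonneg _))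
  have hcard : (Fintype.card (RelaxedWord UB UM k) : ℂ) = (UB.card : ℂ) ^ k - (UM.card : ℂ) ^ k := by
    rw [eq_sub_iff_add_eq]; exact_mod_cast c2
  have e : ∑ w : RelaxedWord UB UM k, F w.1 - (Fintype.card (RelaxedWord UB UM k) : ℂ) • P u
     = (((∑ U ∈ UB, ad t (U : Matrix (Fin 4) (Fin 4) ℂ)) ^ k) u - ((UB.card : ℂ) ^ k) • P u)
      - (∑ f ∈ Finset.univ.filter (fun f : Fin k → {x // x ∈ UB} => ¬ ∃ i, (f i : Matrix.unitaryGroup (Fin 4) ℂ) ∉ UM), F f)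
      + ((UM.card : ℂ) ^ k) • P u := by
    rw [hrel, ← htot, ← hsplit, hcard, sub_smul]; abel
  show ‖∑ w : RelaxedWord UB UM k, F w.1 - (Fintype.card (RelaxedWord UB UM k) : ℂ) • P u‖ ≤ _
  rw [e]
  refine (norm_add_le _ _).trans ?_
  have h1 := norm_sub_le (((∑ U ∈ UB, ad t (U : Matrix (Fin 4) (Fin 4) ℂ)) ^ k) u - ((UB.card : ℂ) ^ k) • P u)
    (∑ f ∈ Finset.univ.filter (fun f : Fin k → {x // x ∈ UB} => ¬ ∃ i, (f i : Matrix.unitaryGroup (Fin 4) ℂ) ∉ UM), F f)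
  have h2 : ‖((UM.card : ℂ) ^ k) • P u‖ ≤ (UM.card : ℝ) ^ k * ‖u‖ := by
    rw [norm_smul, norm_pow]; simp only [RCLike.norm_natCast]
    exact mul_le_mul_of_nonneg_left hPn (by positivity)
  nlinarith
end words

section alg
variable {A : Type*} [Ring A] [Algebra ℂ A]

lemma ofFn_smul_prod (c : ℂ) (d : ℕ) (F : Fin d → A) :
    (List.ofFn fun i => c • F i).prod = c ^ d • (List.ofFn F).prod := by
  induction d with
  | zero => simp
  | succ d ih =>
    rw [List.ofFn_succ, List.ofFn_succ, List.prod_cons, List.prod_cons, ih (fun i => F i.succ), smul_mul_smul_comm, pow_succ']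

lemma avg_ofFn {X : Type*} [Fintype X] (d : ℕ) (F : Fin d → X → A) :
    ((Fintype.card (Fin d → X) : ℂ))⁻¹ • ∑ f : Fin d → X, (List.ofFn fun i => F i (f i)).prod
      = (List.ofFn fun i => ((Fintype.card X : ℂ))⁻¹ • ∑ x, F i x).prod := by
  rw [ofFn_smul_prod, sum_ofFn_prod, Fintype.card_fun, Fintype.card_fin]
  push_cast
  rw [inv_pow]

lemma pow_sub_proj {E : Type*} [NormedAddCommGroup E] [InnerProductSpace ℂ E] (T G : E →L[ℂ] E) (h1 : G * T = G) (h2 : T * G = G) (h3 : G * G = G)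
    (η : ℝ) (hη : ‖T - G‖ ≤ η) (L : ℕ) : ‖T ^ (L + 1) - G‖ ≤ η ^ (L + 1) := by
  have hp : ∀ j : ℕ, T ^ j * G = G := by
    intro j
    induction j with
    | zero => simp
    | succ j ih => rw [pow_succ, mul_assoc, h2, ih]
  have e : ∀ L : ℕ, (T - G) ^ (L + 1) = T ^ (L + 1) - G := by
    intro L
    induction L with
    | zero => simp
    | succ L ih => rw [pow_succ, ih, sub_mul, mul_sub, mul_sub, h1, h3, hp, sub_self, sub_zero, ← pow_succ]
  rw [← e]
  exact (norm_pow_le' _ (by omega)).trans (pow_le_pow_left₀ (norm_nonneg _) hη _)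

lemma ofFn_chn {E : Type*} [NormedAddCommGroup E] [InnerProductSpace ℂ E] (F : ℕ → E →L[ℂ] E) (d s : ℕ) (v : E) :
    (List.ofFn fun i : Fin d => F (s + i)).prod v = chn F d s v := by
  induction d generalizing s with
  | zero => rfl
  | succ d ih =>
    rw [List.ofFn_succ, List.prod_cons, chn, ← ih (s + 1)]
    simp only [Fin.val_zero, add_zero, Fin.val_succ]
    have : ∀ i : Fin d, s + (i.val + 1) = s + 1 + i.val := by intro i; omega
    simp only [this]
    rfl

lemma avg_norm_le {E : Type*} [NormedAddCommGroup E] [InnerProductSpace ℂ E] {X : Type*} [Fintype X] (F : X → E →L[ℂ] E) (h : ∀ x v, ‖F x v‖ = ‖v‖) (v : E) :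
    ‖(((Fintype.card X : ℂ))⁻¹ • ∑ x, F x) v‖ ≤ ‖v‖ := by
  show ‖((Fintype.card X : ℂ))⁻¹ • (∑ x, F x) v‖ ≤ ‖v‖
  rw [ContinuousLinearMap.sum_apply, norm_smul]
  have h1 : ‖∑ x, F x v‖ ≤ Fintype.card X * ‖v‖ := by
    refine (norm_sum_le _ _).trans ?_
    rw [Finset.sum_congr rfl fun x _ => h x v, Finset.sum_const]; simp
  rw [norm_inv]; simp only [RCLike.norm_natCast]
  by_cases hX : (Fintype.card X : ℝ) = 0
  · rw [hX]; simp
  · rw [inv_mul_le_iff₀ (by positivity)]; exact h1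
end alg

section brickavg
variable {n t : ℕ}

lemma InvW_univ : InvW t (Finset.univ : Finset (Fin n)) = invF t (Fin n → Fin 2) := by
  ext v
  rw [mem_InvW, mem_invF]
  refine ⟨fun h U hU => h U hU ?_, fun h U hU _ => h U hU⟩
  refine ⟨fun x y h => absurd (fun r hr => absurd (Finset.mem_univ r) hr) h, fun x y x' y' h1 h2 _ _ => ?_⟩
  rw [funext fun r => h1 r (Finset.mem_univ r), funext fun r => h2 r (Finset.mem_univ r)]

variable {X : Type*} [Fintype X]

/-- averaged gate on the bond `{j, j+1}` -/
def gch (t n : ℕ) (M : X → Matrix (Fin 4) (Fin 4) ℂ) (j : ℕ) : HSp (XX t n) →L[ℂ] HSp (XX t n) :=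
  if h : j + 1 < n then ((Fintype.card X : ℂ))⁻¹ • ∑ x, ad t (applyGate n ⟨j, by omega⟩ ⟨j + 1, h⟩ (M x)) else 1

lemma gate_unitary (q q' : Fin n) (hq : q ≠ q') (U : Matrix (Fin 4) (Fin 4) ℂ) (hU : U ∈ Matrix.unitaryGroup (Fin 4) ℂ) :
    applyGate n q q' U ∈ Matrix.unitaryGroup (Fin n → Fin 2) ℂ := by
  rw [applyGate_eq q q' hq]; exact embE_unitary _ hU

lemma gch_norm (M : X → Matrix (Fin 4) (Fin 4) ℂ) (hM : ∀ x, M x ∈ Matrix.unitaryGroup (Fin 4) ℂ) (j : ℕ) (v : HSp (XX t n)) :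
    ‖gch t n M j v‖ ≤ ‖v‖ := by
  rw [gch]; split_ifs with h
  · exact avg_norm_le _ (fun x v => ad_norm _ (unit_star (gate_unitary _ _ (by simp [Fin.ext_iff]) _ (hM x))) v) v
  · exact le_rfl

lemma gch_apply (M : X → Matrix (Fin 4) (Fin 4) ℂ) (j : ℕ) (hj : j + 1 < n) (v : HSp (XX t n)) :
    gch t n M j v = ((Fintype.card X : ℂ))⁻¹ • ∑ x, ad t (applyGate n ⟨j, by omega⟩ ⟨j + 1, hj⟩ (M x)) v := by
  rw [gch, dif_pos hj, ← ContinuousLinearMap.sum_apply]; rfl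

lemma gch_close (M : X → Matrix (Fin 4) (Fin 4) ℂ) (κ : ℝ) (hκ : 0 ≤ κ) [Nonempty X]
    (h : ∀ u : HSp (Fin t → Fin 4), ‖∑ x, ad t (M x) u - (Fintype.card X : ℂ) • (invF t (Fin 4)).starProjection u‖ ≤ Fintype.card X * κ * ‖u‖)
    (j : ℕ) (hj : j + 1 < n) (v : HSp (XX t n)) :
    ‖gch t n M j v - (Kb t n j).starProjection v‖ ≤ κ * ‖v‖ := by
  set q : Fin n := ⟨j, by omega⟩ with hq
  set q' : Fin n := ⟨j + 1, hj⟩ with hq'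
  have hne : q ≠ q' := by simp [hq, hq', Fin.ext_iff]
  have hK : Kb t n j = InvE t (eB q q' hne) := by
    have e1 : Kb t n j = InvW t (bd n j) := if_pos (by omega)
    have e2 : bd n j = {q, q'} := by
      ext r; rw [mem_bd]; simp [hq, hq', Fin.ext_iff]
    rw [e1, e2, (eB_compat q q' hne).inv_eq]
  have h1 := emb_transfer (eB q q' hne) M (Fintype.card X : ℂ) (Fintype.card X * κ) (by positivity) h v
  have hc : (Fintype.card X : ℂ) ≠ 0 := by exact_mod_cast Fintype.card_ne_zero
  have hc' : (0 : ℝ) < Fintype.card X := by exact_mod_cast Fintype.card_pos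
  have e : gch t n M j v - (InvE t (eB q q' hne)).starProjection v
      = ((Fintype.card X : ℂ))⁻¹ • (∑ x, ad t (embE (eB q q' hne) (M x)) v - (Fintype.card X : ℂ) • (InvE t (eB q q' hne)).starProjection v) := by
    rw [smul_sub, smul_smul, inv_mul_cancel₀ hc, one_smul, gch_apply M j hj v,
      Finset.sum_congr rfl fun x _ => by rw [applyGate_eq q q' hne]]
  rw [hK, e, norm_smul, norm_inv]; simp only [RCLike.norm_natCast]
  rw [inv_mul_le_iff₀ hc', ← mul_assoc]
  exact h1

/-- the averaged brick -/
def brk (t n : ℕ) (M : X → Matrix (Fin 4) (Fin 4) ℂ) : HSp (XX t n) →L[ℂ] HSp (XX t n) :=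
  ((Fintype.card ((Fin (n / 2) → X) × (Fin ((n - 1) / 2) → X)) : ℂ))⁻¹ •
    ∑ y : (Fin (n / 2) → X) × (Fin ((n - 1) / 2) → X), ad t (blockUnitary n (fun i => M (y.1 i)) (fun i => M (y.2 i)))

lemma brk_eq (M : X → Matrix (Fin 4) (Fin 4) ℂ) (v : HSp (XX t n)) :
    brk t n M v = chn (fun i => gch t n M (2 * i + 1)) ((n - 1) / 2) 0 (chn (fun i => gch t n M (2 * i)) (n / 2) 0 v) := by
  have e : brk t n M = (List.ofFn fun i : Fin ((n - 1) / 2) => gch t n M (2 * i + 1)).prod * (List.ofFn fun i : Fin (n / 2) => gch t n M (2 * i)).prod := by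
    have e1 : (fun i : Fin ((n - 1) / 2) => gch t n M (2 * i + 1)) = fun i : Fin ((n - 1) / 2) => ((Fintype.card X : ℂ))⁻¹ • ∑ x, ad t (applyGate n ⟨2 * i.val + 1, by omega⟩ ⟨2 * i.val + 2, by omega⟩ (M x)) := by
      funext i; rw [gch, dif_pos (by omega)]
    have e2 : (fun i : Fin (n / 2) => gch t n M (2 * i)) = fun i : Fin (n / 2) => ((Fintype.card X : ℂ))⁻¹ • ∑ x, ad t (applyGate n ⟨2 * i.val, by omega⟩ ⟨2 * i.val + 1, by omega⟩ (M x)) := by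
      funext i; rw [gch, dif_pos (by omega)]
    rw [e1, e2, ← avg_ofFn (A := HSp (XX t n) →L[ℂ] HSp (XX t n)) _ (fun i x => ad t (applyGate n ⟨2 * i.val + 1, by omega⟩ ⟨2 * i.val + 2, by omega⟩ (M x))),
      ← avg_ofFn (A := HSp (XX t n) →L[ℂ] HSp (XX t n)) _ (fun i x => ad t (applyGate n ⟨2 * i.val, by omega⟩ ⟨2 * i.val + 1, by omega⟩ (M x))),
      smul_mul_smul_comm, brk, Fintype.card_prod, Finset.sum_mul_sum, Finset.sum_comm, ← Fintype.sum_prod_type']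
    push_cast
    rw [mul_inv, mul_comm]
    congr 1
    refine Finset.sum_congr rfl fun y _ => ?_
    rw [blockUnitary, ad_mul', ad_prod, ad_prod, List.map_ofFn, List.map_ofFn]
    rfl
  rw [e]
  have f1 := ofFn_chn (fun i => gch t n M (2 * i + 1)) ((n - 1) / 2) 0 
  have f2 := ofFn_chn (fun i => gch t n M (2 * i)) (n / 2) 0 v
  simp only [zero_add] at f1 f2
  rw [← f2, ← f1]; rfl

lemma brk_close (M : X → Matrix (Fin 4) (Fin 4) ℂ) (hM : ∀ x, M x ∈ Matrix.unitaryGroup (Fin 4) ℂ) (κ : ℝ) (hκ : 0 ≤ κ) [Nonempty X]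
    (h : ∀ u : HSp (Fin t → Fin 4), ‖∑ x, ad t (M x) u - (Fintype.card X : ℂ) • (invF t (Fin 4)).starProjection u‖ ≤ Fintype.card X * κ * ‖u‖)
    (Δ s : ℝ) (hΔ : 0 ≤ Δ) (hs : 0 ≤ s) (hsΔ : 1 ≤ s ^ 2 * (1 + Δ / 4)) (hn : 1 ≤ n)
    (hgap : ∀ v : HSp (XX t n), v ∈ (InvW t (Finset.univ : Finset (Fin n)))ᗮ → Δ * ‖v‖ ^ 2 ≤ ∑ i ∈ Finset.range (n - 1), eb t i v ^ 2)
    (v : HSp (XX t n)) :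
    ‖brk t n M v - (InvW t (Finset.univ : Finset (Fin n))).starProjection v‖ ≤ (s + ((n : ℝ) - 1) * κ) * ‖v‖ := by
  set p := (InvW t (Finset.univ : Finset (Fin n))).starProjection v with hp
  set fO := fun i => gch t n M (2 * i + 1) with hfO
  set fE := fun i => gch t n M (2 * i) with hfE
  have hpm : p ∈ InvW t (Finset.univ : Finset (Fin n)) := Submodule.starProjection_apply_mem _ _
  have hE := chn_hybrid fE (evP t n) κ hκ (fun i v => gch_norm M hM _ v) (fun i v => proj_norm_le' _ v) (n / 2)
    (fun i hi v => gch_close M κ hκ h (2 * i) (by omega) v) (n / 2) 0 (by omega) v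
  set u := chn (evP t n) (n / 2) 0 v with hu
  have hO := chn_hybrid fO (odP t n) κ hκ (fun i v => gch_norm M hM _ v) (fun i v => proj_norm_le' _ v) ((n - 1) / 2)
    (fun i hi v => gch_close M κ hκ h (2 * i + 1) (by omega) v) ((n - 1) / 2) 0 (by omega) u
  have hO2 := chn_norm fO (fun i v => gch_norm M hM _ v) ((n - 1) / 2) 0 (chn fE (n / 2) 0 v - u)
  rw [chn_sub] at hO2
  have hψ : v - p ∈ (InvW t (Finset.univ : Finset (Fin n)))ᗮ := Submodule.sub_starProjection_mem_orthogonal v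
  have hB := (brick_gap Δ hgap (v - p) hψ).1
  have fixE : chn (evP t n) (n / 2) 0 p = p := chn_fix _ _ _ _ fun i => Submodule.starProjection_eq_self_iff.2 (Kb_ge _ hpm)
  have fixO : chn (odP t n) ((n - 1) / 2) 0 p = p := chn_fix _ _ _ _ fun i => Submodule.starProjection_eq_self_iff.2 (Kb_ge _ hpm)
  rw [chn_sub, chn_sub, fixE, fixO, ← hu] at hB
  set w := chn (odP t n) ((n - 1) / 2) 0 u with hw
  have hpv : ‖v - p‖ ≤ ‖v‖ := by
    have := hs_proj_compl_sq (InvW t (Finset.univ : Finset (Fin n))) v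
    refine le_of_sq_le_sq ?_ (norm_nonneg _)
    rw [hp]
    nlinarith [sq_nonneg ‖(InvW t (Finset.univ : Finset (Fin n))).starProjection v‖]
  have hwp : ‖w - p‖ ≤ s * ‖v‖ := by
    refine le_of_sq_le_sq ?_ (by positivity)
    have h1 : ‖v - p‖ ^ 2 ≤ ‖v‖ ^ 2 := pow_le_pow_left₀ (norm_nonneg _) hpv 2
    have h2 : ‖w - p‖ ^ 2 ≤ s ^ 2 * (1 + Δ / 4) * ‖w - p‖ ^ 2 := by nlinarith [sq_nonneg ‖w - p‖]
    have h3 : s ^ 2 * ((1 + Δ / 4) * ‖w - p‖ ^ 2) ≤ s ^ 2 * ‖v‖ ^ 2 := mul_le_mul_of_nonneg_left (hB.trans h1) (by positivity)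
    rw [mul_pow]; linarith
  rw [brk_eq]
  have e : chn fO ((n - 1) / 2) 0 (chn fE (n / 2) 0 v) - p
    = (chn fO ((n - 1) / 2) 0 (chn fE (n / 2) 0 v) - chn fO ((n - 1) / 2) 0 u) + (chn fO ((n - 1) / 2) 0 u - w) + (w - p) := by abel
  rw [e]
  refine (norm_add₃_le).trans ?_
  have hnn : ((n / 2 : ℕ) : ℝ) + (((n - 1) / 2 : ℕ) : ℝ) = (n : ℝ) - 1 := by
    rw [eq_sub_iff_add_eq]; exact_mod_cast (by omega : n / 2 + (n - 1) / 2 + 1 = n)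
  have h5 := hO2.trans hE.2
  have h6 : ‖chn fO ((n - 1) / 2) 0 u - w‖ ≤ (((n - 1) / 2 : ℕ) : ℝ) * κ * ‖v‖ :=
    hO.2.trans (mul_le_mul_of_nonneg_left hE.1 (by positivity))
  rw [← hnn]
  nlinarith
end brickavg

section haar
variable {ξ : Type*} [Fintype ξ] [DecidableEq ξ] {t : ℕ}

lemma ad_integrable (μH : Measure (Matrix.unitaryGroup ξ ℂ)) [IsProbabilityMeasure μH]
    (v : HSp (Fin t → ξ)) : Integrable (fun U : Matrix.unitaryGroup ξ ℂ => ad t (U : Matrix ξ ξ ℂ) v) μH := by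
  refine Integrable.of_bound (ad_continuous v).aestronglyMeasurable ‖v‖ (Filter.Eventually.of_forall fun U => ?_)
  rw [ad_norm _ (unit_star U.2)]

lemma haar_proj (μH : Measure (Matrix.unitaryGroup ξ ℂ)) (hμ : μH.IsHaarMeasure) [IsProbabilityMeasure μH]
    (v : HSp (Fin t → ξ)) :
    ∫ U, ad t (U : Matrix ξ ξ ℂ) v ∂μH = (invF t ξ).starProjection v := by
  have hInt := ad_integrable (t := t) μH v
  refine (Submodule.eq_starProjection_of_mem_of_inner_eq_zero ?_ ?_).symm
  · rw [mem_invF]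
    intro V hV
    rw [← ContinuousLinearMap.integral_comp_comm _ hInt]
    have h := integral_mul_left_eq_self (μ := μH) (fun U : Matrix.unitaryGroup ξ ℂ => ad t (U : Matrix ξ ξ ℂ) v) ⟨V, hV⟩
    rw [← h]
    refine integral_congr_ae (Filter.Eventually.of_forall fun U => ?_)
    show ad t V (ad t (U : Matrix ξ ξ ℂ) v) = ad t (V * (U : Matrix ξ ξ ℂ)) v
    rw [ad_mul]
  · intro w hw
    rw [inner_sub_left, sub_eq_zero, ← inner_conj_symm _ w, ← inner_conj_symm (∫ U, ad t (U : Matrix ξ ξ ℂ) v ∂μH) w]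
    congr 1
    rw [← integral_inner hInt]
    have : ∀ U : Matrix.unitaryGroup ξ ℂ, inner ℂ w (ad t (U : Matrix ξ ξ ℂ) v) = inner ℂ w v := by
      intro U
      have h1 := ad_inner (t := t) ((U : Matrix ξ ξ ℂ)ᴴ) w v
      rw [Matrix.conjTranspose_conjTranspose] at h1
      rw [← h1, ← Matrix.star_eq_conjTranspose, (mem_invF w).1 hw _ (Unitary.star_mem U.2)]
    simp [this]

lemma haar_toV (μH : Measure (Matrix.unitaryGroup ξ ℂ)) (hμ : μH.IsHaarMeasure) [IsProbabilityMeasure μH]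
    (ρ : Matrix (Fin t → ξ) (Fin t → ξ) ℂ) :
    toV (haarChannel t μH ρ) = (invF t ξ).starProjection (toV ρ) := by
  rw [← haar_proj μH hμ]
  ext p
  have h := ContinuousLinearMap.integral_comp_comm (EuclideanSpace.proj (𝕜 := ℂ) p) (ad_integrable (t := t) μH (toV ρ))
  refine Eq.trans ?_ h
  rfl

lemma haar_herm (μH : Measure (Matrix.unitaryGroup ξ ℂ)) 
    (ρ : Matrix (Fin t → ξ) (Fin t → ξ) ℂ) (hρ : ρ.IsHermitian) : (haarChannel t μH ρ).IsHermitian := by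
  ext x y
  rw [Matrix.conjTranspose_apply]
  show (starRingEnd ℂ) (∫ U, (tpowMat t ((U : Matrix ξ ξ ℂ)) * ρ * (tpowMat t ((U : Matrix ξ ξ ℂ)))ᴴ) y x ∂μH) =
    ∫ U, (tpowMat t ((U : Matrix ξ ξ ℂ)) * ρ * (tpowMat t ((U : Matrix ξ ξ ℂ)))ᴴ) x y ∂μH
  rw [← integral_conj]
  refine integral_congr_ae (Filter.Eventually.of_forall fun U => ?_)
  have : (tpowMat t (U : Matrix ξ ξ ℂ) * ρ * (tpowMat t (U : Matrix ξ ξ ℂ))ᴴ).IsHermitian :=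
    Matrix.isHermitian_mul_mul_conjTranspose _ hρ
  exact this.apply x y

end haar

section qform
variable {I : Type*} [Fintype I] [DecidableEq I]

/-- matrix unit as a vector -/
def eU (b d : I) : HSp I := toV (Matrix.single b d 1)

/-- the quadratic form attached to a superoperator -/
def qf (A : HSp I →L[ℂ] HSp I) (Y : Matrix I I ℂ) : ℂ :=
  ∑ a, ∑ b, ∑ c, ∑ d, star (Y a b) * Y c d * (A (eU b d)) (a, c)

lemma qf_add (A B : HSp I →L[ℂ] HSp I) (Y : Matrix I I ℂ) : qf (A + B) Y = qf A Y + qf B Y := by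
  simp only [qf, ContinuousLinearMap.add_apply, PiLp.add_apply, mul_add, Finset.sum_add_distrib]

lemma qf_smul (r : ℂ) (A : HSp I →L[ℂ] HSp I) (Y : Matrix I I ℂ) : qf (r • A) Y = r * qf A Y := by
  simp only [qf, ContinuousLinearMap.smul_apply, PiLp.smul_apply, Finset.mul_sum, smul_eq_mul]
  refine Finset.sum_congr rfl fun a _ => Finset.sum_congr rfl fun b _ => Finset.sum_congr rfl fun c _ =>
    Finset.sum_congr rfl fun d _ => by ring

lemma qf_sub (A B : HSp I →L[ℂ] HSp I) (Y : Matrix I I ℂ) : qf (A - B) Y = qf A Y - qf B Y := by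
  have h := qf_add (A - B) B Y
  rw [sub_add_cancel] at h
  rw [h]; ring

lemma qf_sum {J : Type*} (s : Finset J) (A : J → HSp I →L[ℂ] HSp I) (Y : Matrix I I ℂ) :
    qf (∑ j ∈ s, A j) Y = ∑ j ∈ s, qf (A j) Y := by
  induction s using Finset.induction_on with
  | empty => simp [qf]
  | insert a s ha ih => rw [Finset.sum_insert ha, Finset.sum_insert ha, qf_add, ih]

lemma eU_apply (b d x y : I) : (eU b d : HSp I) (x, y) = if b = x ∧ d = y then 1 else 0 := by
  rw [eU, toV_apply, Matrix.single_apply]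

lemma eU_norm (b d : I) : ‖(eU b d : HSp I)‖ = 1 := by
  have h : ‖(eU b d : HSp I)‖ ^ 2 = 1 := by
    rw [hsp_norm_sq, Finset.sum_eq_single b, Finset.sum_eq_single d]
    · simp [eU_apply]
    · intro y _ hy; simp [eU_apply, Ne.symm hy]
    · simp
    · intro x _ hx; simp [eU_apply, Ne.symm hx]
    · simp
  nlinarith [norm_nonneg (eU b d : HSp I)]

lemma sum_norm_le (Y : Matrix I I ℂ) :
    (∑ a, ∑ b, ‖Y a b‖) ^ 2 ≤ (Fintype.card I : ℝ) ^ 2 * ‖toV Y‖ ^ 2 := by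
  rw [hsp_norm_sq, ← Fintype.sum_prod_type', ← Fintype.sum_prod_type' (f := fun x y => ‖toV Y (x, y)‖ ^ 2)]
  have := sq_sum_le_card_mul_sum_sq (s := (Finset.univ : Finset (I × I))) (f := fun p => ‖Y p.1 p.2‖)
  refine this.trans (le_of_eq ?_)
  rw [Finset.card_univ, Fintype.card_prod]
  push_cast
  rw [sq]; rfl

lemma qf_norm (A : HSp I →L[ℂ] HSp I) (Y : Matrix I I ℂ) (δ : ℝ) (hA : ‖A‖ ≤ δ) :
    ‖qf A Y‖ ≤ δ * (Fintype.card I : ℝ) ^ 2 * ‖toV Y‖ ^ 2 := by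
  have hδ : 0 ≤ δ := (norm_nonneg _).trans hA
  have h1 : ‖qf A Y‖ ≤ ∑ a, ∑ b, ∑ c, ∑ d, ‖Y a b‖ * ‖Y c d‖ * δ := by
    refine norm_sum_le_of_le _ fun a _ => norm_sum_le_of_le _ fun b _ => norm_sum_le_of_le _ fun c _ =>
      norm_sum_le_of_le _ fun d _ => ?_
    rw [norm_mul, norm_mul, norm_star]
    refine mul_le_mul_of_nonneg_left ?_ (by positivity)
    refine (PiLp.norm_apply_le _ _).trans ((A.le_opNorm _).trans ?_)
    rw [eU_norm, mul_one]; exact hA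
  have h2 : ∑ a, ∑ b, ∑ c, ∑ d, ‖Y a b‖ * ‖Y c d‖ * δ = δ * (∑ a, ∑ b, ‖Y a b‖) ^ 2 := by
    simp only [sq, Finset.sum_mul, Finset.mul_sum]
    refine Finset.sum_congr rfl fun a _ => ?_
    refine Finset.sum_congr rfl fun b _ => ?_
    refine Finset.sum_congr rfl fun c _ => Finset.sum_congr rfl fun d _ => by ring
  rw [h2] at h1
  refine h1.trans ?_
  rw [mul_assoc]
  exact mul_le_mul_of_nonneg_left (sum_norm_le Y) hδ

lemma lrM_eU (A B : Matrix I I ℂ) (a b c d : I) : lrM A B (eU b d) (a, c) = A a b * B d c := by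
  rw [lrM_apply, toV_apply, eU, toM_toV, Matrix.mul_apply]
  rw [Finset.sum_eq_single d]
  · rw [Matrix.mul_apply, Finset.sum_eq_single b]
    · simp
    · intro x _ hx; simp [Matrix.single_apply, Ne.symm hx]
    · simp
  · intro x _ hx
    rw [Matrix.mul_apply, Finset.sum_eq_zero, zero_mul]
    intro y _; simp [Matrix.single_apply, Ne.symm hx]
  · simp

lemma inner_eq_sum (Y W : Matrix I I ℂ) : inner ℂ (toV Y) (toV W) = ∑ a, ∑ b, star (Y a b) * W a b := by
  rw [EuclideanSpace.inner_eq_star_dotProduct]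
  simp only [dotProduct, Fintype.sum_prod_type, Pi.star_apply]
  refine Finset.sum_congr rfl fun i _ => Finset.sum_congr rfl fun j _ => mul_comm _ _

lemma qf_lr (W : Matrix I I ℂ) (Y : Matrix I I ℂ) :
    qf (lrM W Wᴴ) Y = ((‖inner ℂ (toV Y) (toV W)‖ ^ 2 : ℝ) : ℂ) := by
  have h : ((‖inner ℂ (toV Y) (toV W)‖ ^ 2 : ℝ) : ℂ) = inner ℂ (toV Y) (toV W) * star (inner ℂ (toV Y) (toV W)) := by
    have := RCLike.mul_conj (inner ℂ (toV Y) (toV W))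
    rw [← starRingEnd_apply, this]
    simp
  rw [h, inner_eq_sum, star_sum, qf, Finset.sum_mul]
  refine Finset.sum_congr rfl fun a _ => ?_
  rw [Finset.sum_mul]
  refine Finset.sum_congr rfl fun b _ => ?_
  rw [Finset.mul_sum]
  refine Finset.sum_congr rfl fun c _ => ?_
  rw [star_sum, Finset.mul_sum]
  refine Finset.sum_congr rfl fun d _ => ?_
  rw [lrM_eU, Matrix.conjTranspose_apply, star_mul', star_star]
  ring

lemma eU_decomp (v : HSp I) : v = ∑ b, ∑ d, v (b, d) • eU b d := by
  ext ⟨x, y⟩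
  simp only [WithLp.ofLp_sum, Finset.sum_apply, PiLp.smul_apply, eU_apply, smul_eq_mul]
  rw [Finset.sum_eq_single x, Finset.sum_eq_single y]
  · simp
  · intro d _ hd; simp [hd]
  · simp
  · intro b _ hb; simp [hb]
  · simp

lemma qf_rank_one (A : HSp I →L[ℂ] HSp I) (x y : I → ℂ) :
    star y ⬝ᵥ (toM (A (toV (vecMulVec x (star x)))) *ᵥ y) = qf A (vecMulVec y (star x)) := by
  have h : ∀ a c, toM (A (toV (vecMulVec x (star x)))) a c = ∑ b, ∑ d, x b * star (x d) * A (eU b d) (a, c) := by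
    intro a c
    rw [eU_decomp (toV (vecMulVec x (star x)))]
    simp only [map_sum, map_smul, toM_apply, WithLp.ofLp_sum, Finset.sum_apply, PiLp.smul_apply, smul_eq_mul]
    refine Finset.sum_congr rfl fun b _ => Finset.sum_congr rfl fun d _ => ?_
    rfl
  simp only [dotProduct, Matrix.mulVec, h, qf, Finset.mul_sum, Finset.sum_mul, Matrix.vecMulVec_apply, Pi.star_apply,
    star_mul', star_star]
  refine Finset.sum_congr rfl fun a _ => ?_
  rw [Finset.sum_comm]
  refine Finset.sum_congr rfl fun b _ => Finset.sum_congr rfl fun c _ => Finset.sum_congr rfl fun d _ => by ring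

end qform

section qG
variable {ξ : Type*} [Fintype ξ] [DecidableEq ξ] {t : ℕ}

lemma qf_ad (V : Matrix ξ ξ ℂ) (Y : Matrix (Fin t → ξ) (Fin t → ξ) ℂ) :
    qf (ad t V) Y = ((‖inner ℂ (toV Y) (toV (tpowMat t V))‖ ^ 2 : ℝ) : ℂ) := qf_lr _ _

lemma qf_G_int (μH : Measure (Matrix.unitaryGroup ξ ℂ)) (hμ : μH.IsHaarMeasure) [IsProbabilityMeasure μH]
    (Y : Matrix (Fin t → ξ) (Fin t → ξ) ℂ) :
    qf ((invF t ξ).starProjection) Y = ∫ U, qf (ad t (U : Matrix ξ ξ ℂ)) Y ∂μH := by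
  have hi : ∀ (b d a c : Fin t → ξ), Integrable (fun U : Matrix.unitaryGroup ξ ℂ =>
      star (Y a b) * Y c d * (ad t (U : Matrix ξ ξ ℂ) (eU b d)) (a, c)) μH := fun b d a c =>
    (ContinuousLinearMap.integrable_comp (EuclideanSpace.proj (𝕜 := ℂ) (a, c)) (ad_integrable μH (eU b d))).const_mul _
  simp only [qf]
  rw [integral_finset_sum _ fun a _ => integrable_finset_sum _ fun b _ => integrable_finset_sum _ fun c _ =>
    integrable_finset_sum _ fun d _ => hi b d a c]
  refine Finset.sum_congr rfl fun a _ => ?_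
  rw [integral_finset_sum _ fun b _ => integrable_finset_sum _ fun c _ =>
    integrable_finset_sum _ fun d _ => hi b d a c]
  refine Finset.sum_congr rfl fun b _ => ?_
  rw [integral_finset_sum _ fun c _ => integrable_finset_sum _ fun d _ => hi b d a c]
  refine Finset.sum_congr rfl fun c _ => ?_
  rw [integral_finset_sum _ fun d _ => hi b d a c]
  refine Finset.sum_congr rfl fun d _ => ?_
  rw [integral_const_mul]
  congr 1
  rw [← haar_proj μH hμ]
  exact (ContinuousLinearMap.integral_comp_comm (EuclideanSpace.proj (𝕜 := ℂ) (a, c)) (ad_integrable (t := t) μH (eU b d))).symm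

lemma invF_star (v : HSp (Fin t → ξ)) (hv : v ∈ invF t ξ) : toV (toM v)ᴴ ∈ invF t ξ := by
  rw [mem_invF] at hv ⊢
  intro U hU
  have h := hv U hU
  rw [ad, lrM_apply] at h ⊢
  have h' := congrArg toM h
  rw [toM_toV] at h'
  rw [toM_toV]
  nth_rewrite 2 [← h']
  simp only [Matrix.conjTranspose_mul, Matrix.conjTranspose_conjTranspose, Matrix.mul_assoc]

lemma invF_one : toV (1 : Matrix (Fin t → ξ) (Fin t → ξ) ℂ) ∈ invF t ξ := by
  rw [mem_invF]
  intro U hU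
  have h := unit_star (Unitary.star_mem hU)
  rw [Matrix.star_eq_conjTranspose, Matrix.conjTranspose_conjTranspose] at h
  rw [ad, lrM_apply, toM_toV, mul_one, tpow_star, ← tpow_mul, h, tpow_one]

lemma invF_comm (v : HSp (Fin t → ξ)) (hv : v ∈ invF t ξ) (U : Matrix ξ ξ ℂ) (hU : U ∈ Matrix.unitaryGroup ξ ℂ) :
    tpowMat t U * toM v = toM v * tpowMat t U := by
  have h := congrArg toM ((mem_invF v).1 hv U hU)
  rw [ad, lrM_apply, toM_toV] at h
  nth_rewrite 2 [← h]
  rw [mul_assoc, tpow_star, ← tpow_mul, unit_star hU, tpow_one, mul_one]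

/-- span of tensor powers -/
def tspan (t : ℕ) (ξ : Type*) [Fintype ξ] [DecidableEq ξ] : Submodule ℂ (HSp (Fin t → ξ)) :=
  Submodule.span ℂ (Set.range fun U : Matrix.unitaryGroup ξ ℂ => toV (tpowMat t (U : Matrix ξ ξ ℂ)))

lemma tspan_comm (v : HSp (Fin t → ξ)) (hv : v ∈ invF t ξ) (s : HSp (Fin t → ξ)) (hs : s ∈ tspan t ξ) :
    toM s * toM v = toM v * toM s := by
  induction hs using Submodule.span_induction with
  | mem x hx => obtain ⟨U, rfl⟩ := hx; exact invF_comm v hv U U.2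
  | zero => 
    have : toM (0 : HSp (Fin t → ξ)) = 0 := rfl
    rw [this, zero_mul, mul_zero]
  | add x y _ _ hx hy => rw [toM_add, add_mul, mul_add, hx, hy]
  | smul a x _ hx => rw [toM_smul, Matrix.smul_mul, Matrix.mul_smul, hx]

lemma toM_sum {I : Type*} [Fintype I] {J : Type*} (s : Finset J) (f : J → HSp I) : toM (∑ j ∈ s, f j) = ∑ j ∈ s, toM (f j) := by
  induction s using Finset.induction_on with
  | empty => rfl
  | insert a s ha ih => rw [Finset.sum_insert ha, Finset.sum_insert ha, toM_add, ih]

lemma norm_one_sq {I : Type*} [Fintype I] [DecidableEq I] : ‖toV (1 : Matrix I I ℂ)‖ ^ 2 = Fintype.card I := by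
  rw [hsp_norm_sq]
  have : ∀ x : I, ∑ y, ‖toV (1 : Matrix I I ℂ) (x, y)‖ ^ 2 = 1 := by
    intro x
    rw [Finset.sum_eq_single x]
    · simp
    · intro y _ hy; simp [Matrix.one_apply, Ne.symm hy]
    · simp
  rw [Finset.sum_congr rfl fun x _ => this x]; simp

lemma norm_toV_sq_trace {I : Type*} [Fintype I] [DecidableEq I] (M : Matrix I I ℂ) :
    (Mᴴ * M).trace = ((‖toV M‖ ^ 2 : ℝ) : ℂ) := by
  have := hsp_inner (toV M) (toV M)
  rw [toM_toV] at this
  rw [← this, inner_self_eq_norm_sq_to_K]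
  push_cast; rfl

lemma qf_rank {I : Type*} [Fintype I] [DecidableEq I] (B Y : Matrix I I ℂ) :
    ∑ a, ∑ b, ∑ c, ∑ d, star (Y a b) * Y c d * (star (B b d) * B a c) = (Yᴴ * B * Y * Bᴴ).trace := by
  simp only [Matrix.trace, Matrix.diag_apply, Matrix.mul_apply, Matrix.conjTranspose_apply, Finset.sum_mul]
  rw [Finset.sum_comm]
  refine Finset.sum_congr rfl fun b _ => ?_
  have h1 : ∀ a, ∑ c, ∑ d, star (Y a b) * Y c d * (star (B b d) * B a c) =
      ∑ d, ∑ c, star (Y a b) * B a c * Y c d * star (B b d) := by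
    intro a
    rw [Finset.sum_comm]
    refine Finset.sum_congr rfl fun d _ => Finset.sum_congr rfl fun c _ => by ring
  simp only [h1]
  rw [Finset.sum_comm]
  refine Finset.sum_congr rfl fun d _ => ?_
  rw [Finset.sum_comm]

lemma qf_G_lower (s : HSp (Fin t → ξ)) (hs : s ∈ tspan t ξ) :
    ∃ g : ℝ, qf ((invF t ξ).starProjection) (toM s) = (g : ℂ) ∧
      ‖s‖ ^ 2 ≤ (Fintype.card (Fin t → ξ) : ℝ) * g := by
  let b := stdOrthonormalBasis ℂ (invF t ξ)
  have hG : ∀ v : HSp (Fin t → ξ), (invF t ξ).starProjection v =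
      ∑ β, inner ℂ (b β : HSp (Fin t → ξ)) v • (b β : HSp (Fin t → ξ)) := fun v => by
    rw [b.starProjection_eq_sum_rankOne, ContinuousLinearMap.sum_apply]
    rfl
  have hcomm : ∀ β, toM s * (toM (b β : HSp (Fin t → ξ)))ᴴ = (toM (b β : HSp (Fin t → ξ)))ᴴ * toM s := by
    intro β
    exact tspan_comm _ (invF_star _ (b β).2) s hs
  refine ⟨∑ β, ‖toV ((toM (b β : HSp (Fin t → ξ)))ᴴ * toM s)‖ ^ 2, ?_, ?_⟩
  · have h0 : (invF t ξ).starProjection = ∑ β, ((innerSL ℂ (b β : HSp (Fin t → ξ))).smulRight (b β : HSp (Fin t → ξ))) := by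
      ext1 v
      rw [hG, ContinuousLinearMap.sum_apply]
      rfl
    rw [h0, qf_sum]
    push_cast
    refine Finset.sum_congr rfl fun β _ => ?_
    set B := toM (b β : HSp (Fin t → ξ)) with hB
    have hBv : (b β : HSp (Fin t → ξ)) = toV B := rfl
    have h1 : qf ((innerSL ℂ (b β : HSp (Fin t → ξ))).smulRight (b β : HSp (Fin t → ξ))) (toM s) =
        ((toM s)ᴴ * B * toM s * Bᴴ).trace := by
      rw [← qf_rank, qf]
      refine Finset.sum_congr rfl fun a _ => Finset.sum_congr rfl fun x _ => Finset.sum_congr rfl fun c _ =>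
        Finset.sum_congr rfl fun d _ => ?_
      have h2 : inner ℂ (b β : HSp (Fin t → ξ)) (eU x d) = star (B x d) := by
        rw [hBv, eU, inner_eq_sum, Finset.sum_eq_single x, Finset.sum_eq_single d]
        · simp
        · intro y _ hy; simp [Matrix.single_apply, Ne.symm hy]
        · simp
        · intro y _ hy; simp [Matrix.single_apply, Ne.symm hy]
        · simp
      rw [ContinuousLinearMap.smulRight_apply, innerSL_apply_apply, h2]
      rfl
    rw [h1, mul_assoc, hcomm β]
    have h3 := norm_toV_sq_trace (Bᴴ * toM s)
    rw [Matrix.conjTranspose_mul, Matrix.conjTranspose_conjTranspose] at h3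
    push_cast at h3
    rw [h3]
  · have h1 : toV (1 : Matrix (Fin t → ξ) (Fin t → ξ) ℂ) =
        ∑ β, inner ℂ (b β : HSp (Fin t → ξ)) (toV 1) • (b β : HSp (Fin t → ξ)) := by
      rw [← hG]; exact ((invF t ξ).starProjection_eq_self_iff.2 invF_one).symm
    set c := fun β => inner ℂ (b β : HSp (Fin t → ξ)) (toV 1) with hc
    have h2 : (1 : Matrix (Fin t → ξ) (Fin t → ξ) ℂ) = ∑ β, star (c β) • (toM (b β : HSp (Fin t → ξ)))ᴴ := by
      have := congrArg (fun v => (toM v)ᴴ) h1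
      simp only [toM_toV, Matrix.conjTranspose_one, toM_sum, toM_smul, Matrix.conjTranspose_sum, Matrix.conjTranspose_smul] at this
      exact this
    have h3 : s = ∑ β, star (c β) • toV ((toM (b β : HSp (Fin t → ξ)))ᴴ * toM s) := by
      have : toM s = ∑ β, star (c β) • ((toM (b β : HSp (Fin t → ξ)))ᴴ * toM s) := by
        nth_rewrite 1 [← one_mul (toM s), h2]
        rw [Finset.sum_mul]
        refine Finset.sum_congr rfl fun β _ => by rw [Matrix.smul_mul]
      have h4 := congrArg toV this
      rw [toV_sum, toV_toM] at h4
      exact h4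
    have h5 : ∑ β, ‖c β‖ ^ 2 ≤ (Fintype.card (Fin t → ξ) : ℝ) := by
      rw [← norm_one_sq]
      have ho : Orthonormal ℂ (fun β => (b β : HSp (Fin t → ξ))) := b.orthonormal.comp_linearIsometry (invF t ξ).subtypeₗᵢ
      exact ho.sum_inner_products_le (s := Finset.univ) (toV 1)
    have h6 : ‖s‖ ≤ ∑ β, ‖c β‖ * ‖toV ((toM (b β : HSp (Fin t → ξ)))ᴴ * toM s)‖ := by
      nth_rewrite 1 [h3]
      refine norm_sum_le_of_le _ fun β _ => ?_
      rw [norm_smul, norm_star]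
    calc ‖s‖ ^ 2 ≤ (∑ β, ‖c β‖ * ‖toV ((toM (b β : HSp (Fin t → ξ)))ᴴ * toM s)‖) ^ 2 :=
          pow_le_pow_left₀ (norm_nonneg _) h6 2
      _ ≤ (∑ β, ‖c β‖ ^ 2) * ∑ β, ‖toV ((toM (b β : HSp (Fin t → ξ)))ᴴ * toM s)‖ ^ 2 :=
          Finset.sum_mul_sq_le_sq_mul_sq _ _ _
      _ ≤ _ := mul_le_mul_of_nonneg_right h5 (Finset.sum_nonneg fun _ _ => sq_nonneg _)

end qG

section design
variable {ξ : Type*} [Fintype ξ] [DecidableEq ξ] {t : ℕ}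

lemma tspan_inner (Y : HSp (Fin t → ξ)) (U : Matrix ξ ξ ℂ) (hU : U ∈ Matrix.unitaryGroup ξ ℂ) :
    inner ℂ Y (toV (tpowMat t U)) = inner ℂ ((tspan t ξ).starProjection Y) (toV (tpowMat t U)) := by
  have hm : toV (tpowMat t U) ∈ tspan t ξ := Submodule.subset_span ⟨⟨U, hU⟩, rfl⟩
  have h := (Submodule.mem_orthogonal' _ _).1 ((tspan t ξ).sub_starProjection_mem_orthogonal Y) _ hm
  rw [inner_sub_left, sub_eq_zero] at h
  exact h

lemma qf_key {ι : Type*} [Fintype ι] (μH : Measure (Matrix.unitaryGroup ξ ℂ)) (hμ : μH.IsHaarMeasure)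
    [IsProbabilityMeasure μH] (p : ι → ℝ) (V : ι → Matrix ξ ξ ℂ) (hV : ∀ i, V i ∈ Matrix.unitaryGroup ξ ℂ)
    (δ ε : ℝ) (hδ : ‖(∑ i, (p i : ℂ) • ad t (V i)) - (invF t ξ).starProjection‖ ≤ δ)
    (hε : δ * (Fintype.card (Fin t → ξ) : ℝ) ^ 3 ≤ ε) (Y : Matrix (Fin t → ξ) (Fin t → ξ) ℂ) :
    ∃ φ g : ℝ, qf (∑ i, (p i : ℂ) • ad t (V i)) Y = (φ : ℂ) ∧ qf ((invF t ξ).starProjection) Y = (g : ℂ) ∧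
      |φ - g| ≤ ε * g := by
  have hδ0 : 0 ≤ δ := (norm_nonneg _).trans hδ
  set s := (tspan t ξ).starProjection (toV Y) with hs
  have hsm : s ∈ tspan t ξ := Submodule.starProjection_apply_mem _ _
  obtain ⟨g, hg, hlow⟩ := qf_G_lower s hsm
  have had : ∀ U ∈ Matrix.unitaryGroup ξ ℂ, qf (ad t U) Y = qf (ad t U) (toM s) := by
    intro U hU
    rw [qf_ad, qf_ad, toV_toM, tspan_inner _ U hU]
  have hGY : qf ((invF t ξ).starProjection) Y = qf ((invF t ξ).starProjection) (toM s) := by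
    rw [qf_G_int μH hμ, qf_G_int μH hμ]
    exact integral_congr_ae (Filter.Eventually.of_forall fun U => had U U.2)
  have hΦY : qf (∑ i, (p i : ℂ) • ad t (V i)) Y = qf (∑ i, (p i : ℂ) • ad t (V i)) (toM s) := by
    rw [qf_sum, qf_sum]
    refine Finset.sum_congr rfl fun i _ => ?_
    rw [qf_smul, qf_smul, had _ (hV i)]
  have hΦ : qf (∑ i, (p i : ℂ) • ad t (V i)) (toM s) =
      ((∑ i, p i * ‖inner ℂ (toV (toM s)) (toV (tpowMat t (V i)))‖ ^ 2 : ℝ) : ℂ) := by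
    rw [qf_sum]
    push_cast
    refine Finset.sum_congr rfl fun i _ => ?_
    rw [qf_smul, qf_ad]
    push_cast; rfl
  refine ⟨_, g, hΦY.trans hΦ, hGY.trans hg, ?_⟩
  have hn := qf_norm _ (toM s) δ hδ
  rw [qf_sub, hΦ, hg, ← Complex.ofReal_sub, Complex.norm_real, toV_toM] at hn
  refine (hn : |_| ≤ _).trans ?_
  rcases Nat.eq_zero_or_pos (Fintype.card (Fin t → ξ)) with h0 | h0
  · have : IsEmpty (Fin t → ξ) := Fintype.card_eq_zero_iff.1 h0
    have hg0 : (g : ℂ) = 0 := by rw [← hg, qf]; simp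
    have hg0' : g = 0 := by exact_mod_cast hg0
    rw [h0, hg0']; simp
  have hD : (0 : ℝ) < (Fintype.card (Fin t → ξ) : ℝ) := by exact_mod_cast h0
  have hg0 : 0 ≤ g := by
    by_contra hneg
    push Not at hneg
    nlinarith [sq_nonneg ‖s‖]
  calc δ * (Fintype.card (Fin t → ξ) : ℝ) ^ 2 * ‖s‖ ^ 2
      ≤ δ * (Fintype.card (Fin t → ξ) : ℝ) ^ 2 * ((Fintype.card (Fin t → ξ) : ℝ) * g) :=
        mul_le_mul_of_nonneg_left hlow (by positivity)
    _ = δ * (Fintype.card (Fin t → ξ) : ℝ) ^ 3 * g := by ring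
    _ ≤ ε * g := mul_le_mul_of_nonneg_right hε hg0

lemma quad_sum {I : Type*} [Fintype I] [DecidableEq I] (A : HSp I →L[ℂ] HSp I) {m : ℕ} (x : Fin m → I → ℂ) (y : I → ℂ) :
    star y ⬝ᵥ (toM (A (toV (∑ k, vecMulVec (x k) (star (x k))))) *ᵥ y) =
      ∑ k, qf A (vecMulVec y (star (x k))) := by
  rw [toV_sum, map_sum, toM_sum, Matrix.sum_mulVec, dotProduct_sum]
  exact Finset.sum_congr rfl fun k _ => qf_rank_one A (x k) y

theorem design_of_norm {ι : Type*} [Fintype ι] (μH : Measure (Matrix.unitaryGroup ξ ℂ)) (hμ : μH.IsHaarMeasure)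
    (hP : IsProbabilityMeasure μH) (p : ι → ℝ) (V : ι → Matrix ξ ξ ℂ) (hV : ∀ i, V i ∈ Matrix.unitaryGroup ξ ℂ)
    (δ ε : ℝ) (hδ : ‖(∑ i, (p i : ℂ) • ad t (V i)) - (invF t ξ).starProjection‖ ≤ δ)
    (hε : δ * (Fintype.card (Fin t → ξ) : ℝ) ^ 3 ≤ ε) : IsApproxDesign t ε μH p V := by
  intro ρ hρ
  have hΦeq : toM ((∑ i, (p i : ℂ) • ad t (V i)) (toV ρ)) =
      ∑ i, (p i : ℂ) • (tpowMat t (V i) * ρ * (tpowMat t (V i))ᴴ) := by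
    rw [ContinuousLinearMap.sum_apply, toM_sum]
    refine Finset.sum_congr rfl fun i _ => ?_
    rw [ContinuousLinearMap.smul_apply, toM_smul]
    rfl
  have hGeq : toM ((invF t ξ).starProjection (toV ρ)) = haarChannel t μH ρ := by
    rw [← haar_toV μH hμ, toM_toV]
  have hΦh : (∑ i, (p i : ℂ) • (tpowMat t (V i) * ρ * (tpowMat t (V i))ᴴ)).IsHermitian := by
    rw [Matrix.IsHermitian, Matrix.conjTranspose_sum]
    refine Finset.sum_congr rfl fun i _ => ?_
    rw [Matrix.conjTranspose_smul, (Matrix.isHermitian_mul_mul_conjTranspose (tpowMat t (V i)) hρ.1).eq]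
    simp
  have hGh := haar_herm (t := t) μH ρ hρ.1
  have hGr : ∀ r : ℝ, ((r : ℂ) • haarChannel t μH ρ).IsHermitian := by
    intro r
    rw [Matrix.IsHermitian, Matrix.conjTranspose_smul, hGh.eq]; simp
  have hq : ∀ y : (Fin t → ξ) → ℂ, ∃ φ g : ℝ,
      star y ⬝ᵥ ((∑ i, (p i : ℂ) • (tpowMat t (V i) * ρ * (tpowMat t (V i))ᴴ)) *ᵥ y) = (φ : ℂ) ∧
      star y ⬝ᵥ ((haarChannel t μH ρ) *ᵥ y) = (g : ℂ) ∧ |φ - g| ≤ ε * g := by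
    intro y
    obtain ⟨m, x, hx⟩ := Matrix.posSemidef_iff_eq_sum_vecMulVec.1 hρ
    choose φ g h1 h2 h3 using fun k => qf_key μH hμ p V hV δ ε hδ hε (vecMulVec y (star (x k)))
    refine ⟨∑ k, φ k, ∑ k, g k, ?_, ?_, ?_⟩
    · rw [← hΦeq, hx, quad_sum]; push_cast
      exact Finset.sum_congr rfl fun k _ => h1 k
    · rw [← hGeq, hx, quad_sum]; push_cast
      exact Finset.sum_congr rfl fun k _ => h2 k
    · rw [← Finset.sum_sub_distrib, Finset.mul_sum]
      exact (Finset.abs_sum_le_sum_abs _ _).trans (Finset.sum_le_sum fun k _ => h3 k)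
  constructor
  · refine Matrix.PosSemidef.of_dotProduct_mulVec_nonneg (hΦh.sub (hGr _)) fun y => ?_
    obtain ⟨φ, g, h1, h2, h3⟩ := hq y
    rw [Matrix.sub_mulVec, dotProduct_sub, Matrix.smul_mulVec, dotProduct_smul, h1, h2, smul_eq_mul,
      ← Complex.ofReal_mul, ← Complex.ofReal_sub, Complex.zero_le_real]
    have := (abs_le.1 h3).1
    linarith
  · refine Matrix.PosSemidef.of_dotProduct_mulVec_nonneg ((hGr _).sub hΦh) fun y => ?_
    obtain ⟨φ, g, h1, h2, h3⟩ := hq y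
    rw [Matrix.sub_mulVec, dotProduct_sub, Matrix.smul_mulVec, dotProduct_smul, h1, h2, smul_eq_mul,
      ← Complex.ofReal_mul, ← Complex.ofReal_sub, Complex.zero_le_real]
    have := (abs_le.1 h3).2
    linarith

end design

section blockdesign
variable {n t : ℕ} {X : Type*} [Fintype X]

lemma block_unitary (f : Fin (n / 2) → Matrix (Fin 4) (Fin 4) ℂ) (g : Fin ((n - 1) / 2) → Matrix (Fin 4) (Fin 4) ℂ)
    (hf : ∀ i, f i ∈ Matrix.unitaryGroup (Fin 4) ℂ) (hg : ∀ i, g i ∈ Matrix.unitaryGroup (Fin 4) ℂ) :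
    blockUnitary n f g ∈ Matrix.unitaryGroup (Fin n → Fin 2) ℂ := by
  unfold blockUnitary
  refine Submonoid.mul_mem _ ?_ ?_
  · refine Submonoid.list_prod_mem _ fun x hx => ?_
    rw [List.mem_ofFn] at hx
    obtain ⟨i, rfl⟩ := hx
    exact gate_unitary _ _ (by simp [Fin.ext_iff]) _ (hg i)
  · refine Submonoid.list_prod_mem _ fun x hx => ?_
    rw [List.mem_ofFn] at hx
    obtain ⟨i, rfl⟩ := hx
    exact gate_unitary _ _ (by simp [Fin.ext_iff]) _ (hf i)

lemma avg_GT {E : Type*} [NormedAddCommGroup E] [InnerProductSpace ℂ E] {Y : Type*} [Fintype Y] [Nonempty Y]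
    (G : E →L[ℂ] E) (F : Y → E →L[ℂ] E) (h : ∀ y v, G (F y v) = G v) :
    G * (((Fintype.card Y : ℂ))⁻¹ • ∑ y, F y) = G := by
  have hc : (Fintype.card Y : ℂ) ≠ 0 := by exact_mod_cast Fintype.card_ne_zero
  ext1 v
  show G (((Fintype.card Y : ℂ))⁻¹ • (∑ y, F y) v) = G v
  rw [ContinuousLinearMap.sum_apply, map_smul, map_sum, Finset.sum_congr rfl fun y _ => h y v, Finset.sum_const,
    Finset.card_univ, ← Nat.cast_smul_eq_nsmul ℂ, inv_smul_smul₀ hc]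

lemma avg_TG {E : Type*} [NormedAddCommGroup E] [InnerProductSpace ℂ E] {Y : Type*} [Fintype Y] [Nonempty Y]
    (G : E →L[ℂ] E) (F : Y → E →L[ℂ] E) (h : ∀ y v, F y (G v) = G v) :
    (((Fintype.card Y : ℂ))⁻¹ • ∑ y, F y) * G = G := by
  have hc : (Fintype.card Y : ℂ) ≠ 0 := by exact_mod_cast Fintype.card_ne_zero
  ext1 v
  show (((Fintype.card Y : ℂ))⁻¹ • (∑ y, F y) (G v)) = G v
  rw [ContinuousLinearMap.sum_apply, Finset.sum_congr rfl fun y _ => h y v, Finset.sum_const,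
    Finset.card_univ, ← Nat.cast_smul_eq_nsmul ℂ, inv_smul_smul₀ hc]

lemma proj_idem {E : Type*} [NormedAddCommGroup E] [InnerProductSpace ℂ E] (K : Submodule ℂ E) [K.HasOrthogonalProjection] :
    K.starProjection * K.starProjection = K.starProjection := by
  ext1 v
  exact Submodule.starProjection_eq_self_iff.2 (Submodule.starProjection_apply_mem _ _)

lemma pow_eq_avg {E : Type*} [NormedAddCommGroup E] [InnerProductSpace ℂ E] {Y : Type*} [Fintype Y]
    (F : Y → E →L[ℂ] E) (L : ℕ) :
    ((Fintype.card (Fin L → Y) : ℂ))⁻¹ • ∑ π : Fin L → Y, (List.ofFn fun l => F (π l)).prod =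
      (((Fintype.card Y : ℂ))⁻¹ • ∑ y, F y) ^ L := by
  rw [avg_ofFn L (fun _ => F), List.ofFn_const, List.prod_replicate]

theorem block_design [Nonempty X] (M : X → Matrix (Fin 4) (Fin 4) ℂ) (hM : ∀ x, M x ∈ Matrix.unitaryGroup (Fin 4) ℂ)
    (η : ℝ) (hη0 : 0 ≤ η)
    (hη : ∀ v : HSp (XX t n), ‖brk t n M v - (invF t (Fin n → Fin 2)).starProjection v‖ ≤ η * ‖v‖)
    (L : ℕ) (hL : 1 ≤ L) (ε : ℝ) (hε : η ^ L * ((2 : ℝ) ^ (n * t)) ^ 3 ≤ ε)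
    (μH : Measure (Matrix.unitaryGroup (Fin n → Fin 2) ℂ)) (hμ : μH.IsHaarMeasure) (hP : IsProbabilityMeasure μH) :
    IsApproxDesign t ε μH
      (fun _ : Fin L → (Fin (n / 2) → X) × (Fin ((n - 1) / 2) → X) =>
        (Fintype.card (Fin L → (Fin (n / 2) → X) × (Fin ((n - 1) / 2) → X)) : ℝ)⁻¹)
      (fun π => (List.ofFn fun l : Fin L =>
        blockUnitary n (fun i => M ((π l).1 i)) (fun i => M ((π l).2 i))).prod) := by
  have hbu : ∀ y : (Fin (n / 2) → X) × (Fin ((n - 1) / 2) → X),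
      blockUnitary n (fun i => M (y.1 i)) (fun i => M (y.2 i)) ∈ Matrix.unitaryGroup (Fin n → Fin 2) ℂ :=
    fun y => block_unitary _ _ (fun i => hM _) (fun i => hM _)
  refine design_of_norm μH hμ hP _ _ ?_ (η ^ L) ε ?_ ?_
  · intro π
    refine Submonoid.list_prod_mem _ fun x hx => ?_
    rw [List.mem_ofFn] at hx
    obtain ⟨i, rfl⟩ := hx
    exact hbu (π i)
  · have e := pow_eq_avg (fun y : (Fin (n / 2) → X) × (Fin ((n - 1) / 2) → X) =>
      ad t (blockUnitary n (fun i => M (y.1 i)) (fun i => M (y.2 i)))) L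
    have e2 : ∑ π : Fin L → (Fin (n / 2) → X) × (Fin ((n - 1) / 2) → X),
        (((Fintype.card (Fin L → (Fin (n / 2) → X) × (Fin ((n - 1) / 2) → X)) : ℝ)⁻¹ : ℝ) : ℂ) •
          ad t ((List.ofFn fun l : Fin L => blockUnitary n (fun i => M ((π l).1 i)) (fun i => M ((π l).2 i))).prod)
        = brk t n M ^ L := by
      rw [← Finset.smul_sum]
      refine Eq.trans ?_ e
      have : (((Fintype.card (Fin L → (Fin (n / 2) → X) × (Fin ((n - 1) / 2) → X)) : ℝ)⁻¹ : ℝ) : ℂ) =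
          ((Fintype.card (Fin L → (Fin (n / 2) → X) × (Fin ((n - 1) / 2) → X)) : ℂ))⁻¹ := by push_cast; rfl
      rw [this]
      refine congrArg _ (Finset.sum_congr rfl fun π _ => ?_)
      rw [ad_prod, List.map_ofFn]; rfl
    rw [e2]
    obtain ⟨L', rfl⟩ : ∃ L', L = L' + 1 := ⟨L - 1, by omega⟩
    refine pow_sub_proj _ _ ?_ ?_ (proj_idem _) η (ContinuousLinearMap.opNorm_le_bound _ hη0 hη) L'
    · exact avg_GT _ _ fun y v => invF_proj_ad _ (hbu y) v
    · exact avg_TG _ _ fun y v => (mem_invF _).1 (Submodule.starProjection_apply_mem _ _) _ (hbu y)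
  · refine le_trans (le_of_eq ?_) hε
    simp only [Fintype.card_fun, Fintype.card_fin]
    push_cast
    rw [pow_mul (2 : ℝ) n t]

end blockdesign

lemma fact_bound (t : ℕ) (ht : 2 ≤ t) : t.factorial * 16 ≤ 2 ^ (t ^ 2) + 16 := by
  induction t, ht using Nat.le_induction with
  | base => decide
  | succ t ht ih =>
    have h1 : 16 ≤ 2 ^ (t ^ 2) := by
      calc 16 = 2 ^ 4 := by norm_num
        _ ≤ 2 ^ (t ^ 2) := Nat.pow_le_pow_right (by norm_num) (by nlinarith)
    have h2 : t + 1 ≤ 2 ^ (2 * t) := by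
      have : 2 * t < 2 ^ (2 * t) := Nat.lt_two_pow_self
      omega
    rw [Nat.factorial_succ]
    have e : 2 ^ ((t + 1) ^ 2) = 2 ^ (t ^ 2) * (2 * 2 ^ (2 * t)) := by
      rw [← pow_succ', ← pow_add]; congr 1; ring
    rw [e]
    calc (t + 1) * t.factorial * 16 = (t + 1) * (t.factorial * 16) := by ring
      _ ≤ 2 ^ (2 * t) * (2 ^ (t ^ 2) + 2 ^ (t ^ 2)) := Nat.mul_le_mul h2 (by omega)
      _ = 2 ^ (t ^ 2) * (2 * 2 ^ (2 * t)) := by ring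
      _ ≤ _ := Nat.le_add_right _ _

/-- the inverse gap constant in the definition of `Pgap` -/
def dC (t : ℕ) : ℝ := (425 * ((⌊Real.logb 2 (4 * t)⌋ : ℤ) : ℝ) ^ 2 * (t : ℝ) ^ 5 *
      (t : ℝ) ^ ((3.1 : ℝ) / Real.log 2))⁻¹

lemma dC_bound (t : ℕ) (ht : 1 ≤ t) : 0 < dC t ∧ dC t ≤ (1700 * (t : ℝ) ^ 5)⁻¹ := by
  have ht' : (1 : ℝ) ≤ t := by exact_mod_cast ht
  have hm : (2 : ℝ) ≤ ((⌊Real.logb 2 (4 * t)⌋ : ℤ) : ℝ) := by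
    have : (2 : ℤ) ≤ ⌊Real.logb 2 (4 * t)⌋ := by
      rw [Int.le_floor, Real.le_logb_iff_rpow_le (by norm_num) (by positivity)]
      norm_num
      linarith
    exact_mod_cast this
  have hp : (1 : ℝ) ≤ (t : ℝ) ^ ((3.1 : ℝ) / Real.log 2) :=
    Real.one_le_rpow ht' (div_nonneg (by norm_num) (Real.log_nonneg (by norm_num)))
  have h5 : (1 : ℝ) ≤ (t : ℝ) ^ 5 := one_le_pow₀ ht'
  have hle : 1700 * (t : ℝ) ^ 5 ≤ 425 * ((⌊Real.logb 2 (4 * t)⌋ : ℤ) : ℝ) ^ 2 * (t : ℝ) ^ 5 *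
      (t : ℝ) ^ ((3.1 : ℝ) / Real.log 2) := by
    have h1 : (4 : ℝ) ≤ ((⌊Real.logb 2 (4 * t)⌋ : ℤ) : ℝ) ^ 2 := by nlinarith
    calc 1700 * (t : ℝ) ^ 5 = 425 * 4 * (t : ℝ) ^ 5 * 1 := by ring
      _ ≤ _ := by gcongr
  refine ⟨?_, ?_⟩
  · rw [dC]; exact inv_pos.2 (lt_of_lt_of_le (by positivity) hle)
  · rw [dC]; exact inv_anti₀ (by positivity) hle

lemma Pgap_eq (t : ℕ) : Pgap t = (1 + (1 / 2) * dC t) ^ (-(1 / 3 : ℝ)) := rfl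

lemma Pgap_pos (t : ℕ) (ht : 1 ≤ t) : 0 < Pgap t := by
  rw [Pgap_eq]
  have := (dC_bound t ht).1
  exact Real.rpow_pos_of_pos (by positivity) _

lemma Pgap_cube (t : ℕ) (ht : 1 ≤ t) : Pgap t ^ 3 * (1 + (1 / 2) * dC t) = 1 := by
  have := (dC_bound t ht).1
  have hb : 0 < 1 + (1 / 2) * dC t := by positivity
  rw [Pgap_eq, ← Real.rpow_natCast, ← Real.rpow_mul hb.le]
  norm_num
  rw [Real.rpow_neg_one]
  field_simp

lemma Pgap_sq (t : ℕ) (ht : 1 ≤ t) (Δ : ℝ) (hΔ : 0 ≤ Δ)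
    (h : (1700 * (t : ℝ) ^ 5)⁻¹ + (1700 * (t : ℝ) ^ 5)⁻¹ ^ 2 / 4 ≤ 3 * Δ / 4) :
    1 ≤ Pgap t ^ 2 * (1 + Δ / 4) := by
  obtain ⟨h0, h1⟩ := dC_bound t ht
  have hs := Pgap_pos t ht
  have hc := Pgap_cube t ht
  set s := Pgap t
  set d := dC t
  set D := (1700 * (t : ℝ) ^ 5)⁻¹
  have hb : 0 < 1 + (1 / 2) * d := by positivity
  have hdd : d + d ^ 2 / 4 ≤ 3 * Δ / 4 := by
    have : d ^ 2 ≤ D ^ 2 := pow_le_pow_left₀ h0.le h1 2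
    linarith
  have h3 : (1 + (1 / 2) * d) ^ 2 ≤ (1 + Δ / 4) ^ 3 := by
    have : (1 + Δ / 4) ^ 3 = 1 + 3 * Δ / 4 + 3 * (Δ / 4) ^ 2 + (Δ / 4) ^ 3 := by ring
    have h' : 0 ≤ 3 * (Δ / 4) ^ 2 + (Δ / 4) ^ 3 := by positivity
    nlinarith
  by_contra hlt
  push Not at hlt
  have h4 : (s ^ 2 * (1 + Δ / 4)) ^ 3 < 1 := pow_lt_one₀ (by positivity) hlt (by norm_num)
  have h5 : (s ^ 2 * (1 + Δ / 4)) ^ 3 = s ^ 6 * (1 + Δ / 4) ^ 3 := by ring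
  have h6 : s ^ 6 * (1 + (1 / 2) * d) ^ 2 = 1 := by
    calc s ^ 6 * (1 + (1 / 2) * d) ^ 2 = (s ^ 3 * (1 + (1 / 2) * d)) ^ 2 := by ring
      _ = 1 := by rw [hc]; norm_num
  have h7 : s ^ 6 * (1 + (1 / 2) * d) ^ 2 ≤ s ^ 6 * (1 + Δ / 4) ^ 3 := mul_le_mul_of_nonneg_left h3 (by positivity)
  linarith

lemma gap_const (t : ℕ) (ht : 1 ≤ t) : ∃ Δ : ℝ, 0 ≤ Δ ∧ 1 ≤ Pgap t ^ 2 * (1 + Δ / 4) ∧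
    ∀ n : ℕ, 3 * t ^ 2 ≤ n → ∀ v : HSp (XX t n), v ∈ (InvW t (Finset.univ : Finset (Fin n)))ᗮ →
      Δ * ‖v‖ ^ 2 ≤ ∑ i ∈ Finset.range (n - 1), eb t i v ^ 2 := by
  have ht' : (1 : ℝ) ≤ t := by exact_mod_cast ht
  have hpi : Real.pi ^ 2 < 10 := by
    have h1 := Real.pi_lt_d2
    have h2 := Real.pi_pos
    nlinarith
  have hpi0 : 0 < Real.pi ^ 2 := by positivity
  have ht2 : (1 : ℝ) ≤ (t : ℝ) ^ 2 := one_le_pow₀ ht'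
  have hK : 0 < 32 * Real.pi ^ 2 * (t : ℝ) ^ 2 * (3 * (t : ℝ) ^ 2 - 2) := by
    have : 0 < 3 * (t : ℝ) ^ 2 - 2 := by linarith
    positivity
  obtain ⟨ε, x, hx, hx1, hε0, hε, hxe, hD⟩ : ∃ ε x : ℝ, x = ((t.factorial : ℝ) - 1) * (1 / 2) ^ (t ^ 2) ∧ x < 1 ∧
      0 ≤ ε ∧ ε < 1 / 2 ∧ 2 * x ≤ ε * (1 - x) ∧
      (1700 * (t : ℝ) ^ 5)⁻¹ + (1700 * (t : ℝ) ^ 5)⁻¹ ^ 2 / 4 ≤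
        3 * ((1 - 2 * ε) / (32 * Real.pi ^ 2 * (t : ℝ) ^ 2 * (3 * (t : ℝ) ^ 2 - 2))) / 4 := by
    rcases Nat.lt_or_ge t 2 with h | h
    · have : t = 1 := by omega
      subst this
      refine ⟨0, 0, by simp, by norm_num, le_rfl, by norm_num, by norm_num, ?_⟩
      have : (1 : ℝ) / 320 ≤ (1 - 2 * 0) / (32 * Real.pi ^ 2 * ((1 : ℕ) : ℝ) ^ 2 * (3 * ((1 : ℕ) : ℝ) ^ 2 - 2)) := by
        push_cast
        rw [div_le_div_iff₀ (by norm_num) (by positivity)]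
        linarith
      refine le_trans ?_ (div_le_div_of_nonneg_right (mul_le_mul_of_nonneg_left this (by norm_num : (0 : ℝ) ≤ 3)) (by norm_num : (0 : ℝ) ≤ 4))
      norm_num
    · have h2 : (2 : ℝ) ≤ t := by exact_mod_cast h
      have hxb : ((t.factorial : ℝ) - 1) * (1 / 2) ^ (t ^ 2) ≤ 1 / 16 := by
        have h1 : (t.factorial : ℝ) * 16 ≤ 2 ^ (t ^ 2) + 16 := by exact_mod_cast fact_bound t h
        have h3 : (0 : ℝ) < 2 ^ (t ^ 2) := by positivity
        rw [div_pow, one_pow, mul_one_div, div_le_div_iff₀ h3 (by norm_num)]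
        linarith
      refine ⟨2 / 15, _, rfl, by linarith, by norm_num, by norm_num, by linarith, ?_⟩
      have h4 : (11 : ℝ) / 14400 / (t : ℝ) ^ 4 ≤ (1 - 2 * (2 / 15)) / (32 * Real.pi ^ 2 * (t : ℝ) ^ 2 * (3 * (t : ℝ) ^ 2 - 2)) := by
        have e : (11 : ℝ) / 14400 / (t : ℝ) ^ 4 = (1 - 2 * (2 / 15)) / (960 * (t : ℝ) ^ 4) := by
          field_simp; norm_num
        rw [e]
        refine div_le_div_of_nonneg_left (by norm_num) hK ?_
        have : 32 * Real.pi ^ 2 * (t : ℝ) ^ 2 * (3 * (t : ℝ) ^ 2 - 2) ≤ 32 * 10 * (t : ℝ) ^ 2 * (3 * (t : ℝ) ^ 2) := by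
          gcongr
          · have : 0 < 3 * (t : ℝ) ^ 2 - 2 := by linarith
            exact this.le
          · linarith
        linarith [this, show 32 * 10 * (t : ℝ) ^ 2 * (3 * (t : ℝ) ^ 2) = 960 * (t : ℝ) ^ 4 by ring]
      refine le_trans ?_ (div_le_div_of_nonneg_right (mul_le_mul_of_nonneg_left h4 (by norm_num : (0 : ℝ) ≤ 3)) (by norm_num : (0 : ℝ) ≤ 4))
      have h4p : (0 : ℝ) < (t : ℝ) ^ 4 := by positivity
      have h5 : (1700 * (t : ℝ) ^ 5)⁻¹ ≤ 1 / 3400 / (t : ℝ) ^ 4 := by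
        rw [div_div, one_div]
        refine inv_anti₀ (by positivity) ?_
        have : (t : ℝ) ^ 5 = t * (t : ℝ) ^ 4 := by ring
        rw [this]; nlinarith
      have h6 : (1700 * (t : ℝ) ^ 5)⁻¹ ≤ 1 := inv_le_one_of_one_le₀ (by
        have : (1 : ℝ) ≤ (t : ℝ) ^ 5 := one_le_pow₀ ht'
        linarith)
      have h7 : (0 : ℝ) ≤ (1700 * (t : ℝ) ^ 5)⁻¹ := by positivity
      have h8 : (1700 * (t : ℝ) ^ 5)⁻¹ ^ 2 ≤ (1700 * (t : ℝ) ^ 5)⁻¹ := by nlinarith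
      have h9 : (1700 * (t : ℝ) ^ 5)⁻¹ * (5 / 4) ≤ 1 / 3400 / (t : ℝ) ^ 4 * (5 / 4) := by linarith
      have h10 : 1 / 3400 / (t : ℝ) ^ 4 * (5 / 4) ≤ 3 * (11 / 14400 / (t : ℝ) ^ 4) / 4 := by
        have : 0 ≤ 1 / (t : ℝ) ^ 4 := by positivity
        have e1 : 1 / 3400 / (t : ℝ) ^ 4 * (5 / 4) = (1 / 3400 * (5 / 4)) * (1 / (t : ℝ) ^ 4) := by ring
        have e2 : 3 * (11 / 14400 / (t : ℝ) ^ 4) / 4 = (3 * 11 / 14400 / 4) * (1 / (t : ℝ) ^ 4) := by ring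
        rw [e1, e2]
        exact mul_le_mul_of_nonneg_right (by norm_num) this
      linarith
  have hΔ0 : 0 ≤ (1 - 2 * ε) / (32 * Real.pi ^ 2 * (t : ℝ) ^ 2 * (3 * (t : ℝ) ^ 2 - 2)) :=
    div_nonneg (by linarith) hK.le
  refine ⟨_, hΔ0, Pgap_sq t ht _ hΔ0 hD, fun n hn v hv => ?_⟩
  have := gap_main ht hn ε x hε0 hε hx hx1 hxe v hv
  rw [div_mul_eq_mul_div, div_le_iff₀ hK]
  linarith


lemma eta_pow (η ε : ℝ) (hη0 : 0 < η) (hη1 : η < 1) (hε0 : 0 < ε) (hε1 : ε < 1) (n t L : ℕ)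
    (h : (4 * n * t + Real.logb 2 (1 / ε)) / Real.logb 2 (1 / η) ≤ (L : ℝ)) :
    1 ≤ L ∧ η ^ L * ((2 : ℝ) ^ (n * t)) ^ 3 ≤ ε := by
  have hlη : 0 < Real.logb 2 (1 / η) := Real.logb_pos (by norm_num) (one_lt_one_div hη0 hη1)
  have hlε : 0 < Real.logb 2 (1 / ε) := Real.logb_pos (by norm_num) (one_lt_one_div hε0 hε1)
  have hnt : (0 : ℝ) ≤ n * t := by positivity
  rw [div_le_iff₀ hlη] at h
  refine ⟨?_, ?_⟩
  · rcases Nat.eq_zero_or_pos L with h0 | h0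
    · subst h0; simp only [Nat.cast_zero, zero_mul] at h
      nlinarith
    · exact h0
  · rw [one_div, Real.logb_inv] at h
    rw [one_div, Real.logb_inv] at h
    rw [← Real.logb_le_logb (b := 2) (by norm_num) (by positivity) hε0, Real.logb_mul (by positivity) (by positivity),
      Real.logb_pow, Real.logb_pow, Real.logb_pow, Real.logb_self_eq_one (by norm_num)]
    push_cast
    nlinarith

lemma lin_decay (k : ℕ → ℕ) (c : ℝ) (hc : 0 < c) (hk : ∀ n : ℕ, c * n ≤ (k n : ℝ)) (q : ℝ) (hq0 : 0 < q) (hq1 : q < 1)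
    (δ : ℝ) (hδ : 0 < δ) : ∃ N : ℕ, ∀ n, N ≤ n → (n : ℝ) * q ^ (k n) < δ := by
  have hp0 : 0 < q ^ c := Real.rpow_pos_of_pos hq0 c
  have hp1 : q ^ c < 1 := Real.rpow_lt_one hq0.le hq1 hc
  have ht := tendsto_self_mul_const_pow_of_lt_one hp0.le hp1
  have he := ht.eventually (gt_mem_nhds hδ)
  obtain ⟨N, hN⟩ := Filter.eventually_atTop.1 he
  refine ⟨N, fun n hn => lt_of_le_of_lt ?_ (hN n hn)⟩
  refine mul_le_mul_of_nonneg_left ?_ (Nat.cast_nonneg n)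
  rw [← Real.rpow_natCast, ← Real.rpow_natCast, ← Real.rpow_mul hq0.le]
  exact Real.rpow_le_rpow_of_exponent_ge hq0 hq1.le (hk n)

lemma eta_bound (P ε' α : ℝ) (n : ℕ) (hn : 1 ≤ n) (hP : 0 < P) (hε' : 0 < ε') (hα0 : 0 ≤ α) (hα1 : α ≤ 1 / 2)
    (h : (n : ℝ) * α < (1 - P - ε') / 2) :
    P + ε' ≤ (P + ε') / (1 - α) ^ (n - 1) + (1 - (1 - α) ^ (n - 1)) / (1 - α) ^ (n - 1) ∧
    (P + ε') / (1 - α) ^ (n - 1) + (1 - (1 - α) ^ (n - 1)) / (1 - α) ^ (n - 1) < 1 := by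
  have hb0 : 0 < (1 - α) ^ (n - 1) := pow_pos (by linarith) _
  have hb1 : (1 - α) ^ (n - 1) ≤ 1 := pow_le_one₀ (by linarith) (by linarith)
  have hbern : 1 + ((n - 1 : ℕ) : ℝ) * (-α) ≤ (1 + (-α)) ^ (n - 1) := one_add_mul_le_pow (by linarith) _
  rw [← sub_eq_add_neg] at hbern
  have hc : ((n - 1 : ℕ) : ℝ) ≤ n := by exact_mod_cast Nat.sub_le _ _
  have hlow : 1 - (n : ℝ) * α ≤ (1 - α) ^ (n - 1) := by nlinarith
  set b := (1 - α) ^ (n - 1)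
  constructor
  · have h1 : P + ε' ≤ (P + ε') / b := by rw [le_div_iff₀ hb0]; nlinarith
    have h2 : 0 ≤ (1 - b) / b := div_nonneg (by linarith) hb0.le
    linarith
  · rw [← add_div, div_lt_one hb0]; linarith

lemma kappa_bound (q α : ℝ) (hq : 0 ≤ q) (hα0 : 0 ≤ α) (hα1 : α ≤ 1 / 2) :
    0 ≤ (q + 2 * α) / (1 - α) ∧ (q + 2 * α) / (1 - α) ≤ 2 * q + 4 * α := by
  refine ⟨div_nonneg (by positivity) (by linarith), ?_⟩
  rw [div_le_iff₀ (by linarith)]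
  nlinarith

lemma k_lower (t : ℕ) (ht : 1 ≤ t) (ε' a : ℝ) (hε0 : 0 < ε') (hε1 : ε' < 1) (ha0 : 0 < a) (ha1 : a < 1) (k : ℕ → ℕ)
    (hk : ∀ n : ℕ, (10 * t + (n : ℝ) ^ 2 * t - n * t + n + Real.logb 2 (1 / ε')) /
            Real.logb 2 (1 / (1 + ((1 / 2 : ℝ) - 1) * a)) ≤ (k n : ℝ)) :
    ∃ c : ℝ, 0 < c ∧ ∀ n : ℕ, c * n ≤ (k n : ℝ) := by
  have hD : 0 < Real.logb 2 (1 / (1 + ((1 / 2 : ℝ) - 1) * a)) :=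
    Real.logb_pos (by norm_num) (one_lt_one_div (by linarith) (by linarith))
  have hlε : 0 < Real.logb 2 (1 / ε') := Real.logb_pos (by norm_num) (one_lt_one_div hε0 hε1)
  refine ⟨(Real.logb 2 (1 / (1 + ((1 / 2 : ℝ) - 1) * a)))⁻¹, inv_pos.2 hD, fun n => le_trans ?_ (hk n)⟩
  rw [mul_comm, ← div_eq_mul_inv]
  refine div_le_div_of_nonneg_right ?_ hD.le
  have h1 : (n : ℝ) * t ≤ (n : ℝ) ^ 2 * t := by
    refine mul_le_mul_of_nonneg_right ?_ (Nat.cast_nonneg t)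
    exact_mod_cast (by nlinarith [Nat.le_mul_self n] : n ≤ n ^ 2)
  have h2 : (0 : ℝ) ≤ t := Nat.cast_nonneg t
  linarith

/-- Theorem 5 of the paper: let `U_B ⊂ U(4)` be a partially invertible
universal set with invertible algebraic subset `U_M ⊊ U_B` and `a = |U_M|/|U_B|`, let
`t ≥ 1`, `0 < ε' < 1 − P(t)`, and (for some constant `0 < C < 1`) for each `n` let
`k n ≥ (10t + n²t − nt + n + log₂(1/ε')) / log₂(1/(1+(C−1)a))`. Then there exists
`n₀ ≥ ⌊2.5·log₂(4t)⌋` such that for all `n ≥ n₀` and every `0 < ε < 1`, the `n`-qubit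
ensemble `block^L(B₁)` is an `ε`-approximate unitary `t`-design on `U(2^n)` whenever
`L ≥ (4nt + log₂(1/ε)) / log₂(1/η)`, with
`η = (P(t) + ε')/(1 − a^{k n})^{n−1} + (1 − (1 − a^{k n})^{n−1})/(1 − a^{k n})^{n−1}`
and `B₁` the uniform ensemble on the relaxed seed `𝒰^{k n}`. -/
theorem block_L_B1_is_approx_design
    (UB UM : Finset (Matrix.unitaryGroup (Fin 4) ℂ))
    (hMB : UM ⊆ UB) (hMne : UM.Nonempty) (hproper : UM ≠ UB)
    (hMinv : ∀ U ∈ UM, U⁻¹ ∈ UM)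
    (hMalg : ∀ U ∈ UM, ∀ i j, IsAlgebraic ℚ ((U : Matrix (Fin 4) (Fin 4) ℂ) i j))
    (hdense : Dense ((Subgroup.closure (↑UB : Set (Matrix.unitaryGroup (Fin 4) ℂ)) :
        Subgroup (Matrix.unitaryGroup (Fin 4) ℂ)) : Set (Matrix.unitaryGroup (Fin 4) ℂ)))
    (t : ℕ) (ht : 1 ≤ t) :
    ∃ C : ℝ, 0 < C ∧ C < 1 ∧
      ∀ (ε' : ℝ), 0 < ε' → ε' < 1 - Pgap t →
      ∀ k : ℕ → ℕ,
        (∀ n : ℕ,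
          (10 * t + (n : ℝ) ^ 2 * t - n * t + n + Real.logb 2 (1 / ε')) /
            Real.logb 2 (1 / (1 + (C - 1) * ((UM.card : ℝ) / (UB.card : ℝ)))) ≤ (k n : ℝ)) →
      ∃ n₀ : ℕ, ⌊(2.5 : ℝ) * Real.logb 2 (4 * t)⌋ ≤ (n₀ : ℤ) ∧
        ∀ n : ℕ, n₀ ≤ n → ∀ ε : ℝ, 0 < ε → ε < 1 → ∀ L : ℕ,
          (4 * n * t + Real.logb 2 (1 / ε)) /
              Real.logb 2 (1 /
                ((Pgap t + ε') / (1 - ((UM.card : ℝ) / (UB.card : ℝ)) ^ k n) ^ (n - 1)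
                  + (1 - (1 - ((UM.card : ℝ) / (UB.card : ℝ)) ^ k n) ^ (n - 1))
                    / (1 - ((UM.card : ℝ) / (UB.card : ℝ)) ^ k n) ^ (n - 1))) ≤ (L : ℝ) →
          ∀ μH : Measure (Matrix.unitaryGroup (Fin n → Fin 2) ℂ),
            μH.IsHaarMeasure → IsProbabilityMeasure μH →
            IsApproxDesign t ε μH
              (fun _ : Fin L → (Fin (n / 2) → RelaxedWord UB UM (k n)) ×
                  (Fin ((n - 1) / 2) → RelaxedWord UB UM (k n)) =>
                (Fintype.card (Fin L → (Fin (n / 2) → RelaxedWord UB UM (k n)) ×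
                  (Fin ((n - 1) / 2) → RelaxedWord UB UM (k n))) : ℝ)⁻¹)
              (fun π =>
                (List.ofFn fun l : Fin L =>
                  blockUnitary n
                    (fun i => wordMat fun j => (((π l).1 i).1 j : Matrix.unitaryGroup (Fin 4) ℂ))
                    (fun i => wordMat fun j => (((π l).2 i).1 j : Matrix.unitaryGroup (Fin 4) ℂ))).prod) := by
  refine ⟨1 / 2, by norm_num, by norm_num, fun ε' hε'0 hε'1 k hk => ?_⟩
  have hMpos : 0 < UM.card := hMne.card_pos
  have hlt : UM.card < UB.card := Finset.card_lt_card (hMB.ssubset_of_ne hproper)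
  have hM' : (0 : ℝ) < UM.card := by exact_mod_cast hMpos
  have hB' : (0 : ℝ) < UB.card := by exact_mod_cast (hMpos.trans hlt)
  obtain ⟨a, ha⟩ : ∃ a : ℝ, a = (UM.card : ℝ) / (UB.card : ℝ) := ⟨_, rfl⟩
  simp only [← ha] at hk ⊢
  have ha0 : 0 < a := by rw [ha]; positivity
  have ha1 : a < 1 := by rw [ha, div_lt_one hB']; exact_mod_cast hlt
  have hP0 := Pgap_pos t ht
  obtain ⟨c, hc, hkc⟩ := k_lower t ht ε' a hε'0 (by linarith) ha0 ha1 k hk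
  obtain ⟨r, hr0, hr1, K, hK⟩ := gate_kappa (t := t) UB UM hMB hMne hMinv hdense
  obtain ⟨Δ, hΔ0, hsΔ, hgap⟩ := gap_const t ht
  obtain ⟨N1, hN1⟩ := lin_decay k c hc hkc r hr0 hr1 (ε' / 4) (by linarith)
  obtain ⟨N2, hN2⟩ := lin_decay k c hc hkc a ha0 ha1 (min (ε' / 8) (min (1 / 2) ((1 - Pgap t - ε') / 2)))
    (lt_min (by linarith) (lt_min (by norm_num) (by linarith)))
  obtain ⟨N3, hN3⟩ := exists_nat_ge ((K : ℝ) / c)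
  refine ⟨(⌊(2.5 : ℝ) * Real.logb 2 (4 * t)⌋).toNat + (3 * t ^ 2 + (N1 + (N2 + (N3 + 1)))), ?_, ?_⟩
  · have := Int.self_le_toNat ⌊(2.5 : ℝ) * Real.logb 2 (4 * t)⌋
    push_cast
    push_cast at this
    have h2 : (0 : ℤ) ≤ 3 * (t : ℤ) ^ 2 + (N1 + (N2 + (N3 + 1))) := by positivity
    linarith
  intro n hn ε hε0 hε1 L hL μH hμ hPr
  have hn1 : 1 ≤ n := by omega
  have hn1' : (1 : ℝ) ≤ n := by exact_mod_cast hn1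
  have hkK : K ≤ k n := by
    have h1 : (K : ℝ) ≤ c * n := by
      rw [div_le_iff₀ hc] at hN3
      have : (N3 : ℝ) ≤ n := by exact_mod_cast (by omega : N3 ≤ n)
      nlinarith
    exact_mod_cast h1.trans (hkc n)
  have hr := hN1 n (by omega)
  have hα := hN2 n (by omega)
  obtain ⟨hα1, hα2⟩ := lt_min_iff.1 hα
  obtain ⟨hα2, hα3⟩ := lt_min_iff.1 hα2
  have hrk0 : 0 ≤ r ^ k n := by positivity
  have hak0 : 0 ≤ a ^ k n := by positivity
  have hakh : a ^ k n ≤ 1 / 2 := by nlinarith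
  obtain ⟨hκ0, hκ1⟩ := kappa_bound (r ^ k n) (a ^ k n) hrk0 hak0 hakh
  obtain ⟨hη1, hη2⟩ := eta_bound (Pgap t) ε' (a ^ k n) n hn1 hP0 hε'0 hak0 hakh hα3
  obtain ⟨η, hη⟩ : ∃ η : ℝ, η = (Pgap t + ε') / (1 - a ^ k n) ^ (n - 1) +
      (1 - (1 - a ^ k n) ^ (n - 1)) / (1 - a ^ k n) ^ (n - 1) := ⟨_, rfl⟩
  rw [← hη] at hη1 hη2 hL
  have hη0 : 0 < η := by linarith
  obtain ⟨hL1, hLε⟩ := eta_pow η ε hη0 hη2 hε0 hε1 n t L hL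
  -- cardinality of the relaxed seed
  have hcard : (Fintype.card (RelaxedWord UB UM (k n)) : ℝ) = (UB.card : ℝ) ^ k n * (1 - a ^ k n) := by
    have h := (card_relaxed UB UM hMB (k n)).2
    have h' : (Fintype.card (RelaxedWord UB UM (k n)) : ℝ) + (UM.card : ℝ) ^ k n = (UB.card : ℝ) ^ k n := by
      exact_mod_cast h
    rw [ha, div_pow, mul_sub, mul_one, mul_div_cancel₀ _ (pow_pos hB' _).ne']
    linarith
  have hcpos : 0 < Fintype.card (RelaxedWord UB UM (k n)) := by
    have : (0 : ℝ) < Fintype.card (RelaxedWord UB UM (k n)) := by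
      rw [hcard]; exact mul_pos (pow_pos hB' _) (by linarith)
    exact_mod_cast this
  have hne : Nonempty (RelaxedWord UB UM (k n)) := Fintype.card_pos_iff.1 hcpos
  refine block_design (X := RelaxedWord UB UM (k n))
    (fun w => wordMat fun j => (w.1 j : Matrix.unitaryGroup (Fin 4) ℂ)) (fun w => word_unitary _)
    η hη0.le ?_ L hL1 ε hLε μH hμ hPr
  intro v
  have hclose := brk_close (n := n) (t := t) (X := RelaxedWord UB UM (k n))
    (fun w => wordMat fun j => (w.1 j : Matrix.unitaryGroup (Fin 4) ℂ)) (fun w => word_unitary _)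
    ((r ^ k n + 2 * a ^ k n) / (1 - a ^ k n)) hκ0 (fun u => ?_) Δ (Pgap t) hΔ0 hP0.le hsΔ hn1
    (hgap n (by omega)) v
  · rw [InvW_univ] at hclose
    refine hclose.trans (mul_le_mul_of_nonneg_right ?_ (norm_nonneg v))
    have : ((n : ℝ) - 1) * ((r ^ k n + 2 * a ^ k n) / (1 - a ^ k n)) ≤ ε' := by
      calc ((n : ℝ) - 1) * ((r ^ k n + 2 * a ^ k n) / (1 - a ^ k n)) ≤ (n : ℝ) * (2 * r ^ k n + 4 * a ^ k n) :=
            mul_le_mul (by linarith) hκ1 hκ0 (by linarith)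
        _ ≤ ε' := by nlinarith
    linarith
  · have h := relaxed_sum UB UM hMB (k n) (r ^ k n) (hK (k n) hkK) u
    refine h.trans (le_of_eq ?_)
    congr 1
    have h1 : 1 - a ^ k n ≠ 0 := by linarith
    rw [hcard, mul_assoc, mul_div_cancel₀ _ h1, ha, div_pow, mul_add]
    have h2 : (UB.card : ℝ) ^ k n ≠ 0 := (pow_pos hB' _).ne'
    field_simp


end
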